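/- Let p > 3 be a prime and n = 2(p-1). The subgroups E_R, E_{s,p-1-s} for 0 ≤ s ≤ (p-1)/2, E_2 and the diagonal Δ(E_2) of E_2 are pairwise non-conjugate in Out(F_n), and every nontrivial elementary abelian p-subgroup of Out(F_n) is conjugate to one of them. -/

import Mathlib

/-!
Formalization of statements from:
H. Glover, H.-W. Henn, "On the mod-p cohomology of Out(F_{2(p-1)})".
-/

noncomputable section
namespace OutFormal
open FreeGroup

/-! ### The outer automorphism group `Out G = Aut G / Inn G` -/

variable (G : Type) [Group G]

instance conjRangeNormal : ((MulAut.conj : G →* MulAut G).range).Normal := by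
  constructor
  rintro x ⟨g, rfl⟩ f
  refine ⟨f g, ?_⟩
  ext h
  simp only [MulAut.conj_apply, MulAut.mul_apply, MulAut.inv_def, _root_.map_mul,
    _root_.map_inv, MulEquiv.apply_symm_apply]

/-- `Out G = Aut G / Inn G`, the group of outer automorphisms of `G`. -/
def Out : Type := MulAut G ⧸ (MulAut.conj : G →* MulAut G).range

instance : Group (Out G) := QuotientGroup.Quotient.group _

/-- The class of an automorphism in `Out G`. -/
def Out.mk : MulAut G →* Out G := QuotientGroup.mk' _

/-- `Out(F_n)` for `F_n` the free group on `n` generators. -/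
abbrev OutF (n : ℕ) : Type := Out (FreeGroup (Fin n))

variable {G}

/-- The subgroups `H` and `K` of `G` are conjugate. -/
def SubConj (H K : Subgroup G) : Prop :=
  ∃ g : G, Subgroup.map (MulAut.conj g : G ≃* G).toMonoidHom H = K

/-- `H` is subconjugate to `K`, i.e. conjugate to a subgroup of `K`. -/
def SubConjLE (H K : Subgroup G) : Prop :=
  ∃ g : G, Subgroup.map (MulAut.conj g : G ≃* G).toMonoidHom H ≤ K

/-- An elementary abelian `p`-subgroup: an abelian subgroup of exponent dividing `p`. -/
def IsElementaryAbelian (p : ℕ) (H : Subgroup G) : Prop :=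
  (∀ a ∈ H, ∀ b ∈ H, a * b = b * a) ∧ ∀ a ∈ H, a ^ p = 1

/-- The set of outer classes of those automorphisms of the free group `F_n` which act on
the free basis, transported along the identification `eI : I ≃ Fin n`, by the
formula `rhs`.  (There is exactly one such automorphism.) -/
def formalGen {n : ℕ} {I : Type} (eI : I ≃ Fin n) (rhs : I → FreeGroup I) :
    Set (OutF n) :=
  {x | ∃ φ : MulAut (FreeGroup (Fin n)),
    (∀ k : I, φ (FreeGroup.of (eI k)) = FreeGroup.freeGroupCongr eI (rhs k)) ∧
      x = Out.mk _ φ}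

/-! ### The elementary abelian subgroups `E_R`, `E_{s,p-1-s}`, `E_2`, `Δ(E_2)` -/

/-- The effect, on the free basis `u_1, …, u_{p-1}` of the fundamental group of the graph
`Θ_{p-1}` (with `u_i = b_i b_0⁻¹` for the `p` edges `b_0, …, b_{p-1}`), of the graph
automorphism cyclically rotating the `p` edges. -/
def rotWord (p : ℕ) (hp : 0 < p - 1) (k : Fin (p - 1)) : FreeGroup (Fin (p - 1)) :=
  if h : (k : ℕ) + 1 < p - 1 then of ⟨(k : ℕ) + 1, h⟩ * (of ⟨0, hp⟩)⁻¹
  else (of ⟨0, hp⟩)⁻¹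

/-- Basis of `F_{2(p-1)}` adapted to the rose `R_{2(p-1)}`:
`p` petals `x_1, …, x_p` and `p-2` further petals `y_1, …, y_{p-2}`. -/
def eRose (p : ℕ) (h2 : 2 ≤ p) : Fin p ⊕ Fin (p - 2) ≃ Fin (2 * (p - 1)) :=
  finSumFinEquiv.trans (finCongr (by omega))

/-- The generator of `E_R`: it cyclically permutes the petals `x_1, …, x_p`
and fixes the petals `y_1, …, y_{p-2}`. -/
def rhsRose (p : ℕ) : Fin p ⊕ Fin (p - 2) → FreeGroup (Fin p ⊕ Fin (p - 2))
  | Sum.inl i => of (Sum.inl (finRotate p i))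
  | Sum.inr j => of (Sum.inr j)

/-- The subgroup `E_R ≤ Out(F_{2(p-1)})` of order `p` coming from the rose
`R_{2(p-1)}` with the identity marking. -/
def ERose (p : ℕ) (h2 : 2 ≤ p) : Subgroup (OutF (2 * (p - 1))) :=
  Subgroup.closure (formalGen (eRose p h2) (rhsRose p))

/-- Basis of `F_{2(p-1)}` adapted to the graph `Θ_{p-1}^{s,p-1-s}`:
`s` loops `a_i` at the base vertex, the `p-1` classes `u_i = b_i b_0⁻¹` of the edges of
`Θ_{p-1}`, and `p-1-s` loops `c_i` at the other vertex (conjugated back to the base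
vertex by the edge `b_0`). -/
def eTheta (p s : ℕ) (hs : s ≤ p - 1) (h2 : 2 ≤ p) :
    Fin s ⊕ (Fin (p - 1) ⊕ Fin (p - 1 - s)) ≃ Fin (2 * (p - 1)) :=
  ((Equiv.refl (Fin s)).sumCongr finSumFinEquiv).trans
    (finSumFinEquiv.trans (finCongr (by omega)))

/-- The generator of `E_{s,p-1-s}`, induced by the graph automorphism of
`Θ_{p-1}^{s,p-1-s}` cyclically rotating the `p` edges of `Θ_{p-1}` and fixing all
attached loops. -/
def rhsTheta (p s : ℕ) (hp : 0 < p - 1) :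
    Fin s ⊕ (Fin (p - 1) ⊕ Fin (p - 1 - s)) →
      FreeGroup (Fin s ⊕ (Fin (p - 1) ⊕ Fin (p - 1 - s)))
  | Sum.inl a => of (Sum.inl a)
  | Sum.inr (Sum.inl k) => FreeGroup.map (fun i => Sum.inr (Sum.inl i)) (rotWord p hp k)
  | Sum.inr (Sum.inr c) =>
      of (Sum.inr (Sum.inl ⟨0, hp⟩)) * of (Sum.inr (Sum.inr c)) *
        (of (Sum.inr (Sum.inl ⟨0, hp⟩)))⁻¹

/-- The subgroup `E_{s,p-1-s} ≤ Out(F_{2(p-1)})` of order `p` coming from the marked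
graph `Θ_{p-1}^{s,p-1-s}`. -/
def ETheta (p s : ℕ) (hs : s ≤ p - 1) (h2 : 2 ≤ p) : Subgroup (OutF (2 * (p - 1))) :=
  Subgroup.closure (formalGen (eTheta p s hs h2) (rhsTheta p s (by omega)))

/-- Basis of `F_{2(p-1)}` adapted to the wedge `Θ_{p-1} ∨ Θ_{p-1}` (based at the wedge
point): the edge classes `u_i` for the left copy and `w_i` for the right copy. -/
def eWedge (p : ℕ) : Fin (p - 1) ⊕ Fin (p - 1) ≃ Fin (2 * (p - 1)) :=
  finSumFinEquiv.trans (finCongr (by omega))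

/-- The automorphism rotating the `p` edges of the left copy of `Θ_{p-1}` in
`Θ_{p-1} ∨ Θ_{p-1}`. -/
def rhsWedgeL (p : ℕ) (hp : 0 < p - 1) :
    Fin (p - 1) ⊕ Fin (p - 1) → FreeGroup (Fin (p - 1) ⊕ Fin (p - 1))
  | Sum.inl k => FreeGroup.map Sum.inl (rotWord p hp k)
  | Sum.inr k => of (Sum.inr k)

/-- The automorphism rotating the `p` edges of the right copy of `Θ_{p-1}` in
`Θ_{p-1} ∨ Θ_{p-1}`. -/
def rhsWedgeR (p : ℕ) (hp : 0 < p - 1) :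
    Fin (p - 1) ⊕ Fin (p - 1) → FreeGroup (Fin (p - 1) ⊕ Fin (p - 1))
  | Sum.inl k => of (Sum.inl k)
  | Sum.inr k => FreeGroup.map Sum.inr (rotWord p hp k)

/-- The diagonal automorphism, rotating the `p` edges of both copies of `Θ_{p-1}`. -/
def rhsWedgeDiag (p : ℕ) (hp : 0 < p - 1) :
    Fin (p - 1) ⊕ Fin (p - 1) → FreeGroup (Fin (p - 1) ⊕ Fin (p - 1))
  | Sum.inl k => FreeGroup.map Sum.inl (rotWord p hp k)
  | Sum.inr k => FreeGroup.map Sum.inr (rotWord p hp k)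

/-- The subgroup `E_2 ≅ Z/p × Z/p` of `Out(F_{2(p-1)})`, generated by the two commuting
edge rotations of the two copies of `Θ_{p-1}` in the marked graph `Θ_{p-1} ∨ Θ_{p-1}`. -/
def E2 (p : ℕ) (h2 : 2 ≤ p) : Subgroup (OutF (2 * (p - 1))) :=
  Subgroup.closure
    (formalGen (eWedge p) (rhsWedgeL p (by omega)) ∪
      formalGen (eWedge p) (rhsWedgeR p (by omega)))

/-- The first factor `Z/p × 1` of `E_2`, generated by the left edge rotation.  Under the
identification of the subgroup `E_{0,p-1}` with a factor of `E_2` this is the subgroup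
denoted `E_{0,p-1}`. -/
def E2Left (p : ℕ) (h2 : 2 ≤ p) : Subgroup (OutF (2 * (p - 1))) :=
  Subgroup.closure (formalGen (eWedge p) (rhsWedgeL p (by omega)))

/-- The diagonal subgroup `Δ(E_2)` of `E_2`. -/
def EDiag (p : ℕ) (h2 : 2 ≤ p) : Subgroup (OutF (2 * (p - 1))) :=
  Subgroup.closure (formalGen (eWedge p) (rhsWedgeDiag p (by omega)))

/-! ### Auxiliary finite groups -/

/-- The symmetric group `Σ_p`. -/
abbrev SymN (p : ℕ) : Type := Equiv.Perm (Fin p)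

/-- The normalizer `N_{Σ_p}(Z/p)` of a subgroup of order `p` of the symmetric group
`Σ_p` (namely of the subgroup generated by the standard `p`-cycle). -/
def NSigma (p : ℕ) : Subgroup (SymN p) :=
  Subgroup.normalizer (Subgroup.zpowers (finRotate p))

/-- The cyclic group `Z/p`, written multiplicatively. -/
abbrev Zc (p : ℕ) : Type := Multiplicative (ZMod p)

/-- `Aut(F_s)`, the automorphism group of the free group of rank `s`. -/
abbrev AutF (s : ℕ) : Type := MulAut (FreeGroup (Fin s))

/-- The homomorphism `Z/2 →* M` sending the generator to a given element whose square
is `1`. -/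
def z2Hom {M : Type*} [Monoid M] (a : M) (ha : a * a = 1) : Zc 2 →* M where
  toFun x := a ^ (Multiplicative.toAdd x).val
  map_one' := by simp
  map_mul' x y := by
    have hsq : a ^ 2 = 1 := by rw [pow_two, ha]
    have key : ∀ m : ℕ, a ^ (m % 2) = a ^ m := by
      intro m
      conv_rhs => rw [← Nat.div_add_mod m 2]
      rw [pow_add, pow_mul, hsq, one_pow, one_mul]
    show a ^ (Multiplicative.toAdd (x * y)).val = _
    have : Multiplicative.toAdd (x * y) = Multiplicative.toAdd x + Multiplicative.toAdd y := rfl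
    rw [this, ZMod.val_add, key, pow_add]

/-- The swap automorphism of `A × A`. -/
def swapAut (A : Type) [Group A] : MulAut (A × A) :=
  (MulEquiv.prodComm : A × A ≃* A × A)

theorem swapAut_sq (A : Type) [Group A] : swapAut A * swapAut A = 1 := by
  ext x
  · rfl
  · rfl

/-- The wreath product `A ≀ Z/2 = (A × A) ⋊ Z/2`, with `Z/2` interchanging the two
factors. -/
def wr2 (A : Type) [Group A] : Type :=
  (A × A) ⋊[z2Hom (swapAut A) (swapAut_sq A)] Zc 2

instance (A : Type) [Group A] : Group (wr2 A) := by
  unfold wr2; infer_instance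

end OutFormal

namespace OutFormal
section PartSec1

/-! ### Canonical nested families of optimal cuts -/
section Nested
variable {V : Type}

/-- Two subsets are nested. -/
def Nst (a b : Set V) : Prop := a ⊆ b ∨ a ⊆ bᶜ ∨ aᶜ ⊆ b ∨ aᶜ ⊆ bᶜ

lemma Nst.symm {a b : Set V} (h : Nst a b) : Nst b a := by
  rcases h with h | h | h | h
  · exact Or.inr (Or.inr (Or.inr (Set.compl_subset_compl.2 h)))
  · exact Or.inr (Or.inl (Set.subset_compl_comm.1 h))
  · exact Or.inr (Or.inr (Or.inl (Set.compl_subset_comm.1 h)))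
  · exact Or.inl (Set.compl_subset_compl.1 h)

lemma Nst.compl_left {a b : Set V} (h : Nst a b) : Nst aᶜ b := by
  rcases h with h | h | h | h
  · right; right; left; rwa [compl_compl]
  · right; right; right; rwa [compl_compl]
  · left; exact h
  · right; left; exact h

lemma Nst.compl_right {a b : Set V} (h : Nst a b) : Nst a bᶜ := h.symm.compl_left.symm

lemma nst_compl_left {a b : Set V} : Nst aᶜ b ↔ Nst a b :=
  ⟨fun h => by simpa using h.compl_left, fun h => h.compl_left⟩

lemma nst_compl_right {a b : Set V} : Nst a bᶜ ↔ Nst a b :=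
  ⟨fun h => by simpa using h.compl_right, fun h => h.compl_right⟩

lemma nst_inter_self_left (a b : Set V) : Nst a (a ∩ b) :=
  Or.inr (Or.inr (Or.inr (Set.compl_subset_compl.2 Set.inter_subset_left)))

lemma nst_inter_self_right (a b : Set V) : Nst b (a ∩ b) :=
  Or.inr (Or.inr (Or.inr (Set.compl_subset_compl.2 Set.inter_subset_right)))

lemma nst_corner {a b c : Set V} (ha : Nst c a) (hb : Nst c b) (hab : ¬ Nst a b) :
    Nst c (a ∩ b) := by
  by_contra h
  simp only [Nst, not_or, Set.subset_def, Set.mem_compl_iff, Set.mem_inter_iff, not_forall] at *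
  grind

lemma nst_or {a b c : Set V} (ha : Nst c a) :
    Nst c (a ∩ b) ∨ Nst c (aᶜ ∩ bᶜ) := by
  by_contra h
  simp only [Nst, not_or, Set.subset_def, Set.mem_compl_iff, Set.mem_inter_iff, not_forall] at *
  grind

/-- Elements of `D` crossing `a`. -/
def Crs (D : Set (Set V)) (a : Set V) : Set (Set V) := {c | c ∈ D ∧ ¬ Nst c a}

lemma crs_compl (D : Set (Set V)) (a : Set V) : Crs D aᶜ = Crs D a := by
  ext c; simp [Crs, nst_compl_right]

lemma crs_corner {D : Set (Set V)} {a b : Set V} (haD : a ∈ D)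
    (hfa : (Crs D a).Finite) (hfb : (Crs D b).Finite) (hab : ¬ Nst a b) :
    (Crs D (a ∩ b)).ncard + (Crs D (aᶜ ∩ bᶜ)).ncard < (Crs D a).ncard + (Crs D b).ncard := by
  have hab' : ¬ Nst aᶜ bᶜ := by simpa [nst_compl_left, nst_compl_right] using hab
  have h1 : Crs D (a ∩ b) ∪ Crs D (aᶜ ∩ bᶜ) ⊆ Crs D a ∪ Crs D b := by
    rintro c (⟨hc, h⟩ | ⟨hc, h⟩)
    · by_contra hh
      simp only [Crs, Set.mem_union, Set.mem_setOf_eq, hc, true_and, not_or, not_not] at hh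
      exact h (nst_corner hh.1 hh.2 hab)
    · by_contra hh
      simp only [Crs, Set.mem_union, Set.mem_setOf_eq, hc, true_and, not_or, not_not] at hh
      exact h (nst_corner hh.1.compl_right hh.2.compl_right hab')
  have h2 : Crs D (a ∩ b) ∩ Crs D (aᶜ ∩ bᶜ) ⊆ Crs D a ∩ Crs D b := by
    rintro c ⟨⟨hc, h⟩, ⟨_, h'⟩⟩
    refine ⟨⟨hc, fun hh => ?_⟩, ⟨hc, fun hh => ?_⟩⟩
    · rcases nst_or (b := b) hh with k | k
      · exact h k
      · exact h' k
    · rcases nst_or (b := a) hh with k | k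
      · exact h (by rwa [Set.inter_comm] at k)
      · exact h' (by rwa [Set.inter_comm] at k)
  have hf : (Crs D a ∪ Crs D b).Finite := hfa.union hfb
  have hf' := hf.subset h1
  have h3 : (Crs D (a ∩ b) ∪ Crs D (aᶜ ∩ bᶜ)).ncard < (Crs D a ∪ Crs D b).ncard := by
    refine Set.ncard_lt_ncard ⟨h1, fun hh => ?_⟩ hf
    have : a ∈ Crs D a ∪ Crs D b := Or.inr ⟨haD, hab⟩
    rcases hh this with k | k
    · exact k.2 (nst_inter_self_left a b)
    · exact k.2 (nst_compl_left.1 (nst_inter_self_left aᶜ bᶜ))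
  have h4 := Set.ncard_le_ncard h2 (hfa.subset Set.inter_subset_left)
  have e1 := Set.ncard_union_add_ncard_inter (Crs D (a ∩ b)) (Crs D (aᶜ ∩ bᶜ))
    (hf'.subset Set.subset_union_left) (hf'.subset Set.subset_union_right)
  have e2 := Set.ncard_union_add_ncard_inter (Crs D a) (Crs D b) hfa hfb
  omega

variable (B : Set (Set V)) (d : Set V → ℕ) (K : ℕ)

/-- `a` is an optimal cut separating `u` from `v`. -/
def Opt (u v : Ultrafilter V) (a : Set V) : Prop :=
  a ∈ B ∧ a ∈ u ∧ a ∉ v ∧ ∀ b ∈ B, b ∈ u → b ∉ v → d a ≤ d b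

/-- All optimal cuts of size at most `K`. -/
def OptSet : Set (Set V) := {a | ∃ u v, Opt B d u v a ∧ d a ≤ K}

/-- A system of cuts. -/
structure CutSys : Prop where
  compl : ∀ a ∈ B, aᶜ ∈ B
  inter : ∀ a ∈ B, ∀ b ∈ B, a ∩ b ∈ B
  dcompl : ∀ a, d aᶜ = d a
  dsub : ∀ a ∈ B, ∀ b ∈ B, d (a ∩ b) + d (aᶜ ∩ bᶜ) ≤ d a + d b
  fin : ∀ a ∈ OptSet B d K, (Crs (OptSet B d K) a).Finite

/-- Optimal cuts of size `k` nested with `N`. -/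
def ANst (N : Set (Set V)) (k : ℕ) (u v : Ultrafilter V) : Set (Set V) :=
  {a | Opt B d u v a ∧ d a = k ∧ ∀ c ∈ N, Nst c a}

/-- The union of all `ANst`. -/
def DNst (N : Set (Set V)) (k : ℕ) : Set (Set V) :=
  {a | k ≤ K ∧ ∃ u v, a ∈ ANst B d N k u v}

/-- The canonical nested family, level by level. -/
def Nlt : ℕ → Set (Set V)
  | 0 => ∅
  | k + 1 => Nlt k ∪ {a | k ≤ K ∧ ∃ u v, a ∈ ANst B d (Nlt k) k u v ∧
      ∀ b ∈ ANst B d (Nlt k) k u v,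
        (Crs (DNst B d K (Nlt k) k) a).ncard ≤ (Crs (DNst B d K (Nlt k) k) b).ncard}

variable {B d K}

lemma ultra_compl_mem {u : Ultrafilter V} {a : Set V} : aᶜ ∈ u ↔ a ∉ u :=
  Ultrafilter.compl_mem_iff_notMem

lemma ultra_inter_mem {u : Ultrafilter V} {a b : Set V} : a ∩ b ∈ u ↔ a ∈ u ∧ b ∈ u :=
  Filter.inter_mem_iff

lemma Opt.compl (H : CutSys B d K) {u v : Ultrafilter V} {a : Set V} (h : Opt B d u v a) :
    Opt B d v u aᶜ := by
  obtain ⟨h1, h2, h3, h4⟩ := h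
  refine ⟨H.compl a h1, ultra_compl_mem.2 h3, fun h => ultra_compl_mem.1 h h2,
    fun b hb hbv hbu => ?_⟩
  have := h4 bᶜ (H.compl b hb) (ultra_compl_mem.2 hbu) (fun h => ultra_compl_mem.1 h hbv)
  rwa [H.dcompl] at this ⊢

/-- One uncrossing step: an optimal cut `a` crossing a strictly smaller optimal cut `c`. -/
lemma uncross_small (H : CutSys B d K) {u v : Ultrafilter V} {a c : Set V}
    (ha : Opt B d u v a) {u' v' : Ultrafilter V} (hc : Opt B d u' v' c) (hlt : d c < d a) :
    ∃ a', Opt B d u v a' ∧ d a' = d a ∧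
      (∃ x y, (x = a ∨ x = aᶜ) ∧ (y = c ∨ y = cᶜ) ∧ (a' = x ∩ y ∨ a' = (x ∩ y)ᶜ)) := by
  wlog hcu : c ∉ u generalizing c u' v'
  · rw [not_not] at hcu
    obtain ⟨a', h1, h2, x, y, hx, hy, h3⟩ := this (hc.compl H) (by rwa [H.dcompl])
      (fun h => ultra_compl_mem.1 h hcu)
    refine ⟨a', h1, h2, x, y, hx, ?_, h3⟩
    rw [compl_compl] at hy
    exact hy.symm
  have hcv : c ∉ v := by
    intro hcv
    have := ha.2.2.2 cᶜ (H.compl c hc.1) (ultra_compl_mem.2 hcu)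
      (fun h => ultra_compl_mem.1 h hcv)
    rw [H.dcompl] at this; omega
  have key : ∀ a' ∈ B, a' ∈ u → a' ∉ v → d a' ≤ d a → Opt B d u v a' ∧ d a' = d a := by
    intro a' hB hu hv hle
    refine ⟨⟨hB, hu, hv, fun b h1 h2 h3 => hle.trans (ha.2.2.2 b h1 h2 h3)⟩,
      le_antisymm hle (ha.2.2.2 a' hB hu hv)⟩
  have hac := H.compl a ha.1
  have hcc := H.compl c hc.1
  by_cases hau : a ∈ u'
  · have h1 := H.dsub a ha.1 c hc.1
    have h2 := hc.2.2.2 (a ∩ c) (H.inter _ ha.1 _ hc.1) (ultra_inter_mem.2 ⟨hau, hc.2.1⟩)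
      (fun h => hc.2.2.1 (ultra_inter_mem.1 h).2)
    obtain ⟨k1, k2⟩ := key (aᶜ ∩ cᶜ)ᶜ (H.compl _ (H.inter _ hac _ hcc))
      (ultra_compl_mem.2 fun h => ultra_compl_mem.1 (ultra_inter_mem.1 h).1 ha.2.1)
      (fun h => ultra_compl_mem.1 h (ultra_inter_mem.2
        ⟨ultra_compl_mem.2 ha.2.2.1, ultra_compl_mem.2 hcv⟩)) (by rw [H.dcompl]; omega)
    exact ⟨_, k1, k2, aᶜ, cᶜ, Or.inr rfl, Or.inr rfl, Or.inr rfl⟩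
  · have h1 := H.dsub aᶜ hac c hc.1
    have h2 := hc.2.2.2 (aᶜ ∩ c) (H.inter _ hac _ hc.1)
      (ultra_inter_mem.2 ⟨ultra_compl_mem.2 hau, hc.2.1⟩)
      (fun h => hc.2.2.1 (ultra_inter_mem.1 h).2)
    rw [compl_compl, H.dcompl] at h1
    obtain ⟨k1, k2⟩ := key (a ∩ cᶜ) (H.inter _ ha.1 _ hcc)
      (ultra_inter_mem.2 ⟨ha.2.1, ultra_compl_mem.2 hcu⟩)
      (fun h => ha.2.2.1 (ultra_inter_mem.1 h).1) (by omega)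
    exact ⟨_, k1, k2, a, cᶜ, Or.inl rfl, Or.inr rfl, Or.inl rfl⟩

/-- Existence of an optimal cut nested with a family of smaller cuts. -/
lemma exists_ANst (H : CutSys B d K) {N : Set (Set V)} {k : ℕ} (hk : k ≤ K)
    (hN : ∀ c ∈ N, ∃ u v, Opt B d u v c ∧ d c < k)
    (hNn : ∀ c ∈ N, ∀ c' ∈ N, Nst c c') {u v : Ultrafilter V} {a : Set V}
    (ha : Opt B d u v a) (hda : d a = k) : (ANst B d N k u v).Nonempty := by
  classical
  let f : Set V → ℕ := fun a => (Crs N a).ncard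
  obtain ⟨a0, ⟨h1, h2⟩, h3⟩ := WellFounded.has_min (InvImage.wf f Nat.lt_wfRel.wf)
    {a | Opt B d u v a ∧ d a = k} ⟨a, ha, hda⟩
  refine ⟨a0, h1, h2, fun c hc => ?_⟩
  by_contra hcross
  obtain ⟨u', v', hc1, hc2⟩ := hN c hc
  obtain ⟨a', g1, g2, x, y, hx, hy, g3⟩ := uncross_small H h1 hc1 (by omega)
  refine h3 a' ⟨g1, g2.trans h2⟩ ?_
  have hNM : N ⊆ OptSet B d K := fun c hc => by
    obtain ⟨u', v', hc1, hc2⟩ := hN c hc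
    exact ⟨u', v', hc1, by omega⟩
  have hfin : (Crs N a0).Finite :=
    (H.fin a0 ⟨u, v, h1, by omega⟩).subset fun c hc => ⟨hNM hc.1, hc.2⟩
  have hxy : ¬ Nst x y := by
    rcases hx with rfl | rfl <;> rcases hy with rfl | rfl <;>
      simpa [nst_compl_left, nst_compl_right] using fun h => hcross (Nst.symm h)
  have hxe : ∀ e, Nst e x ↔ Nst e a0 := by
    rcases hx with rfl | rfl <;> simp [nst_compl_right]
  have hye : ∀ e, Nst e y ↔ Nst e c := by
    rcases hy with rfl | rfl <;> simp [nst_compl_right]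
  have hae : ∀ e, Nst e a' ↔ Nst e (x ∩ y) := by
    rcases g3 with rfl | rfl <;> simp [nst_compl_right]
  have hyc : Nst c (x ∩ y) := by
    have := nst_inter_self_right x y
    rcases hy with rfl | rfl
    · exact this
    · exact nst_compl_left.1 this
  show (Crs N a').ncard < (Crs N a0).ncard
  refine Set.ncard_lt_ncard ⟨?_, ?_⟩ hfin
  · rintro e ⟨he, hn⟩
    refine ⟨he, fun hh => hn ?_⟩
    rw [hae]
    exact nst_corner ((hxe e).2 hh) ((hye e).2 (hNn e he c hc)) hxy
  · intro hh
    exact (hh (show c ∈ Crs N a0 from ⟨hc, hcross⟩)).2 ((hae c).2 hyc)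

/-- Minimal-crossing optimal cuts of the same size are nested. -/
lemma same_level (H : CutSys B d K) {N : Set (Set V)} {k : ℕ} (hk : k ≤ K)
    {u v u' v' : Ultrafilter V} {a b : Set V}
    (ha : a ∈ ANst B d N k u v)
    (hamin : ∀ c ∈ ANst B d N k u v,
      (Crs (DNst B d K N k) a).ncard ≤ (Crs (DNst B d K N k) c).ncard)
    (hb : b ∈ ANst B d N k u' v')
    (hbmin : ∀ c ∈ ANst B d N k u' v',
      (Crs (DNst B d K N k) b).ncard ≤ (Crs (DNst B d K N k) c).ncard) : Nst a b := by
  by_contra hab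
  set D := DNst B d K N k with hD
  have hDc : ∀ a ∈ D, aᶜ ∈ D := by
    rintro a ⟨hk, u, v, h1, h2, h3⟩
    exact ⟨hk, v, u, h1.compl H, by rwa [H.dcompl], fun c hc => (h3 c hc).compl_right⟩
  have hDM : D ⊆ OptSet B d K := by
    rintro a ⟨hk, u, v, h1, h2, h3⟩
    exact ⟨u, v, h1, by omega⟩
  have haD : a ∈ D := ⟨hk, u, v, ha⟩
  have hbD : b ∈ D := ⟨hk, u', v', hb⟩
  have hfin : ∀ a ∈ D, (Crs D a).Finite := fun a haD =>
    (H.fin a (hDM haD)).subset fun c hc => ⟨hDM hc.1, hc.2⟩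
  obtain ⟨hao, had, han⟩ := ha
  obtain ⟨hbo, hbd, hbn⟩ := hb
  have haB := hao.1
  have hbB := hbo.1
  -- separating sets
  have sepa : ∀ c ∈ B, (c ∈ u ∧ c ∉ v ∨ c ∉ u ∧ c ∈ v) → k ≤ d c := by
    rintro c hc (⟨h1, h2⟩ | ⟨h1, h2⟩)
    · have := hao.2.2.2 c hc h1 h2; omega
    · have := hao.2.2.2 cᶜ (H.compl c hc) (ultra_compl_mem.2 h1)
        (fun h => ultra_compl_mem.1 h h2)
      rw [H.dcompl] at this; omega
  have sepb : ∀ c ∈ B, (c ∈ u' ∧ c ∉ v' ∨ c ∉ u' ∧ c ∈ v') → k ≤ d c := by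
    rintro c hc (⟨h1, h2⟩ | ⟨h1, h2⟩)
    · have := hbo.2.2.2 c hc h1 h2; omega
    · have := hbo.2.2.2 cᶜ (H.compl c hc) (ultra_compl_mem.2 h1)
        (fun h => ultra_compl_mem.1 h h2)
      rw [H.dcompl] at this; omega
  have mina : ∀ c ∈ B, (c ∈ u ∧ c ∉ v ∨ c ∉ u ∧ c ∈ v) → d c = k → (∀ e ∈ N, Nst e c) →
      (Crs D a).ncard ≤ (Crs D c).ncard := by
    rintro c hc (⟨h1, h2⟩ | ⟨h1, h2⟩) hd hn
    · exact hamin c ⟨⟨hc, h1, h2, fun e he h3 h4 => hd ▸ sepa e he (Or.inl ⟨h3, h4⟩)⟩, hd, hn⟩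
    · rw [← crs_compl D c]
      exact hamin cᶜ ⟨⟨H.compl c hc, ultra_compl_mem.2 h1, fun h => ultra_compl_mem.1 h h2,
        fun e he h3 h4 => by rw [H.dcompl, hd]; exact sepa e he (Or.inl ⟨h3, h4⟩)⟩,
        by rw [H.dcompl, hd], fun e he => (hn e he).compl_right⟩
  have minb : ∀ c ∈ B, (c ∈ u' ∧ c ∉ v' ∨ c ∉ u' ∧ c ∈ v') → d c = k → (∀ e ∈ N, Nst e c) →
      (Crs D b).ncard ≤ (Crs D c).ncard := by
    rintro c hc (⟨h1, h2⟩ | ⟨h1, h2⟩) hd hn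
    · exact hbmin c ⟨⟨hc, h1, h2, fun e he h3 h4 => hd ▸ sepb e he (Or.inl ⟨h3, h4⟩)⟩, hd, hn⟩
    · rw [← crs_compl D c]
      exact hbmin cᶜ ⟨⟨H.compl c hc, ultra_compl_mem.2 h1, fun h => ultra_compl_mem.1 h h2,
        fun e he h3 h4 => by rw [H.dcompl, hd]; exact sepb e he (Or.inl ⟨h3, h4⟩)⟩,
        by rw [H.dcompl, hd], fun e he => (hn e he).compl_right⟩
  -- corners
  have hBac := H.compl a haB
  have hBbc := H.compl b hbB
  have c11 := H.inter a haB b hbB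
  have c00 := H.inter _ hBac _ hBbc
  have c10 := H.inter a haB _ hBbc
  have c01 := H.inter _ hBac b hbB
  have s1 := H.dsub a haB b hbB
  have s2 := H.dsub a haB bᶜ hBbc
  rw [compl_compl, H.dcompl] at s2
  have x1 := crs_corner haD (hfin a haD) (hfin b hbD) hab
  have x2 := crs_corner haD (hfin a haD) (hfin bᶜ (hDc b hbD))
    (by simpa [nst_compl_right] using hab)
  rw [compl_compl, crs_compl] at x2
  have n11 : ∀ e ∈ N, Nst e (a ∩ b) := fun e he => nst_corner (han e he) (hbn e he) hab
  have n00 : ∀ e ∈ N, Nst e (aᶜ ∩ bᶜ) := fun e he =>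
    nst_corner (han e he).compl_right (hbn e he).compl_right
      (by simpa [nst_compl_right, nst_compl_left] using hab)
  have n10 : ∀ e ∈ N, Nst e (a ∩ bᶜ) := fun e he =>
    nst_corner (han e he) (hbn e he).compl_right (by simpa [nst_compl_right] using hab)
  have n01 : ∀ e ∈ N, Nst e (aᶜ ∩ b) := fun e he =>
    nst_corner (han e he).compl_right (hbn e he) (by simpa [nst_compl_left] using hab)
  obtain ⟨-, au, av, -⟩ := hao
  obtain ⟨-, bu', bv', -⟩ := hbo
  have A11 := sepa _ c11
  have A00 := sepa _ c00
  have A10 := sepa _ c10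
  have A01 := sepa _ c01
  have B11 := sepb _ c11
  have B00 := sepb _ c00
  have B10 := sepb _ c10
  have B01 := sepb _ c01
  have MA11 := mina _ c11
  have MA00 := mina _ c00
  have MA10 := mina _ c10
  have MA01 := mina _ c01
  have MB11 := minb _ c11
  have MB00 := minb _ c00
  have MB10 := minb _ c10
  have MB01 := minb _ c01
  replace MA11 := fun h h' => MA11 h h' n11
  replace MA00 := fun h h' => MA00 h h' n00
  replace MA10 := fun h h' => MA10 h h' n10
  replace MA01 := fun h h' => MA01 h h' n01
  replace MB11 := fun h h' => MB11 h h' n11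
  replace MB00 := fun h h' => MB00 h h' n00
  replace MB10 := fun h h' => MB10 h h' n10
  replace MB01 := fun h h' => MB01 h h' n01
  clear sepa sepb mina minb hamin hbmin n11 n00 n10 n01
  simp only [ultra_inter_mem, ultra_compl_mem] at *
  by_cases q1 : b ∈ u <;> by_cases q2 : b ∈ v <;> by_cases q3 : a ∈ u' <;>
    by_cases q4 : a ∈ v' <;>
    simp only [au, av, bu', bv', q1, q2, q3, q4, not_true_eq_false, not_false_eq_true, and_true,
      true_and, and_false, false_and, or_true, true_or, or_false, false_or, and_self, or_self,
      forall_true_left, false_implies] at * <;> omega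

theorem Nlt_spec (H : CutSys B d K) (k : ℕ) :
    (∀ a ∈ Nlt B d K k, ∃ u v, Opt B d u v a ∧ d a < k ∧ d a ≤ K) ∧
    (∀ a ∈ Nlt B d K k, aᶜ ∈ Nlt B d K k) ∧
    (∀ a ∈ Nlt B d K k, ∀ b ∈ Nlt B d K k, Nst a b) ∧
    (∀ u v a, Opt B d u v a → d a < k → d a ≤ K → ∃ b ∈ Nlt B d K k, Opt B d u v b) := by
  induction k with
  | zero => simp [Nlt]
  | succ k ih =>
    obtain ⟨i1, i2, i3, i4⟩ := ih
    refine ⟨?_, ?_, ?_, ?_⟩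
    · rintro a (ha | ⟨hk, u, v, ha, -⟩)
      · obtain ⟨u, v, h1, h2, h3⟩ := i1 a ha
        exact ⟨u, v, h1, by omega, h3⟩
      · exact ⟨u, v, ha.1, by have := ha.2.1; omega, by have := ha.2.1; omega⟩
    · rintro a (ha | ⟨hk, u, v, ha, hm⟩)
      · exact Or.inl (i2 a ha)
      · refine Or.inr ⟨hk, v, u, ⟨ha.1.compl H, by rw [H.dcompl]; exact ha.2.1,
          fun c hc => (ha.2.2 c hc).compl_right⟩, fun b hb => ?_⟩
        rw [crs_compl, ← crs_compl _ b]
        exact hm bᶜ ⟨hb.1.compl H, by rw [H.dcompl]; exact hb.2.1,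
          fun c hc => (hb.2.2 c hc).compl_right⟩
    · rintro a (ha | ⟨hk, u, v, ha, hm⟩) b (hb | ⟨hk', u', v', hb, hm'⟩)
      · exact i3 a ha b hb
      · exact hb.2.2 a ha
      · exact (ha.2.2 b hb).symm
      · exact same_level H hk ha hm hb hm'
    · intro u v a ha h1 h2
      rcases Nat.lt_succ_iff_lt_or_eq.1 h1 with h | h
      · obtain ⟨b, hb, hb'⟩ := i4 u v a ha h h2
        exact ⟨b, Or.inl hb, hb'⟩
      · have hne := exists_ANst H (N := Nlt B d K k) (k := k) (by omega)
          (fun c hc => by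
            obtain ⟨u, v, h1, h2, h3⟩ := i1 c hc
            exact ⟨u, v, h1, h2⟩) i3 ha h
        obtain ⟨b, hb, hmin⟩ := WellFounded.has_min
          (InvImage.wf (fun a => (Crs (DNst B d K (Nlt B d K k) k) a).ncard) Nat.lt_wfRel.wf)
          _ hne
        exact ⟨b, Or.inr ⟨by omega, u, v, hb, fun c hc => not_lt.1 (hmin c hc)⟩, hb.1⟩

lemma image_compl_perm (e : Equiv.Perm V) (a : Set V) : e '' aᶜ = (e '' a)ᶜ :=
  Set.image_compl_eq e.bijective

lemma nst_image (e : Equiv.Perm V) (a b : Set V) : Nst (e '' a) (e '' b) ↔ Nst a b := by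
  simp only [Nst, ← image_compl_perm, Set.image_subset_image_iff e.injective]

lemma Opt_image (e : Equiv.Perm V) (hB : ∀ a, e '' a ∈ B ↔ a ∈ B) (hd : ∀ a, d (e '' a) = d a)
    (u v : Ultrafilter V) (a : Set V) :
    Opt B d (u.map e) (v.map e) (e '' a) ↔ Opt B d u v a := by
  have hm : ∀ (w : Ultrafilter V) (a : Set V), e '' a ∈ w.map e ↔ a ∈ w := by
    intro w a
    rw [Ultrafilter.mem_map, Set.preimage_image_eq _ e.injective]
  have hs : ∀ b : Set V, ∃ c, b = e '' c := fun b =>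
    ⟨e ⁻¹' b, (Set.image_preimage_eq b e.surjective).symm⟩
  unfold Opt
  rw [hB, hm, hm, hd]
  refine and_congr_right fun _ => and_congr_right fun _ => and_congr_right fun _ => ?_
  constructor
  · intro h b hb h1 h2
    have := h (e '' b) ((hB b).2 hb) ((hm u b).2 h1) (fun h => h2 ((hm v b).1 h))
    rwa [hd] at this
  · intro h b hb h1 h2
    obtain ⟨c, rfl⟩ := hs b
    rw [hd]
    exact h c ((hB c).1 hb) ((hm u c).1 h1) (fun h => h2 ((hm v c).2 h))

lemma Nlt_image (e : Equiv.Perm V) (hB : ∀ a, e '' a ∈ B ↔ a ∈ B) (hd : ∀ a, d (e '' a) = d a)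
    (k : ℕ) (a : Set V) : e '' a ∈ Nlt B d K k ↔ a ∈ Nlt B d K k := by
  have hs : ∀ b : Set V, ∃ c, b = e '' c := fun b =>
    ⟨e ⁻¹' b, (Set.image_preimage_eq b e.surjective).symm⟩
  have hu : ∀ w : Ultrafilter V, ∃ w', w = Ultrafilter.map e w' := fun w =>
    ⟨w.map e.symm, by rw [Ultrafilter.map_map]; simp⟩
  induction k generalizing a with
  | zero => simp [Nlt]
  | succ k ih =>
    have hA : ∀ u v a, e '' a ∈ ANst B d (Nlt B d K k) k (u.map e) (v.map e) ↔
        a ∈ ANst B d (Nlt B d K k) k u v := by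
      intro u v a
      simp only [ANst, Set.mem_setOf_eq, Opt_image e hB hd, hd]
      refine and_congr_right fun _ => and_congr_right fun _ => ?_
      constructor
      · intro h c hc
        exact (nst_image e c a).1 (h _ ((ih c).2 hc))
      · intro h c hc
        obtain ⟨c, rfl⟩ := hs c
        exact (nst_image e c a).2 (h _ ((ih c).1 hc))
    have hD : ∀ a, e '' a ∈ DNst B d K (Nlt B d K k) k ↔ a ∈ DNst B d K (Nlt B d K k) k := by
      intro a
      simp only [DNst, Set.mem_setOf_eq]
      refine and_congr_right fun _ => ⟨?_, ?_⟩
      · rintro ⟨u, v, h⟩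
        obtain ⟨u, rfl⟩ := hu u
        obtain ⟨v, rfl⟩ := hu v
        exact ⟨u, v, (hA u v a).1 h⟩
      · rintro ⟨u, v, h⟩
        exact ⟨_, _, (hA u v a).2 h⟩
    have hC : ∀ a, (Crs (DNst B d K (Nlt B d K k) k) (e '' a)).ncard =
        (Crs (DNst B d K (Nlt B d K k) k) a).ncard := by
      intro a
      have : Crs (DNst B d K (Nlt B d K k) k) (e '' a) =
          (fun b => e '' b) '' Crs (DNst B d K (Nlt B d K k) k) a := by
        ext c
        obtain ⟨c, rfl⟩ := hs c
        simp only [Crs, Set.mem_setOf_eq, Set.mem_image]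
        rw [hD, nst_image]
        constructor
        · intro h
          exact ⟨c, h, rfl⟩
        · rintro ⟨x, h, hx⟩
          rwa [← e.injective.image_injective hx]
      rw [this, Set.ncard_image_of_injective _ e.injective.image_injective]
    simp only [Nlt, Set.mem_union, ih, Set.mem_setOf_eq]
    refine or_congr_right (and_congr_right fun _ => ⟨?_, ?_⟩)
    · rintro ⟨u, v, h, hm⟩
      obtain ⟨u, rfl⟩ := hu u
      obtain ⟨v, rfl⟩ := hu v
      refine ⟨u, v, (hA u v a).1 h, fun b hb => ?_⟩
      rw [← hC a, ← hC b]
      exact hm _ ((hA u v b).2 hb)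
    · rintro ⟨u, v, h, hm⟩
      refine ⟨_, _, (hA u v a).2 h, fun b hb => ?_⟩
      obtain ⟨b, rfl⟩ := hs b
      rw [hC a, hC b]
      exact hm _ ((hA u v b).1 hb)

end Nested
end PartSec1
end OutFormal

namespace OutFormal
section PartSec2

/-! ### Cuts in Cayley graphs -/
section Cayley
variable {Γ : Type} [Group Γ] (S : Finset Γ)

/-- The coboundary of a set of vertices of the Cayley graph. -/
def bd (a : Set Γ) : Set (Γ × Γ) := {q | q.2 ∈ S ∧ ¬ (q.1 ∈ a ↔ q.1 * q.2 ∈ a)}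

/-- Connected on the inside. -/
def Tight (a : Set Γ) : Prop := ∀ b ⊆ a, bd S b ⊆ bd S a → b = ∅ ∨ b = a

/-- Tight cuts of bounded size. -/
def TT (k : ℕ) : Set (Set Γ) :=
  {a | Tight S a ∧ Tight S aᶜ ∧ (bd S a).Finite ∧ (bd S a).ncard ≤ k}

/-- Finite cuts. -/
def BC : Set (Set Γ) := {a | (bd S a).Finite}

/-- The size of a cut. -/
def dC (a : Set Γ) : ℕ := (bd S a).ncard

variable {S}

lemma mem_bd {a : Set Γ} {q : Γ × Γ} : q ∈ bd S a ↔ q.2 ∈ S ∧ ¬ (q.1 ∈ a ↔ q.1 * q.2 ∈ a) :=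
  Iff.rfl

lemma bd_compl (a : Set Γ) : bd S aᶜ = bd S a := by
  ext q; simp only [mem_bd, Set.mem_compl_iff, not_iff_not]

lemma bd_inter_sub (a b : Set Γ) : bd S (a ∩ b) ⊆ bd S a ∪ bd S b := by
  rintro q ⟨h1, h2⟩
  simp only [Set.mem_union, mem_bd, Set.mem_inter_iff] at *
  grind

lemma bd_compl_inter_sub (a b : Set Γ) : bd S (aᶜ ∩ bᶜ) ⊆ bd S a ∪ bd S b := by
  have := bd_inter_sub (S := S) aᶜ bᶜ
  rwa [bd_compl, bd_compl] at this

lemma bd_sub2 (a b : Set Γ) : bd S (a ∩ b) ∩ bd S (aᶜ ∩ bᶜ) ⊆ bd S a ∩ bd S b := by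
  rintro q ⟨⟨h1, h2⟩, ⟨_, h4⟩⟩
  simp only [Set.mem_inter_iff, mem_bd, Set.mem_compl_iff] at *
  grind

lemma dC_sub (a b : Set Γ) (ha : a ∈ BC S) (hb : b ∈ BC S) :
    dC S (a ∩ b) + dC S (aᶜ ∩ bᶜ) ≤ dC S a + dC S b := by
  unfold dC
  have hf : (bd S a ∪ bd S b).Finite := Set.Finite.union ha hb
  have f1 := hf.subset (bd_inter_sub a b)
  have f2 := hf.subset (bd_compl_inter_sub a b)
  have e1 := Set.ncard_union_add_ncard_inter _ _ f1 f2
  have e2 := Set.ncard_union_add_ncard_inter _ _ ha hb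
  have e3 := Set.ncard_le_ncard (Set.union_subset (bd_inter_sub a b) (bd_compl_inter_sub a b)) hf
  have e4 := Set.ncard_le_ncard (bd_sub2 (S := S) a b) (Set.Finite.subset ha Set.inter_subset_left)
  omega

lemma bd_eq_empty (hS : Subgroup.closure (S : Set Γ) = ⊤) {a : Set Γ} (h : bd S a = ∅) :
    a = ∅ ∨ a = Set.univ := by
  have key : ∀ g : Γ, ∀ x, x ∈ a ↔ x * g ∈ a := by
    intro g
    have hg : g ∈ Subgroup.closure (S : Set Γ) := by rw [hS]; trivial
    induction hg using Subgroup.closure_induction with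
    | mem s hs =>
      intro x
      by_contra hh
      have : (x, s) ∈ bd S a := ⟨hs, hh⟩
      rw [h] at this; exact this
    | one => simp
    | mul g h _ _ i1 i2 => intro x; rw [i1 x, i2 (x * g), mul_assoc]
    | inv g _ i => intro x; rw [i (x * g⁻¹)]; simp
  rcases a.eq_empty_or_nonempty with h | ⟨x, hx⟩
  · exact Or.inl h
  · right
    ext y
    simp only [Set.mem_univ, iff_true]
    have := (key (x⁻¹ * y) x).1 hx
    simpa using this

lemma opt_tight (hS : Subgroup.closure (S : Set Γ) = ⊤) {u v : Ultrafilter Γ} {a : Set Γ}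
    (h : Opt (BC S) (dC S) u v a) : Tight S a := by
  obtain ⟨hB, hu, hv, hmin⟩ := h
  intro b hba hbd
  by_contra hcon
  push Not at hcon
  obtain ⟨hne, hne'⟩ := hcon
  have hc : bd S (a \ b) ⊆ bd S a := by
    rintro q ⟨h1, h2⟩
    by_contra hq
    have hqb : q ∉ bd S b := fun h => hq (hbd h)
    have := @hba q.1
    have := @hba (q.1 * q.2)
    simp only [mem_bd, h1, true_and, not_not, Set.mem_sdiff] at *
    grind
  have hdis : Disjoint (bd S b) (bd S (a \ b)) := by
    rw [Set.disjoint_left]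
    intro q h1 h2
    have h3 := hbd h1
    have := @hba q.1
    have := @hba (q.1 * q.2)
    simp only [mem_bd, Set.mem_sdiff] at *
    grind
  obtain ⟨z, hza, hzb⟩ : ∃ z ∈ a, z ∉ b := by
    by_contra hh; push Not at hh
    exact hne' (Set.Subset.antisymm hba hh)
  obtain ⟨y, hy⟩ := hne
  have n1 : (bd S b).Nonempty := by
    rw [Set.nonempty_iff_ne_empty]
    intro h
    rcases bd_eq_empty hS h with h | h
    · rw [h] at hy; exact hy
    · rw [h] at hzb; exact hzb trivial
  have n2 : (bd S (a \ b)).Nonempty := by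
    rw [Set.nonempty_iff_ne_empty]
    intro h
    rcases bd_eq_empty hS h with h | h
    · have : z ∈ a \ b := ⟨hza, hzb⟩
      rw [h] at this; exact this
    · have : y ∈ a \ b := by rw [h]; trivial
      exact this.2 hy
  have fa : (bd S a).Finite := hB
  have fb := fa.subset hbd
  have fc := fa.subset hc
  have c1 := (Set.ncard_pos fb).2 n1
  have c2 := (Set.ncard_pos fc).2 n2
  have c3 := Set.ncard_union_eq hdis fb fc
  have c4 := Set.ncard_le_ncard (Set.union_subset hbd hc) fa
  have hvb : ∀ c ⊆ a, c ∉ v := fun c hc h => hv (Filter.mem_of_superset h hc)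
  have hub : b ∈ u ∨ a \ b ∈ u := by
    rw [← Ultrafilter.union_mem_iff, Set.union_sdiff_cancel hba]; exact hu
  rcases hub with h | h
  · have := hmin b fb h (hvb b hba)
    unfold dC at this; omega
  · have := hmin _ fc h (hvb _ Set.sdiff_subset)
    unfold dC at this; omega

lemma dC_compl (a : Set Γ) : dC S aᶜ = dC S a := by unfold dC; rw [bd_compl]

lemma opt_compl' {u v : Ultrafilter Γ} {a : Set Γ}
    (h : Opt (BC S) (dC S) u v a) : Opt (BC S) (dC S) v u aᶜ := by
  obtain ⟨hB, hu, hv, hmin⟩ := h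
  refine ⟨?_, ultra_compl_mem.2 hv, fun h => ultra_compl_mem.1 h hu, ?_⟩
  · show (bd S aᶜ).Finite; rw [bd_compl]; exact hB
  · intro b hb h1 h2
    rw [dC_compl, ← dC_compl b]
    refine hmin _ (by show (bd S bᶜ).Finite; rw [bd_compl]; exact hb) (ultra_compl_mem.2 h2)
      (fun h => ultra_compl_mem.1 h h1)

lemma opt_TT (hS : Subgroup.closure (S : Set Γ) = ⊤) {u v : Ultrafilter Γ} {a : Set Γ} {k : ℕ}
    (h : Opt (BC S) (dC S) u v a) (hk : dC S a ≤ k) : a ∈ TT S k :=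
  ⟨opt_tight hS h, opt_tight hS (opt_compl' h), h.1, hk⟩

lemma TT_edge_finite (k : ℕ) (e : Γ × Γ) : {a | a ∈ TT S k ∧ e ∈ bd S a}.Finite := by
  by_contra hinf
  set T := {a | a ∈ TT S k ∧ e ∈ bd S a} with hT
  have : Infinite T := Set.infinite_coe_iff.2 hinf
  let U : Ultrafilter (Set Γ) := (Filter.hyperfilter T).map Subtype.val
  have hTU : T ∈ U := by
    show Subtype.val ⁻¹' T ∈ Filter.hyperfilter T
    rw [Subtype.coe_preimage_self]
    exact Filter.univ_mem
  have hsing : ∀ a, {a} ∉ U := by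
    intro a h
    have h' : (Subtype.val ⁻¹' {a} : Set T) ∈ Filter.hyperfilter T := h
    refine Set.Finite.notMem_hyperfilter ?_ h'
    exact Set.Finite.preimage Subtype.val_injective.injOn (Set.finite_singleton a)
  let a' : Set Γ := {x | {a : Set Γ | x ∈ a} ∈ U}
  have ha' : ∀ x, x ∈ a' ↔ {a : Set Γ | x ∈ a} ∈ U := fun x => Iff.rfl
  have hag : ∀ x, {a : Set Γ | x ∈ a ↔ x ∈ a'} ∈ U := by
    intro x
    by_cases hx : x ∈ a'
    · simp only [hx, iff_true]; exact hx
    · simp only [hx, iff_false]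
      exact ultra_compl_mem.2 hx
  have hagq : ∀ q, {a : Set Γ | q ∈ bd S a ↔ q ∈ bd S a'} ∈ U := by
    intro q
    filter_upwards [hag q.1, hag (q.1 * q.2)] with a h1 h2
    simp only [Set.mem_ofPred_eq, mem_bd, h1, h2]
  have hfin : (bd S a').Finite := by
    by_contra hi
    obtain ⟨t, ht, htc⟩ := Set.Infinite.exists_subset_card_eq hi (k + 1)
    have h1 : {a : Set Γ | ∀ q ∈ t, (q ∈ bd S a ↔ q ∈ bd S a')} ∈ U :=
      (Filter.eventually_all_finset t (l := (U : Filter (Set Γ)))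
        (p := fun q a => (q ∈ bd S a ↔ q ∈ bd S a'))).2 fun q _ => hagq q
    obtain ⟨a, ha1, ha2⟩ := Ultrafilter.nonempty_of_mem (Filter.inter_mem hTU h1)
    have hsub : (t : Set (Γ × Γ)) ⊆ bd S a := fun q hq => (ha2 q hq).2 (ht hq)
    have := Set.ncard_le_ncard hsub ha1.1.2.2.1
    rw [Set.ncard_coe_finset, htc] at this
    have := ha1.1.2.2.2
    omega
  have h1 : {a : Set Γ | ∀ q ∈ hfin.toFinset, (q ∈ bd S a ↔ q ∈ bd S a')} ∈ U :=
      (Filter.eventually_all_finset hfin.toFinset (l := (U : Filter (Set Γ)))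
        (p := fun q a => (q ∈ bd S a ↔ q ∈ bd S a'))).2 fun q _ => hagq q
  refine hsing a' ?_
  filter_upwards [hTU, h1, hag e.1, hag (e.1 * e.2)] with a haT haq he1 he2
  have hsub : bd S a' ⊆ bd S a := fun q hq => (haq q (hfin.mem_toFinset.2 hq)).2 hq
  obtain ⟨⟨t1, t2, -, -⟩, hea⟩ := haT
  have s1 : bd S (a ∩ a') ⊆ bd S a := (bd_inter_sub a a').trans (Set.union_subset subset_rfl hsub)
  have s2 : bd S (aᶜ ∩ a'ᶜ) ⊆ bd S aᶜ := by
    rw [bd_compl]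
    exact (bd_compl_inter_sub a a').trans (Set.union_subset subset_rfl hsub)
  have hx : ∃ x, x ∈ a ∩ a' := by
    by_cases h : e.1 ∈ a
    · exact ⟨_, h, he1.1 h⟩
    · have : e.1 * e.2 ∈ a := by have := hea.2; tauto
      exact ⟨_, this, he2.1 this⟩
  have hy : ∃ x, x ∈ aᶜ ∩ a'ᶜ := by
    by_cases h : e.1 ∈ a
    · have : e.1 * e.2 ∉ a := by have := hea.2; tauto
      exact ⟨_, this, fun h => this (he2.2 h)⟩
    · exact ⟨_, h, fun h' => h (he1.2 h')⟩
  obtain ⟨x, hx⟩ := hx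
  obtain ⟨y, hy⟩ := hy
  have r1 : a ∩ a' = a := by
    rcases t1 _ Set.inter_subset_left s1 with h | h
    · rw [h] at hx; exact hx.elim
    · exact h
  have r2 : aᶜ ∩ a'ᶜ = aᶜ := by
    rcases t2 _ Set.inter_subset_left s2 with h | h
    · rw [h] at hy; exact hy.elim
    · exact h
  show a = a'
  refine Set.Subset.antisymm (Set.inter_eq_left.1 r1) ?_
  exact Set.compl_subset_compl.1 (Set.inter_eq_left.1 r2)

lemma TT_sep_finite (hS : Subgroup.closure (S : Set Γ) = ⊤) (k : ℕ) (x y : Γ) :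
    {a | a ∈ TT S k ∧ ¬ (x ∈ a ↔ y ∈ a)}.Finite := by
  have key : ∀ g : Γ, ∀ x, {a | a ∈ TT S k ∧ ¬ (x ∈ a ↔ x * g ∈ a)}.Finite := by
    intro g
    have hg : g ∈ Subgroup.closure (S : Set Γ) := by rw [hS]; trivial
    induction hg using Subgroup.closure_induction with
    | mem s hs =>
      intro x
      refine (TT_edge_finite (S := S) k (x, s)).subset ?_
      rintro a ⟨h1, h2⟩
      exact ⟨h1, hs, h2⟩
    | one => intro x; simp
    | mul g h _ _ i1 i2 =>
      intro x
      refine ((i1 x).union (i2 (x * g))).subset ?_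
      rintro a ⟨h1, h2⟩
      by_cases h3 : x ∈ a ↔ x * g ∈ a
      · right; refine ⟨h1, ?_⟩
        rw [← h3, mul_assoc]; exact h2
      · exact Or.inl ⟨h1, h3⟩
    | inv g _ i =>
      intro x
      refine (i (x * g⁻¹)).subset ?_
      rintro a ⟨h1, h2⟩
      refine ⟨h1, fun h => h2 ?_⟩
      rw [inv_mul_cancel_right] at h
      exact h.symm
  have := key (x⁻¹ * y) x
  simpa using this

lemma TT_cross_finite (hS : Subgroup.closure (S : Set Γ) = ⊤) (k : ℕ) {a : Set Γ}
    (ha : (bd S a).Finite) : {b | b ∈ TT S k ∧ ¬ Nst b a}.Finite := by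
  have hf : (⋃ q ∈ bd S a, ⋃ q' ∈ bd S a,
      {b | b ∈ TT S k ∧ ¬ (q.1 ∈ b ↔ q'.1 ∈ b)}).Finite :=
    ha.biUnion fun q _ => ha.biUnion fun q' _ => TT_sep_finite hS k _ _
  refine hf.subset ?_
  rintro b ⟨hb, hn⟩
  simp only [Nst, not_or, Set.not_subset] at hn
  obtain ⟨⟨x1, h1, h1'⟩, ⟨x2, h2, h2'⟩, ⟨x3, h3, h3'⟩, ⟨x4, h4, h4'⟩⟩ := hn
  have key : ∀ c : Set Γ, Tight S c → (∃ x ∈ c, x ∉ a) → (∃ x ∈ c, x ∈ a) →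
      ∃ q ∈ bd S a, q.1 ∈ c := by
    rintro c hc ⟨x, hx, hxa⟩ ⟨y, hy, hya⟩
    have : ¬ bd S (c ∩ a) ⊆ bd S c := by
      intro h
      rcases hc _ Set.inter_subset_left h with h | h
      · have : y ∈ c ∩ a := ⟨hy, hya⟩
        rw [h] at this; exact this
      · have : x ∈ c ∩ a := by rw [h]; exact hx
        exact hxa this.2
    rw [Set.not_subset] at this
    obtain ⟨q, hq, hqc⟩ := this
    refine ⟨q, ?_, ?_⟩
    · exact (bd_inter_sub c a hq).resolve_left hqc
    · simp only [mem_bd, Set.mem_inter_iff] at hq hqc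
      grind
  obtain ⟨q, hq, hqb⟩ := key b hb.1 ⟨x1, h1, h1'⟩ ⟨x2, h2, by simpa using h2'⟩
  obtain ⟨q', hq', hqb'⟩ := key bᶜ hb.2.1 ⟨x3, h3, h3'⟩ ⟨x4, h4, by simpa using h4'⟩
  simp only [Set.mem_iUnion]
  refine ⟨q, hq, q', hq', hb, ?_⟩
  have : q'.1 ∉ b := hqb'
  tauto

lemma cutSys (hS : Subgroup.closure (S : Set Γ) = ⊤) (K : ℕ) : CutSys (BC S) (dC S) K where
  compl a ha := by show (bd S aᶜ).Finite; rw [bd_compl]; exact ha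
  inter a ha b hb := (Set.Finite.union ha hb).subset (bd_inter_sub a b)
  dcompl := dC_compl
  dsub a ha b hb := dC_sub a b ha hb
  fin := by
    rintro a ⟨u, v, ha, -⟩
    refine (TT_cross_finite hS K ha.1).subset ?_
    rintro b ⟨⟨u', v', hb, hk⟩, hn⟩
    exact ⟨opt_TT hS hb hk, hn⟩

lemma bd_translate (g : Γ) (a : Set Γ) :
    bd S ((Equiv.mulLeft g) '' a) = (fun q : Γ × Γ => (g * q.1, q.2)) '' bd S a := by
  have hm : ∀ x, x ∈ (Equiv.mulLeft g) '' a ↔ g⁻¹ * x ∈ a := by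
    intro x
    rw [Equiv.image_eq_preimage_symm]
    simp
  ext q
  simp only [mem_bd, hm, Set.mem_image]
  constructor
  · rintro ⟨h1, h2⟩
    refine ⟨(g⁻¹ * q.1, q.2), ⟨h1, ?_⟩, by simp⟩
    simpa [mul_assoc] using h2
  · rintro ⟨r, ⟨h1, h2⟩, rfl⟩
    refine ⟨h1, ?_⟩
    simpa [mul_assoc] using h2

lemma BC_translate (g : Γ) (a : Set Γ) : (Equiv.mulLeft g) '' a ∈ BC S ↔ a ∈ BC S := by
  show (bd S _).Finite ↔ (bd S a).Finite
  rw [bd_translate]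
  refine Set.finite_image_iff ?_
  rintro ⟨a, b⟩ _ ⟨c, d⟩ _ h
  simpa using h

lemma dC_translate (g : Γ) (a : Set Γ) : dC S ((Equiv.mulLeft g) '' a) = dC S a := by
  unfold dC
  rw [bd_translate]
  refine Set.ncard_image_of_injective _ ?_
  rintro ⟨a, b⟩ ⟨c, d⟩ h
  simpa using h

variable (S) in
/-- The nested family of cuts (the edge set of the structure tree). -/
def EE (K : ℕ) : Set (Set Γ) := Nlt (BC S) (dC S) K (K + 1)

/-- Summary of the properties of the nested family. -/
lemma EE_compl (hS : Subgroup.closure (S : Set Γ) = ⊤) {K : ℕ} {a : Set Γ} (ha : a ∈ EE S K) :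
    aᶜ ∈ EE S K := (Nlt_spec (cutSys hS K) (K + 1)).2.1 a ha

lemma EE_nst (hS : Subgroup.closure (S : Set Γ) = ⊤) {K : ℕ} {a b : Set Γ} (ha : a ∈ EE S K)
    (hb : b ∈ EE S K) : Nst a b := (Nlt_spec (cutSys hS K) (K + 1)).2.2.1 a ha b hb

lemma EE_TT (hS : Subgroup.closure (S : Set Γ) = ⊤) {K : ℕ} {a : Set Γ} (ha : a ∈ EE S K) :
    a ∈ TT S K := by
  obtain ⟨u, v, h1, h2, h3⟩ := (Nlt_spec (cutSys hS K) (K + 1)).1 a ha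
  exact opt_TT hS h1 h3

lemma EE_nonempty (hS : Subgroup.closure (S : Set Γ) = ⊤) {K : ℕ} {a : Set Γ} (ha : a ∈ EE S K) :
    a.Nonempty := by
  obtain ⟨u, v, h1, h2, h3⟩ := (Nlt_spec (cutSys hS K) (K + 1)).1 a ha
  exact Ultrafilter.nonempty_of_mem h1.2.1

lemma EE_sep_finite (hS : Subgroup.closure (S : Set Γ) = ⊤) (K : ℕ) (x y : Γ) :
    {a | a ∈ EE S K ∧ ¬ (x ∈ a ↔ y ∈ a)}.Finite :=
  (TT_sep_finite hS K x y).subset fun _ h => ⟨EE_TT hS h.1, h.2⟩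

lemma EE_translate (K : ℕ) (g : Γ) (a : Set Γ) :
    (Equiv.mulLeft g) '' a ∈ EE S K ↔ a ∈ EE S K :=
  Nlt_image _ (BC_translate g) (dC_translate g) _ _

/-- Every pair of ultrafilters separated by a small cut is separated by an edge. -/
lemma EE_separates (hS : Subgroup.closure (S : Set Γ) = ⊤) {K : ℕ} {u v : Ultrafilter Γ}
    {a : Set Γ} (hB : (bd S a).Finite) (hK : (bd S a).ncard ≤ K) (hu : a ∈ u) (hv : a ∉ v) :
    ∃ b ∈ EE S K, b ∈ u ∧ b ∉ v := by
  classical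
  have hex : ∃ m, ∃ b ∈ BC S, b ∈ u ∧ b ∉ v ∧ dC S b = m := ⟨_, a, hB, hu, hv, rfl⟩
  obtain ⟨b, hb, hbu, hbv, hm⟩ := Nat.find_spec hex
  have hmin : ∀ c ∈ BC S, c ∈ u → c ∉ v → dC S b ≤ dC S c := by
    intro c hc h1 h2
    rw [hm]
    exact Nat.find_min' hex ⟨c, hc, h1, h2, rfl⟩
  have hopt : Opt (BC S) (dC S) u v b := ⟨hb, hbu, hbv, hmin⟩
  have hbK : dC S b ≤ K := (hmin a hB hu hv).trans hK
  obtain ⟨c, hc, ho⟩ := (Nlt_spec (cutSys hS K) (K + 1)).2.2.2 u v b hopt (by omega) hbK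
  exact ⟨c, hc, ho.2.1, ho.2.2.1⟩

/-- Finitely many orbits of edges. -/
lemma EE_orbits (hS : Subgroup.closure (S : Set Γ) = ⊤) (K : ℕ) :
    ∃ R : Set (Set Γ), R.Finite ∧ ∀ a ∈ EE S K, ∃ g : Γ, (Equiv.mulLeft g) '' a ∈ R := by
  refine ⟨⋃ s ∈ (S : Set Γ), {a | a ∈ TT S K ∧ ((1 : Γ), s) ∈ bd S a},
    S.finite_toSet.biUnion fun s _ => TT_edge_finite K _, ?_⟩
  intro a ha
  have hne : (bd S a).Nonempty := by
    rw [Set.nonempty_iff_ne_empty]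
    intro h
    rcases bd_eq_empty hS h with h | h
    · have := EE_nonempty hS ha
      rw [h] at this; exact Set.not_nonempty_empty this
    · have := EE_nonempty hS (EE_compl hS ha)
      rw [h, Set.compl_univ] at this; exact Set.not_nonempty_empty this
  obtain ⟨⟨x, s⟩, hq⟩ := hne
  refine ⟨x⁻¹, ?_⟩
  simp only [Set.mem_iUnion]
  refine ⟨s, hq.1, EE_TT hS ((EE_translate K _ _).2 ha), ?_⟩
  rw [bd_translate]
  exact ⟨(x, s), hq, by simp⟩

end Cayley
end PartSec2
end OutFormal

namespace OutFormal
section PartSec3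

/-! ### Half spaces in free groups -/
section Half
variable {α : Type} [DecidableEq α]

/-- Words starting with the letter `x`. -/
def HS (x : α × Bool) : Set (FreeGroup α) := {w | w.toWord.head? = some x}

lemma toWord_of_isReduced {L : List (α × Bool)} (h : FreeGroup.IsReduced L) :
    (FreeGroup.mk L).toWord = L := by
  rw [FreeGroup.toWord_mk]; exact h.reduce_eq

lemma toWord_mul_of (w : FreeGroup α) (y : α) (h1 : w ≠ 1) (h2 : w ≠ (FreeGroup.of y)⁻¹) :
    (w * FreeGroup.of y).toWord.head? = w.toWord.head? := by
  have hred : FreeGroup.IsReduced w.toWord := FreeGroup.isReduced_toWord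
  rcases List.eq_nil_or_concat' w.toWord with h | ⟨M, l, h⟩
  · exact absurd (FreeGroup.toWord_eq_nil_iff.1 h) h1
  · by_cases hl : l = (y, false)
    · subst hl
      have hw : w = FreeGroup.mk M * (FreeGroup.of y)⁻¹ := by
        rw [← FreeGroup.mk_toWord (x := w), h, ← FreeGroup.mul_mk]; rfl
      have hM : FreeGroup.IsReduced M := by
        rw [h] at hred
        exact List.IsChain.left_of_append hred
      have hMne : M ≠ [] := by
        rintro rfl
        apply h2
        rw [hw, ← FreeGroup.one_eq_mk, one_mul]
      have : w * FreeGroup.of y = FreeGroup.mk M := by rw [hw]; group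
      rw [this, toWord_of_isReduced hM, h, List.head?_append]
      cases M with
      | nil => exact absurd rfl hMne
      | cons a t => simp
    · have hr : FreeGroup.IsReduced (w.toWord ++ [(y, true)]) := by
        rw [h, FreeGroup.IsReduced, List.isChain_append]
        refine ⟨by rw [h] at hred; exact hred, by simp, ?_⟩
        intro a ha b hb
        simp only [List.getLast?_append, List.getLast?_singleton, Option.some_or, Option.mem_def,
          Option.some.injEq, List.head?_cons] at ha hb
        subst ha hb
        intro h3
        by_contra h4
        apply hl
        ext
        · exact h3
        · simpa using h4
      have : w * FreeGroup.of y = FreeGroup.mk (w.toWord ++ [(y, true)]) := by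
        rw [← FreeGroup.mul_mk, FreeGroup.mk_toWord]; rfl
      rw [this, toWord_of_isReduced hr, h]
      cases M <;> simp

lemma HS_finite (x : α × Bool) (f : FreeGroup α) :
    {w | ¬ (w ∈ HS x ↔ w * f ∈ HS x)}.Finite := by
  have hf : f ∈ Subgroup.closure (Set.range (FreeGroup.of : α → FreeGroup α)) := by
    rw [FreeGroup.closure_range_of]; trivial
  induction hf using Subgroup.closure_induction with
  | mem s hs =>
    obtain ⟨y, rfl⟩ := hs
    refine (Set.toFinite {1, (FreeGroup.of y)⁻¹}).subset ?_
    intro w hw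
    by_contra hcon
    simp only [Set.mem_insert_iff, Set.mem_singleton_iff, not_or] at hcon
    apply hw
    show _ = _ ↔ _ = _
    rw [toWord_mul_of w y hcon.1 hcon.2]
  | one => simp
  | mul g h _ _ i1 i2 =>
    have i3 : ((fun w => w * g) ⁻¹' {w | ¬ (w ∈ HS x ↔ w * h ∈ HS x)}).Finite :=
      i2.preimage (mul_left_injective g).injOn
    refine (i1.union i3).subset ?_
    intro w hw
    by_cases h3 : w ∈ HS x ↔ w * g ∈ HS x
    · right
      show ¬ (w * g ∈ HS x ↔ w * g * h ∈ HS x)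
      rw [← h3, mul_assoc]; exact hw
    · exact Or.inl h3
  | inv g _ i =>
    have i3 : ((fun w => w * g⁻¹) ⁻¹' {w | ¬ (w ∈ HS x ↔ w * g ∈ HS x)}).Finite :=
      i.preimage (mul_left_injective g⁻¹).injOn
    refine i3.subset ?_
    intro w hw
    show ¬ (w * g⁻¹ ∈ HS x ↔ w * g⁻¹ * g ∈ HS x)
    rw [inv_mul_cancel_right]
    intro h; exact hw h.symm

lemma exists_HS (g : FreeGroup α) (hg : g ≠ 1) : ∃ (c : FreeGroup α) (x : α × Bool),
    ∀ m : ℕ, 1 ≤ m → c⁻¹ * g ^ m * c ∈ HS x ∧ c⁻¹ * (g⁻¹) ^ m * c ∉ HS x := by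
  set L := g.toWord with hL
  have hLr : FreeGroup.IsReduced L := FreeGroup.isReduced_toWord
  set H := FreeGroup.reduceCyclically L with hH
  have hcr : FreeGroup.IsCyclicallyReduced H := FreeGroup.reduceCyclically.isCyclicallyReduced hLr
  set c := FreeGroup.mk (FreeGroup.reduceCyclically.conjugator L) with hc
  have hconj : g = c * FreeGroup.mk H * c⁻¹ := by
    have := FreeGroup.reduceCyclically.conj_conjugator_reduceCyclically L
    rw [hc, FreeGroup.inv_mk, FreeGroup.mul_mk, FreeGroup.mul_mk, this, hL, FreeGroup.mk_toWord]
  have hne : H ≠ [] := by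
    intro h
    apply hg
    rw [hconj, h, ← FreeGroup.one_eq_mk]; simp
  have hpow : ∀ m : ℕ, c⁻¹ * g ^ m * c = (FreeGroup.mk H) ^ m := by
    intro m
    rw [hconj, conj_pow]; group
  have hpow' : ∀ m : ℕ, c⁻¹ * (g⁻¹) ^ m * c = ((FreeGroup.mk H) ^ m)⁻¹ := by
    intro m
    rw [← hpow]; simp [mul_assoc]
  have hw : ∀ m : ℕ, ((FreeGroup.mk H) ^ m).toWord = (List.replicate m H).flatten := by
    intro m
    rw [FreeGroup.pow_mk, toWord_of_isReduced (hcr.flatten_replicate m).isReduced]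
  obtain ⟨x, hx⟩ : ∃ x, H.head? = some x := by
    cases hH' : H with
    | nil => exact absurd hH' hne
    | cons a t => exact ⟨a, by simp⟩
  refine ⟨c, x, fun m hm => ⟨?_, ?_⟩⟩
  · show _ = _
    rw [hpow, hw, List.head?_flatten_replicate (by omega), hx]
  · rw [hpow']
    show ¬ (_ = _)
    rw [FreeGroup.toWord_inv, hw, FreeGroup.invRev, List.head?_reverse, List.getLast?_map,
      List.getLast?_flatten_replicate (by omega)]
    intro h
    obtain ⟨y, hy⟩ : ∃ y, H.getLast? = some y := by
      cases hz : H.getLast? with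
      | none => exact absurd (List.getLast?_eq_none_iff.1 hz) hne
      | some y => exact ⟨y, rfl⟩
    rw [hy] at h
    simp only [Option.map_some, Option.some.injEq] at h
    have := hcr.2 y hy x hx (by rw [← h])
    rw [← h] at this
    simp at this

end Half

lemma BC_right_finite {Γ : Type} [Group Γ] {S : Finset Γ}
    (hS : Subgroup.closure (S : Set Γ) = ⊤) {a : Set Γ} (ha : a ∈ BC S) (f : Γ) :
    {w | ¬ (w ∈ a ↔ w * f ∈ a)}.Finite := by
  have hf : f ∈ Subgroup.closure (S : Set Γ) := by
    rw [hS]; trivial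
  induction hf using Subgroup.closure_induction with
  | mem s hs =>
    refine ((show (bd S a).Finite from ha).image Prod.fst).subset ?_
    intro w hw
    exact ⟨(w, s), ⟨hs, hw⟩, rfl⟩
  | one => simp
  | mul g h _ _ i1 i2 =>
    have i3 : ((fun w => w * g) ⁻¹' {w | ¬ (w ∈ a ↔ w * h ∈ a)}).Finite :=
      i2.preimage (mul_left_injective g).injOn
    refine (i1.union i3).subset ?_
    intro w hw
    by_cases h3 : w ∈ a ↔ w * g ∈ a
    · right
      show ¬ (w * g ∈ a ↔ w * g * h ∈ a)
      rw [← h3, mul_assoc]; exact hw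
    · exact Or.inl h3
  | inv g _ i =>
    have i3 : ((fun w => w * g⁻¹) ⁻¹' {w | ¬ (w ∈ a ↔ w * g ∈ a)}).Finite :=
      i.preimage (mul_left_injective g⁻¹).injOn
    refine i3.subset ?_
    intro w hw
    show ¬ (w * g⁻¹ ∈ a ↔ w * g⁻¹ * g ∈ a)
    rw [inv_mul_cancel_right]
    intro h; exact hw h.symm

section Cut
variable {n : ℕ} {Γ P : Type} [Group Γ] [Group P] [Finite P]
  {ι : FreeGroup (Fin n) →* Γ} {π : Γ →* P}

lemma exists_rho (hι : Function.Injective ι) (hπ : Function.Surjective π)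
    (hker : ∀ γ, π γ = 1 ↔ γ ∈ ι.range) :
    ∃ (r : P → Γ) (ρ : Γ → FreeGroup (Fin n)), (∀ γ, γ = ι (ρ γ) * r (π γ)) ∧
      ∀ w γ, ρ (ι w * γ) = w * ρ γ := by
  choose r hr using hπ
  have h1 : ∀ γ, ∃ w, ι w = γ * (r (π γ))⁻¹ := by
    intro γ
    refine (hker _).1 ?_
    rw [map_mul, map_inv, hr, mul_inv_cancel]
  choose ρ hρ using h1
  refine ⟨r, ρ, fun γ => by rw [hρ]; group, fun w γ => ?_⟩
  apply hι
  have : π (ι w) = 1 := (hker _).2 ⟨w, rfl⟩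
  rw [map_mul, hρ, hρ, map_mul, this, one_mul]; group

lemma exists_cut (S : Finset Γ) (hS : Subgroup.closure (S : Set Γ) = ⊤)
    (hι : Function.Injective ι) (hπ : Function.Surjective π)
    (hker : ∀ γ, π γ = 1 ↔ γ ∈ ι.range) :
    ∃ K, ∀ g, g ≠ 1 → ∃ a ∈ EE S K, ∃ M : ℕ, ∀ m ≥ M, (ι g) ^ m ∈ a ∧ ((ι g)⁻¹) ^ m ∉ a := by
  obtain ⟨r, ρ, h1, h2⟩ := exists_rho hι hπ hker
  let A : Fin n × Bool → Set Γ := fun x => {γ | ρ γ ∈ HS x}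
  have hinj : Function.Injective (fun γ => (ρ γ, π γ)) := by
    intro γ γ' h
    simp only [Prod.mk.injEq] at h
    rw [h1 γ, h1 γ', h.1, h.2]
  have hAs : ∀ x s, {γ | ¬ (γ ∈ A x ↔ γ * s ∈ A x)}.Finite := by
    intro x s
    have hf : (⋃ q : P, ({w | ¬ (w ∈ HS x ↔ w * ρ (r q * s) ∈ HS x)} ×ˢ {q} :
        Set (FreeGroup (Fin n) × P))).Finite :=
      Set.finite_iUnion fun q => (HS_finite x _).prod (Set.finite_singleton q)
    refine (hf.preimage hinj.injOn).subset ?_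
    intro γ hγ
    simp only [Set.mem_preimage, Set.mem_iUnion]
    refine ⟨π γ, ?_, rfl⟩
    have : ρ (γ * s) = ρ γ * ρ (r (π γ) * s) := by
      rw [← h2, ← mul_assoc, ← h1]
    show ¬ (ρ γ ∈ HS x ↔ ρ γ * ρ (r (π γ) * s) ∈ HS x)
    rw [← this]; exact hγ
  have hA : ∀ x, (bd S (A x)).Finite := by
    intro x
    have hf : (⋃ s ∈ (S : Set Γ), ({γ | ¬ (γ ∈ A x ↔ γ * s ∈ A x)} ×ˢ {s} : Set (Γ × Γ))).Finite :=
      S.finite_toSet.biUnion fun s _ => (hAs x s).prod (Set.finite_singleton s)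
    refine hf.subset ?_
    rintro ⟨γ, s⟩ ⟨hs, hq⟩
    simp only [Set.mem_iUnion]
    exact ⟨s, hs, hq, rfl⟩
  let K := Finset.univ.sup fun x => (bd S (A x)).ncard
  refine ⟨K, fun g hg => ?_⟩
  obtain ⟨c, x, hx⟩ := exists_HS g hg
  set y : Γ := ι (c * (ρ 1)⁻¹) with hy
  let a0 := (Equiv.mulLeft (ι c)) '' A x
  have hmem : ∀ h : FreeGroup (Fin n), ι h * y ∈ a0 ↔ c⁻¹ * h * c ∈ HS x := by
    intro h
    have : ι h * y ∈ a0 ↔ (ι c)⁻¹ * (ι h * y) ∈ A x := by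
      show _ ∈ (Equiv.mulLeft (ι c)) '' A x ↔ _
      rw [Equiv.image_eq_preimage_symm]
      simp
    rw [this]
    show ρ _ ∈ HS x ↔ _
    have e : (ι c)⁻¹ * (ι h * y) = ι (c⁻¹ * h * c * (ρ 1)⁻¹) * 1 := by
      rw [hy]; simp [mul_assoc]
    rw [e, h2]; simp
  have hinjP : Function.Injective fun m : ℕ => (ι g) ^ m := by
    intro a b hab
    have : g ^ a = g ^ b := hι (by simpa using hab)
    exact injective_pow_iff_not_isOfFinOrder.2 (not_isOfFinOrder_of_isMulTorsionFree hg) this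
  have hinjN : Function.Injective fun m : ℕ => ((ι g)⁻¹) ^ m := by
    intro a b hab
    apply hinjP
    simpa using hab
  let up : Filter Γ := Filter.map (fun m : ℕ => (ι g) ^ m * y) Filter.atTop
  let un : Filter Γ := Filter.map (fun m : ℕ => ((ι g)⁻¹) ^ m * y) Filter.atTop
  let u := Ultrafilter.of up
  let v := Ultrafilter.of un
  have hau : a0 ∈ u := by
    refine Ultrafilter.of_le up ?_
    show ∀ᶠ m : ℕ in Filter.atTop, (ι g) ^ m * y ∈ a0
    filter_upwards [Filter.eventually_ge_atTop 1] with m hm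
    rw [← map_pow, hmem]
    exact (hx m hm).1
  have hav : a0 ∉ v := by
    rw [← ultra_compl_mem]
    refine Ultrafilter.of_le un ?_
    show ∀ᶠ m : ℕ in Filter.atTop, ((ι g)⁻¹) ^ m * y ∈ a0ᶜ
    filter_upwards [Filter.eventually_ge_atTop 1] with m hm
    rw [← map_inv, ← map_pow, Set.mem_compl_iff, hmem]
    exact (hx m hm).2
  have hK : (bd S a0).ncard ≤ K := by
    have := dC_translate (S := S) (ι c) (A x)
    unfold dC at this
    rw [this]
    exact Finset.le_sup (f := fun x => (bd S (A x)).ncard) (Finset.mem_univ x)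
  obtain ⟨a, haE, hau', hav'⟩ := EE_separates hS ((BC_translate (S := S) (ι c) (A x)).2 (hA x))
    hK hau hav
  have haB : a ∈ BC S := (EE_TT hS haE).2.2.1
  have ev : ∀ (z w : Γ), Function.Injective (fun m : ℕ => z ^ m) →
      ∀ᶠ m : ℕ in Filter.atTop, (z ^ m ∈ a ↔ z ^ m * w ∈ a) := by
    intro z w hz
    have hf := (BC_right_finite hS haB w).preimage hz.injOn
    have := hf.compl_mem_cofinite
    rw [Nat.cofinite_eq_atTop] at this
    filter_upwards [this] with m hm
    by_contra hh
    exact hm hh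
  have const : ∀ (z : Γ), Function.Injective (fun m : ℕ => z ^ m) →
      (∀ᶠ m : ℕ in Filter.atTop, z ^ m ∈ a) ∨ (∀ᶠ m : ℕ in Filter.atTop, z ^ m ∉ a) := by
    intro z hz
    obtain ⟨N, hN⟩ := Filter.eventually_atTop.1 (ev z z hz)
    have : ∀ k : ℕ, (z ^ (N + k) ∈ a ↔ z ^ N ∈ a) := by
      intro k
      induction k with
      | zero => simp
      | succ k ih =>
        rw [← ih, ← add_assoc, pow_succ]
        exact (hN (N + k) (by omega)).symm
    by_cases h : z ^ N ∈ a
    · left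
      filter_upwards [Filter.eventually_ge_atTop N] with m hm
      obtain ⟨k, rfl⟩ := Nat.exists_eq_add_of_le hm
      exact (this k).2 h
    · right
      filter_upwards [Filter.eventually_ge_atTop N] with m hm
      obtain ⟨k, rfl⟩ := Nat.exists_eq_add_of_le hm
      exact fun h' => h ((this k).1 h')
  have r1 : ∀ᶠ m : ℕ in Filter.atTop, (ι g) ^ m ∈ a := by
    rcases const _ hinjP with h | h
    · exact h
    · exfalso
      refine ultra_compl_mem.1 (Ultrafilter.of_le up ?_) hau'
      show ∀ᶠ m : ℕ in Filter.atTop, (ι g) ^ m * y ∈ aᶜ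
      filter_upwards [h, ev _ y hinjP] with m h1 h2
      exact fun h3 => h1 (h2.2 h3)
  have r2 : ∀ᶠ m : ℕ in Filter.atTop, ((ι g)⁻¹) ^ m ∉ a := by
    rcases const _ hinjN with h | h
    · exfalso
      refine hav' (Ultrafilter.of_le un ?_)
      show ∀ᶠ m : ℕ in Filter.atTop, ((ι g)⁻¹) ^ m * y ∈ a
      filter_upwards [h, ev _ y hinjN] with m h1 h2
      exact h2.1 h1
    · exact h
  obtain ⟨M, hM⟩ := Filter.eventually_atTop.1 (r1.and r2)
  exact ⟨a, haE, M, hM⟩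

end Cut
end PartSec3
end OutFormal

namespace OutFormal
section PartSec4
open scoped Pointwise

/-! ### The structure tree -/

/-- A tree with an action of `Γ`, with `F` acting freely. -/
structure TreeData {F Γ : Type} [Group F] [Group Γ] (ι : F →* Γ) where
  V : Type
  E : Type
  [actV : MulAction Γ V]
  [actE : MulAction Γ E]
  o : E → V
  t : E → V
  o_smul : ∀ (g : Γ) (e : E), o (g • e) = g • o e
  t_smul : ∀ (g : Γ) (e : E), t (g • e) = g • t e
  grad : ∀ l : E → ℚ, ∃ φ : V → ℚ, ∀ e, φ (t e) - φ (o e) = l e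
  conn : ∀ Q : V → Prop, (∀ e, Q (o e) ↔ Q (t e)) → ∀ v w, Q v → Q w
  free : ∀ g, g ≠ 1 → ∀ v : V, ι g • v ≠ v
  ne : Nonempty V
  finE : ∃ R : Set E, R.Finite ∧ ∀ e, ∃ g : Γ, g • e ∈ R
  finV : ∃ R : Set V, R.Finite ∧ ∀ v, ∃ g : Γ, g • v ∈ R

attribute [instance] TreeData.actV TreeData.actE

section Tree
variable {Γ : Type} [Group Γ]

/-- An abstract nested family. -/
structure NF (D : Set (Set Γ)) : Prop where
  compl : ∀ a ∈ D, aᶜ ∈ D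
  nst : ∀ a ∈ D, ∀ b ∈ D, Nst a b
  ne : ∀ a ∈ D, a.Nonempty
  sep : ∀ x y : Γ, {a | a ∈ D ∧ ¬ (x ∈ a ↔ y ∈ a)}.Finite
  smul : ∀ (g : Γ), ∀ a ∈ D, g • a ∈ D

/-- Vertices of the structure tree. -/
structure IsVtx (D : Set (Set Γ)) (O : Set (Set Γ)) : Prop where
  sub : O ⊆ D
  ori : ∀ a ∈ D, (aᶜ ∈ O ↔ a ∉ O)
  up : ∀ a ∈ O, ∀ b ∈ D, a ⊆ b → b ∈ O
  fin : ∀ x : Γ, {a | a ∈ O ∧ x ∉ a}.Finite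

/-- The head of an oriented edge. -/
def hd (D : Set (Set Γ)) (a : Set Γ) : Set (Set Γ) := {b | b ∈ D ∧ (a ⊆ b ∨ (aᶜ ⊆ b ∧ aᶜ ≠ b))}

variable {D : Set (Set Γ)}

lemma NF.ne' (H : NF D) {a : Set Γ} (ha : a ∈ D) : ¬ aᶜ ⊆ a := by
  obtain ⟨x, hx⟩ := H.ne _ (H.compl a ha)
  exact fun h => hx (h hx)

lemma NF.ne'' (H : NF D) {a : Set Γ} (ha : a ∈ D) : ¬ a ⊆ aᶜ := by
  obtain ⟨x, hx⟩ := H.ne _ ha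
  exact fun h => h hx hx

lemma self_mem_hd {a : Set Γ} (ha : a ∈ D) : a ∈ hd D a := ⟨ha, Or.inl subset_rfl⟩

lemma compl_notMem_hd (H : NF D) {a : Set Γ} (ha : a ∈ D) : aᶜ ∉ hd D a := by
  rintro ⟨_, h | ⟨_, h⟩⟩
  · exact H.ne'' ha h
  · exact h rfl

lemma hd_vtx (H : NF D) {a : Set Γ} (ha : a ∈ D) : IsVtx D (hd D a) where
  sub := fun b hb => hb.1
  ori := by
    intro b hb
    constructor
    · rintro ⟨_, h⟩ ⟨_, h'⟩
      obtain ⟨x, hx⟩ := H.ne _ ha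
      obtain ⟨y, hy⟩ := H.ne _ (H.compl _ ha)
      rcases h with h | ⟨h, hn⟩ <;> rcases h' with h' | ⟨h', hn'⟩
      · exact h hx (h' hx)
      · exact hn' (Set.Subset.antisymm h' (Set.subset_compl_comm.1 h))
      · exact hn (Set.Subset.antisymm h (by rwa [Set.compl_subset_compl]))
      · exact h hy (h' hy)
    · intro hn
      simp only [hd, Set.mem_ofPred_eq, hb, true_and, not_or, not_and, not_not] at hn
      refine ⟨H.compl _ hb, ?_⟩
      rcases H.nst a ha b hb with h | h | h | h
      · exact absurd h hn.1
      · exact Or.inl h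
      · have := hn.2 h
        left; rw [← this, compl_compl]
      · by_cases h' : aᶜ = bᶜ
        · exact absurd (compl_injective h').subset hn.1
        · exact Or.inr ⟨h, h'⟩
  up := by
    rintro b ⟨hb, h⟩ c hc hbc
    refine ⟨hc, ?_⟩
    rcases h with h | ⟨h, hn⟩
    · exact Or.inl (h.trans hbc)
    · refine Or.inr ⟨h.trans hbc, ?_⟩
      rintro rfl
      exact hn (Set.Subset.antisymm h hbc)
  fin := by
    intro x
    obtain ⟨y, hy⟩ := H.ne _ ha
    obtain ⟨z, hz⟩ := H.ne _ (H.compl _ ha)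
    refine ((H.sep x y).union (H.sep x z)).subset ?_
    rintro b ⟨⟨hb, h | ⟨h, -⟩⟩, hx⟩
    · left; refine ⟨hb, ?_⟩
      have := h hy; tauto
    · right; refine ⟨hb, ?_⟩
      have := h hz; tauto

lemma vtx_eq_hd (H : NF D) {O : Set (Set Γ)} (hO : IsVtx D O) {a : Set Γ} (ha : a ∈ O)
    (hmin : ∀ b ∈ O, b ⊆ a → b = a) : O = hd D a := by
  have haD := hO.sub ha
  have h1 : O ⊆ hd D a := by
    intro b hb
    have hbD := hO.sub hb
    refine ⟨hbD, ?_⟩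
    rcases H.nst a haD b hbD with h | h | h | h
    · exact Or.inl h
    · exact absurd hb ((hO.ori b hbD).1 (hO.up a ha _ (H.compl _ hbD) h))
    · refine Or.inr ⟨h, ?_⟩
      rintro rfl
      exact (hO.ori a haD).1 hb ha
    · left; rw [hmin b hb (Set.compl_subset_compl.1 h)]
  refine Set.Subset.antisymm h1 ?_
  intro b hb
  have hbD := hb.1
  by_contra hn
  exact ((hd_vtx H haD).ori b hbD).1 (h1 ((hO.ori b hbD).2 hn)) hb

lemma hd_diff (H : NF D) {a b : Set Γ} (ha : a ∈ D) (h1 : b ≠ a) (h2 : b ≠ aᶜ) :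
    b ∈ hd D a ↔ b ∈ hd D aᶜ := by
  simp only [hd, compl_compl, Set.mem_ofPred_eq]
  have h1' := h1.symm
  have h2' := h2.symm
  tauto

/-- Neighbouring vertices. -/
lemma vtx_flip (H : NF D) {O : Set (Set Γ)} {a : Set Γ} (hO : O = hd D a) (ha : a ∈ D) :
    ∀ b, b ∈ hd D aᶜ ↔ (b ∈ O ∧ b ≠ a) ∨ b = aᶜ := by
  intro b
  subst hO
  by_cases h1 : b = a
  · subst h1
    have h3 := compl_notMem_hd H (H.compl _ ha)
    rw [compl_compl] at h3
    have : b ≠ bᶜ := fun h => H.ne'' ha h.subset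
    simp [h3, this]
  · by_cases h2 : b = aᶜ
    · subst h2; simp [self_mem_hd (H.compl _ ha)]
    · rw [← hd_diff H ha h1 h2]; simp [h1, h2]

lemma vtx_smul (H : NF D) (g : Γ) {O : Set (Set Γ)} (hO : IsVtx D O) : IsVtx D (g • O) where
  sub := by
    rintro _ ⟨a, ha, rfl⟩
    exact H.smul g a (hO.sub ha)
  ori := by
    intro a ha
    rw [Set.mem_smul_set_iff_inv_smul_mem, Set.mem_smul_set_iff_inv_smul_mem, Set.smul_set_compl]
    exact hO.ori _ (H.smul _ _ ha)
  up := by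
    intro a ha b hb hab
    rw [Set.mem_smul_set_iff_inv_smul_mem] at *
    exact hO.up _ ha _ (H.smul _ _ hb) (Set.smul_set_mono hab)
  fin := by
    intro x
    refine ((hO.fin (g⁻¹ • x)).image (fun a => g • a)).subset ?_
    rintro _ ⟨⟨a, ha, rfl⟩, hx⟩
    refine ⟨a, ⟨ha, ?_⟩, rfl⟩
    intro h; exact hx (Set.mem_smul_set_iff_inv_smul_mem.2 h)

lemma smul_hd (H : NF D) (g : Γ) (a : Set Γ) : g • hd D a = hd D (g • a) := by
  ext b
  rw [Set.mem_smul_set_iff_inv_smul_mem]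
  have hb : g⁻¹ • b ∈ D ↔ b ∈ D :=
    ⟨fun h => by simpa using H.smul g _ h, fun h => H.smul _ _ h⟩
  have h1 : ∀ c : Set Γ, c ⊆ g⁻¹ • b ↔ g • c ⊆ b := fun c => by
    rw [Set.subset_smul_set_iff, inv_inv]
  have h2 : ∀ c : Set Γ, c = g⁻¹ • b ↔ g • c = b := fun c => by
    rw [eq_inv_smul_iff]
  simp only [hd, Set.mem_ofPred_eq, hb, h1, ne_eq, h2, Set.smul_set_compl]

/-- Connectedness. -/
lemma vtx_conn (H : NF D) (Q : Set (Set Γ) → Prop)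
    (hQ : ∀ a ∈ D, Q (hd D a) → Q (hd D aᶜ)) (O O' : Set (Set Γ)) (hO : IsVtx D O)
    (hO' : IsVtx D O') (h : Q O) : Q O' := by
  have hfin : ∀ O, IsVtx D O → (O \ O').Finite := by
    intro O hO
    refine ((hO.fin 1).union ((hO'.fin 1).image compl)).subset ?_
    rintro a ⟨ha, ha'⟩
    by_cases h1 : (1 : Γ) ∈ a
    · right
      exact ⟨aᶜ, ⟨(hO'.ori a (hO.sub ha)).2 ha', fun h => h h1⟩, compl_compl a⟩
    · exact Or.inl ⟨ha, h1⟩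
  generalize hk : (O \ O').ncard = k
  induction k generalizing O with
  | zero =>
    have h0 := (Set.ncard_eq_zero (hfin O hO)).1 hk
    have hsub : O ⊆ O' := Set.sdiff_eq_empty.1 h0
    have : O = O' := by
      refine Set.Subset.antisymm hsub ?_
      intro b hb
      by_contra hn
      have hbD := hO'.sub hb
      exact (hO'.ori b hbD).1 (hsub ((hO.ori b hbD).2 hn)) hb
    rwa [← this]
  | succ k ih =>
    have hne : (O \ O').Nonempty := by
      rw [← Set.ncard_pos (hfin O hO)]; omega
    obtain ⟨a, ha⟩ := (hfin O hO).exists_minimal hne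
    have haO := ha.prop.1
    have haD := hO.sub haO
    have hmin : ∀ b ∈ O, b ⊆ a → b = a := by
      intro b hb hba
      have hb' : b ∈ O \ O' := ⟨hb, fun h => ha.prop.2 (hO'.up b h a haD hba)⟩
      exact Set.Subset.antisymm hba (ha.le_of_le hb' hba)
    have hOe := vtx_eq_hd H hO haO hmin
    have hv := hd_vtx H (H.compl _ haD)
    refine ih (hd D aᶜ) hv (hQ a haD (hOe ▸ h)) ?_
    have : hd D aᶜ \ O' = (O \ O') \ {a} := by
      ext b
      have hac : aᶜ ∈ O' := (hO'.ori a haD).2 ha.prop.2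
      simp only [Set.mem_sdiff, vtx_flip H hOe haD, Set.mem_singleton_iff]
      constructor
      · rintro ⟨h | rfl, h'⟩
        · exact ⟨⟨h.1, h'⟩, h.2⟩
        · exact absurd hac h'
      · rintro ⟨⟨h1, h2⟩, h3⟩
        exact ⟨Or.inl ⟨h1, h3⟩, h2⟩
    rw [this, Set.ncard_sdiff_singleton_of_mem ha.prop]
    omega

/-- An invariant orientation. -/
lemma exists_orientation (H : NF D) (hinv : ∀ a ∈ D, ∀ g : Γ, g • a ≠ aᶜ) :
    ∃ D' ⊆ D, (∀ g : Γ, ∀ a ∈ D', g • a ∈ D') ∧ ∀ a ∈ D, (aᶜ ∈ D' ↔ a ∉ D') := by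
  let orb : Set Γ → Set (Set Γ) := fun a => MulAction.orbit Γ a
  have h1 : ∀ (g : Γ) a, orb (g • a) = orb a := fun g a => MulAction.orbit_eq_iff.2 ⟨g, rfl⟩
  have h2 : ∀ a ∈ D, orb a ≠ orb aᶜ := by
    intro a ha h
    have : aᶜ ∈ orb a := by rw [h]; exact MulAction.mem_orbit_self _
    obtain ⟨g, hg⟩ := this
    exact hinv a ha g hg
  let r : Set (Set Γ) → Set (Set Γ) → Prop := WellOrderingRel
  refine ⟨{a | a ∈ D ∧ r (orb a) (orb aᶜ)}, fun a ha => ha.1, ?_, ?_⟩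
  · rintro g a ⟨ha, h⟩
    refine ⟨H.smul g a ha, ?_⟩
    rw [← Set.smul_set_compl, h1, h1]
    exact h
  · intro a ha
    simp only [Set.mem_ofPred_eq, ha, H.compl a ha, true_and, compl_compl]
    constructor
    · intro h h'
      exact asymm_of WellOrderingRel h h'
    · intro h
      rcases trichotomous_of WellOrderingRel (orb a) (orb aᶜ) with h' | h' | h'
      · exact absurd h' h
      · exact absurd h' (h2 a ha)
      · exact h'

lemma vtx_free_aux {O : Set (Set Γ)} (hO : IsVtx D O) {a : Set Γ} (ha : a ∈ O) (z : Γ) (M : ℕ)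
    (hM : ∀ m ≥ M, z ^ m ∈ a ∧ (z⁻¹) ^ m ∉ a) : z • O ≠ O := by
  intro hz
  have hp : ∀ m : ℕ, z ^ m • O = O := by
    intro m
    induction m with
    | zero => simp
    | succ m ih => rw [pow_succ, mul_smul, hz, ih]
  have hmem : ∀ (w : Γ) (x : Γ), x ∈ w • a ↔ w⁻¹ * x ∈ a := fun w x => by
    rw [Set.mem_smul_set_iff_inv_smul_mem]; rfl
  have hinj : Function.Injective (fun m : ℕ => z ^ m • a) := by
    have key : ∀ i k : ℕ, 0 < k → z ^ i • a ≠ z ^ (i + k) • a := by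
      intro i k hk h
      rw [pow_add, mul_smul, smul_left_cancel_iff] at h
      have h3 : ∀ j : ℕ, z ^ (k * j) • a = a := by
        intro j
        induction j with
        | zero => simp
        | succ j ih => rw [Nat.mul_succ, pow_add, mul_smul, ← h, ih]
      have hb : M ≤ k * M := Nat.le_mul_of_pos_left M hk
      have q1 := (hM (k * M) hb).1
      have q2 := (hM (k * M) hb).2
      have e1 := hmem (z ^ (k * M)) 1
      have e2 := hmem (z ^ (k * M)) (z ^ (k * M))
      rw [h3] at e1 e2
      rw [inv_mul_cancel] at e2
      rw [mul_one, ← inv_pow] at e1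
      exact q2 (e1.1 (e2.1 q1))
    intro i j hij
    rcases lt_trichotomy i j with h | h | h
    · obtain ⟨k, rfl⟩ := Nat.exists_eq_add_of_lt h
      exact absurd hij (key i (k + 1) (by omega))
    · exact h
    · obtain ⟨k, rfl⟩ := Nat.exists_eq_add_of_lt h
      exact absurd hij.symm (key j (k + 1) (by omega))
  have hinf : ((fun m : ℕ => z ^ m • a) '' Set.Ici M).Infinite :=
    (Set.Ici_infinite M).image hinj.injOn
  refine hinf ((hO.fin 1).subset ?_)
  rintro _ ⟨m, hm, rfl⟩
  refine ⟨?_, ?_⟩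
  · rw [← hp m]; exact Set.smul_mem_smul_set ha
  · intro h
    have := (hmem _ _).1 h
    rw [mul_one, ← inv_pow] at this
    exact (hM m hm).2 this

lemma vtx_free (H : NF D) {O : Set (Set Γ)} (hO : IsVtx D O) {a : Set Γ} (ha : a ∈ D) (z : Γ)
    (M : ℕ) (hM : ∀ m ≥ M, z ^ m ∈ a ∧ (z⁻¹) ^ m ∉ a) : z • O ≠ O := by
  by_cases h : a ∈ O
  · exact vtx_free_aux hO h z M hM
  · have h' := (hO.ori a ha).2 h
    have := vtx_free_aux hO h' z⁻¹ M (fun m hm => by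
      rw [inv_inv]; exact ⟨(hM m hm).2, fun h => h (hM m hm).1⟩)
    intro hz
    apply this
    rw [inv_smul_eq_iff, hz]

theorem tree_exists {F : Type} [Group F] (ι : F →* Γ) (H : NF D)
    (hinv : ∀ a ∈ D, ∀ g : Γ, g • a ≠ aᶜ)
    (hsep : ∀ g, g ≠ 1 → ∃ a ∈ D, ∃ M : ℕ, ∀ m ≥ M, (ι g) ^ m ∈ a ∧ ((ι g)⁻¹) ^ m ∉ a)
    (horb : ∃ R : Set (Set Γ), R.Finite ∧ ∀ a ∈ D, ∃ g : Γ, g • a ∈ R)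
    (hne : D.Nonempty) : Nonempty (TreeData ι) := by
  classical
  obtain ⟨D', hD', hsm, hor⟩ := exists_orientation H hinv
  obtain ⟨a0, ha0⟩ := hne
  let V := {O : Set (Set Γ) // IsVtx D O}
  let E := {a : Set Γ // a ∈ D'}
  let aV : MulAction Γ V :=
    { smul := fun g O => ⟨g • O.1, vtx_smul H g O.2⟩
      one_smul := fun O => Subtype.ext (one_smul Γ O.1)
      mul_smul := fun g h O => Subtype.ext (mul_smul g h O.1) }
  let aE : MulAction Γ E :=
    { smul := fun g a => ⟨g • a.1, hsm g a.1 a.2⟩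
      one_smul := fun a => Subtype.ext (one_smul Γ a.1)
      mul_smul := fun g h a => Subtype.ext (mul_smul g h a.1) }
  let t : E → V := fun a => ⟨hd D a.1, hd_vtx H (hD' a.2)⟩
  let o : E → V := fun a => ⟨hd D a.1ᶜ, hd_vtx H (H.compl _ (hD' a.2))⟩
  have conn : ∀ Q : V → Prop, (∀ e, Q (o e) ↔ Q (t e)) → ∀ v w, Q v → Q w := by
    intro Q hQ v w hv
    have := vtx_conn H (fun O => ∃ h : IsVtx D O, Q ⟨O, h⟩) (by
      rintro a ha ⟨h1, h2⟩
      refine ⟨hd_vtx H (H.compl a ha), ?_⟩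
      by_cases hdd : a ∈ D'
      · exact (hQ ⟨a, hdd⟩).2 h2
      · have hd' := (hor a ha).2 hdd
        refine (hQ ⟨aᶜ, hd'⟩).1 ?_
        have e : o ⟨aᶜ, hd'⟩ = ⟨_, h1⟩ := Subtype.ext (by
          show hd D aᶜᶜ = _
          rw [compl_compl])
        rw [e]; exact h2) v.1 w.1 v.2 w.2 ⟨v.2, hv⟩
    exact this.2
  have hE0 : Nonempty E := by
    by_cases hd : a0 ∈ D'
    · exact ⟨⟨a0, hd⟩⟩
    · exact ⟨⟨a0ᶜ, (hor a0 ha0).2 hd⟩⟩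
  have finE : ∃ R : Set E, R.Finite ∧ ∀ e, ∃ g : Γ, g • e ∈ R := by
    obtain ⟨R, hR, h⟩ := horb
    refine ⟨Subtype.val ⁻¹' R, hR.preimage Subtype.val_injective.injOn, fun e => ?_⟩
    obtain ⟨g, hg⟩ := h e.1 (hD' e.2)
    exact ⟨g, hg⟩
  have osm : ∀ (g : Γ) (e : E), o (g • e) = g • o e := fun g e => Subtype.ext (by
    show hd D (g • e.1)ᶜ = g • hd D e.1ᶜ
    rw [smul_hd H, Set.smul_set_compl])
  have tsm : ∀ (g : Γ) (e : E), t (g • e) = g • t e := fun g e => Subtype.ext (by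
    show hd D (g • e.1) = g • hd D e.1
    rw [smul_hd H])
  refine ⟨@TreeData.mk F Γ _ _ ι V E aV aE o t osm tsm ?_ conn ?_ ⟨t hE0.some⟩ finE ?_⟩
  · intro l
    let ind : Set (Set Γ) → E → ℚ := fun O a => if a.1 ∈ O then 1 else 0
    let O0 := (t hE0.some)
    let φ : V → ℚ := fun O => ∑ᶠ a : E, l a * (ind O.1 a - ind O0.1 a)
    have hfin : ∀ O : V, (Function.support fun a : E => l a * (ind O.1 a - ind O0.1 a)).Finite := by
      intro O
      have h1 : ∀ O1 O2 : V, {a : E | a.1 ∈ O1.1 ∧ a.1 ∉ O2.1}.Finite := by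
        intro O1 O2
        have hf : ({a | a ∈ O1.1 ∧ (1 : Γ) ∉ a} ∪ compl '' {a | a ∈ O2.1 ∧ (1 : Γ) ∉ a}).Finite :=
          (O1.2.fin 1).union ((O2.2.fin 1).image compl)
        refine (hf.preimage Subtype.val_injective.injOn).subset ?_
        rintro a ⟨h1, h2⟩
        by_cases h3 : (1 : Γ) ∈ a.1
        · right
          exact ⟨a.1ᶜ, ⟨(O2.2.ori a.1 (hD' a.2)).2 h2, fun h => h h3⟩, compl_compl a.1⟩
        · exact Or.inl ⟨h1, h3⟩
      refine ((h1 O O0).union (h1 O0 O)).subset ?_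
      intro a ha
      by_contra hn
      simp only [Set.mem_union, Set.mem_ofPred_eq, not_or, not_and, not_not] at hn
      apply ha
      have : a.1 ∈ O.1 ↔ a.1 ∈ O0.1 := ⟨hn.1, hn.2⟩
      simp [ind, this]
    refine ⟨φ, fun e => ?_⟩
    rw [← finsum_sub_distrib (hfin _) (hfin _)]
    rw [finsum_eq_single _ e]
    · have h1 : e.1 ∈ (t e).1 := self_mem_hd (hD' e.2)
      have h2 : e.1 ∉ (o e).1 := by
        have := compl_notMem_hd H (H.compl _ (hD' e.2))
        rwa [compl_compl] at this
      have i1 : ind (t e).1 e = 1 := if_pos h1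
      have i2 : ind (o e).1 e = 0 := if_neg h2
      rw [i1, i2]; ring
    · intro b hb
      have h1 : b.1 ≠ e.1 := fun h => hb (Subtype.ext h)
      have h2 : b.1 ≠ e.1ᶜ := by
        intro h
        have := (hor e.1 (hD' e.2)).1 (by rw [← h]; exact b.2)
        exact this e.2
      have := hd_diff H (hD' e.2) h1 h2
      have e : b.1 ∈ (t e).1 ↔ b.1 ∈ (o e).1 := this
      simp [ind, e]
  · intro g hg v hv
    obtain ⟨a, ha, M, hM⟩ := hsep g hg
    exact vtx_free H v.2 ha (ι g) M hM (congrArg Subtype.val hv)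
  · obtain ⟨R, hR, h⟩ := finE
    refine ⟨t '' R ∪ o '' R, (hR.image t).union (hR.image o), ?_⟩
    have h1 : ∀ e : E, ∃ g : Γ, g • t e ∈ t '' R ∪ o '' R := by
      intro e
      obtain ⟨g, hg⟩ := h e
      exact ⟨g, Or.inl ⟨_, hg, tsm g e⟩⟩
    have h2 : ∀ e : E, ∃ g : Γ, g • o e ∈ t '' R ∪ o '' R := by
      intro e
      obtain ⟨g, hg⟩ := h e
      exact ⟨g, Or.inr ⟨_, hg, osm g e⟩⟩
    intro v
    exact conn (fun v => ∃ g : Γ, g • v ∈ t '' R ∪ o '' R) (fun e => ⟨fun _ => h1 e, fun _ => h2 e⟩)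
      (t hE0.some) v (h1 _)

end Tree

section Final
variable {n : ℕ} {Γ P : Type} [Group Γ] [Group P] [Finite P]
  {ι : FreeGroup (Fin n) →* Γ} {π : Γ →* P}

lemma exists_gens (hπ : Function.Surjective π)
    (hker : ∀ γ, π γ = 1 ↔ γ ∈ ι.range) :
    ∃ S : Finset Γ, Subgroup.closure (S : Set Γ) = ⊤ := by
  choose r hr using hπ
  have hf : (Set.range (fun i => ι (FreeGroup.of i)) ∪ Set.range r).Finite :=
    (Set.finite_range _).union (Set.finite_range _)
  refine ⟨hf.toFinset, ?_⟩
  rw [Set.Finite.coe_toFinset, eq_top_iff]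
  intro γ _
  have h1 : ι.range ≤ Subgroup.closure (Set.range (fun i => ι (FreeGroup.of i)) ∪ Set.range r) := by
    rw [MonoidHom.range_eq_map, ← FreeGroup.closure_range_of, MonoidHom.map_closure]
    refine Subgroup.closure_mono ?_
    rintro _ ⟨_, ⟨i, rfl⟩, rfl⟩
    exact Or.inl ⟨i, rfl⟩
  have h2 : γ * (r (π γ))⁻¹ ∈ ι.range := by
    refine (hker _).1 ?_
    rw [map_mul, map_inv, hr, mul_inv_cancel]
  have := Subgroup.mul_mem _ (h1 h2) (Subgroup.subset_closure (Or.inr ⟨π γ, rfl⟩))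
  simpa using this

/-- The structure tree of a virtually free group. -/
theorem exists_tree (hn : 0 < n) (p : ℕ) (hodd : Odd p)
    (hι : Function.Injective ι) (hπ : Function.Surjective π)
    (hker : ∀ γ, π γ = 1 ↔ γ ∈ ι.range) (hexp : ∀ x : P, x ^ p = 1) :
    Nonempty (TreeData ι) := by
  obtain ⟨S, hS⟩ := exists_gens (ι := ι) hπ hker
  obtain ⟨K, hK⟩ := exists_cut S hS hι hπ hker
  have H : NF (EE S K) :=
    { compl := fun a ha => EE_compl hS ha
      nst := fun a ha b hb => EE_nst hS ha hb
      ne := fun a ha => EE_nonempty hS ha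
      sep := EE_sep_finite hS K
      smul := fun g a ha => (EE_translate K g a).2 ha }
  have hp0 : p ≠ 0 := by rintro rfl; simp at hodd
  refine tree_exists ι H ?_ hK ?_ ?_
  · intro a ha g hg
    have hfree : ∀ f, ι f • a = a → f = 1 := by
      intro f hf
      by_contra hne
      obtain ⟨b, hb, M, hM⟩ := hK f hne
      refine vtx_free H (hd_vtx H ha) hb (ι f) M hM ?_
      rw [smul_hd H, hf]
    have h2 : (g ^ 2) • a = a := by
      rw [pow_two, mul_smul, hg, Set.smul_set_compl, hg, compl_compl]
    have h2k : ∀ k : ℕ, (g ^ 2) ^ k • a = a := by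
      intro k
      induction k with
      | zero => simp
      | succ k ih => rw [pow_succ, mul_smul, h2, ih]
    obtain ⟨f, hf⟩ : g ^ p ∈ ι.range := (hker _).1 (by rw [map_pow, hexp])
    have hf2 : f ^ 2 = 1 := by
      apply hfree
      rw [map_pow, hf, ← pow_mul, mul_comm, pow_mul]
      exact h2k p
    have hf1 : f = 1 := by
      by_contra hne
      exact hne ((pow_eq_one_iff_left (two_ne_zero)).1 hf2)
    rw [hf1, map_one] at hf
    obtain ⟨k, hk⟩ := hodd
    have : g • a = a := by
      have e : (g ^ 2) ^ (k + 1) = g := by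
        rw [← pow_mul, show 2 * (k + 1) = p + 1 by omega, pow_succ, ← hf, one_mul]
      conv_lhs => rw [← e]
      exact h2k _
    rw [hg] at this
    exact H.ne'' ha this.symm.subset
  · obtain ⟨R, hR, h⟩ := EE_orbits hS K
    exact ⟨R, hR, h⟩
  · have : FreeGroup.of (⟨0, hn⟩ : Fin n) ≠ 1 := FreeGroup.of_ne_one _
    obtain ⟨a, ha, -⟩ := hK _ this
    exact ⟨a, ha⟩
end Final
end PartSec4
end OutFormal

namespace OutFormal
section PartSec5

/-! ### Euler characteristic -/
section Count
variable {Γ P : Type} [Group Γ] [Group P] (π : Γ →* P) (hπ : Function.Surjective π)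
  (X : Type) [MulAction Γ X]

/-- The weight of a subgroup: the index of its image. -/
def wt (Q : Subgroup Γ) : ℕ := (Q.map π).index

/-- Orbits of the kernel. -/
abbrev KOrb : Type := MulAction.orbitRel.Quotient π.ker X

/-- Orbits of the full group. -/
abbrev GOrb (Γ X : Type) [Group Γ] [MulAction Γ X] : Type := MulAction.orbitRel.Quotient Γ X

/-- Stabilizer. -/
abbrev stb (Γ : Type) {X : Type} [Group Γ] [MulAction Γ X] (x : X) : Subgroup Γ :=
  MulAction.stabilizer Γ x

/-- The orbit of a point. -/
def gmk (Γ : Type) {X : Type} [Group Γ] [MulAction Γ X] (x : X) : GOrb Γ X := Quotient.mk'' x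

lemma gmk_eq {x y : X} : gmk Γ x = gmk Γ y ↔ ∃ g : Γ, g • y = x := by
  unfold gmk
  rw [Quotient.eq'']
  exact MulAction.orbitRel_apply

/-- The kernel-orbit of a point. -/
def kmk {X : Type} [MulAction Γ X] (x : X) : KOrb π X := Quotient.mk'' x

lemma kmk_eq {x y : X} : kmk π x = kmk π y ↔ ∃ g : Γ, π g = 1 ∧ g • y = x := by
  unfold kmk
  rw [Quotient.eq'']
  refine (MulAction.orbitRel_apply).trans ?_
  constructor
  · rintro ⟨g, hg⟩; exact ⟨g, g.2, hg⟩
  · rintro ⟨g, h1, h2⟩; exact ⟨⟨g, h1⟩, h2⟩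

variable {X} in
lemma gmk_out (c : GOrb Γ X) : gmk Γ c.out = c := Quotient.out_eq' c

lemma orbit_count_equiv (hπ : Function.Surjective π) :
    Nonempty ((Σ c : GOrb Γ X, P ⧸ ((stb Γ c.out).map π)) ≃ KOrb π X) := by
  choose r hr using hπ
  let f : (Σ c : GOrb Γ X, P ⧸ ((stb Γ c.out).map π)) → KOrb π X :=
    fun z => kmk π (r z.2.out • z.1.out)
  refine ⟨Equiv.ofBijective f ⟨?_, ?_⟩⟩
  · rintro ⟨c, q⟩ ⟨c', q'⟩ h
    obtain ⟨g, hg, h⟩ := (kmk_eq π X).1 h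
    simp only at h
    have hc : c = c' := by
      rw [← gmk_out c, ← gmk_out c', gmk_eq]
      refine ⟨(r q.out)⁻¹ * g * r q'.out, ?_⟩
      rw [mul_smul, mul_smul, h, inv_smul_smul]
    subst hc
    have : q = q' := by
      rw [← Quotient.out_eq' q, ← Quotient.out_eq' q', Quotient.eq'']
      rw [QuotientGroup.leftRel_apply]
      refine ⟨(r q.out)⁻¹ * g * r q'.out, ?_, ?_⟩
      · show _ • _ = _
        rw [mul_smul, mul_smul, h, inv_smul_smul]
      · simp [hr, hg]
    rw [this]
  · intro z
    obtain ⟨x, rfl⟩ := Quotient.exists_rep z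
    obtain ⟨γ, hγ⟩ := (gmk_eq X).1 (gmk_out (gmk Γ x)).symm
    refine ⟨⟨gmk Γ x, (QuotientGroup.mk (π γ) : P ⧸ _)⟩, ?_⟩
    show kmk π _ = kmk π x
    rw [kmk_eq]
    obtain ⟨⟨k, hk⟩, e⟩ := QuotientGroup.mk_out_eq_mul ((stb Γ (gmk Γ x).out).map π) (π γ)
    obtain ⟨s, hs, rfl⟩ := hk
    simp only at e ⊢
    refine ⟨r (π γ * π s) * (γ * s)⁻¹, ?_, ?_⟩
    · rw [map_mul, hr, map_inv, map_mul, mul_inv_cancel]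
    · have hs' : s⁻¹ • (gmk Γ x).out = (gmk Γ x).out := by
        rw [inv_smul_eq_iff]; exact (show s • _ = _ from hs).symm
      have : (γ * s)⁻¹ • x = (gmk Γ x).out := by
        rw [inv_smul_eq_iff, mul_smul, show s • (gmk Γ x).out = _ from hs, hγ]
      rw [mul_smul, this, e]

lemma orbit_count (hπ : Function.Surjective π) [Finite P] [Fintype (GOrb Γ X)] :
    Finite (KOrb π X) ∧ Nat.card (KOrb π X) = ∑ c : GOrb Γ X, wt π (stb Γ c.out) := by
  obtain ⟨e⟩ := orbit_count_equiv π X hπ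
  refine ⟨Finite.of_equiv _ e, ?_⟩
  rw [← Nat.card_congr e, Nat.card_sigma]
  rfl

end Count

section Euler
variable {n : ℕ} {Γ P : Type} [Group Γ] [Group P] [Finite P]
  {ι : FreeGroup (Fin n) →* Γ} {π : Γ →* P}

lemma euler (hι : Function.Injective ι)
    (hker : ∀ γ, π γ = 1 ↔ γ ∈ ι.range) (T : TreeData ι)
    [Finite (KOrb π T.V)] [Finite (KOrb π T.E)] :
    Nat.card (KOrb π T.E) + 1 = n + Nat.card (KOrb π T.V) := by
  classical
  have := Fintype.ofFinite (KOrb π T.V)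
  have := Fintype.ofFinite (KOrb π T.E)
  let W : Submodule ℚ (T.V → ℚ) :=
    { carrier := {φ | ∀ f e, φ (ι f • T.t e) - φ (ι f • T.o e) = φ (T.t e) - φ (T.o e)}
      add_mem' := by
        intro a b ha hb f e
        have := ha f e; have := hb f e
        simp only [Pi.add_apply]; linarith
      zero_mem' := by intro f e; simp
      smul_mem' := by
        intro c a ha f e
        have := ha f e
        simp only [Pi.smul_apply, smul_eq_mul, ← mul_sub, this] }
  obtain ⟨v0⟩ := T.ne
  have hconst : ∀ φ : T.V → ℚ, (∀ e, φ (T.t e) = φ (T.o e)) → ∀ v w, φ v = φ w := by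
    intro φ h v w
    exact (T.conn (fun x => φ v = φ x) (fun e => by rw [h e]) v w rfl)
  -- first count
  have key1 : Nonempty (W ≃ₗ[ℚ] (KOrb π T.E → ℚ) × ℚ) := by
    let Ψ : (T.V → ℚ) →ₗ[ℚ] (KOrb π T.E → ℚ) × ℚ :=
      { toFun := fun φ => (fun c => φ (T.t c.out) - φ (T.o c.out), φ v0)
        map_add' := by
          intro a b; ext
          · simp only [Pi.add_apply, Prod.mk_add_mk]; ring
          · simp
        map_smul' := by
          intro a b; ext
          · simp only [Pi.smul_apply, smul_eq_mul, Prod.smul_mk, RingHom.id_apply]; ring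
          · simp }
    refine ⟨LinearEquiv.ofBijective (Ψ.comp W.subtype) ⟨?_, ?_⟩⟩
    · rw [← LinearMap.ker_eq_bot, LinearMap.ker_eq_bot']
      rintro ⟨φ, hφ⟩ h
      have h1 : (fun c : KOrb π T.E => φ (T.t c.out) - φ (T.o c.out)) = 0 := congrArg Prod.fst h
      have h2 : φ v0 = 0 := congrArg Prod.snd h
      have h3 : ∀ e, φ (T.t e) = φ (T.o e) := by
        intro e
        have : kmk π e = kmk π (kmk π e).out := (Quotient.out_eq' _).symm
        obtain ⟨g, hg, he⟩ := (kmk_eq π T.E).1 this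
        obtain ⟨f, rfl⟩ := (hker g).1 hg
        have h4 := hφ f (kmk π e).out
        have h5 := congrFun h1 (kmk π e)
        simp only [Pi.zero_apply] at h5
        rw [← T.t_smul, ← T.o_smul, he] at h4
        linarith
      ext v
      show φ v = 0
      rw [hconst φ h3 v v0, h2]
    · rintro ⟨l, x⟩
      obtain ⟨φ, hφ⟩ := T.grad (fun e => l (kmk π e))
      refine ⟨⟨fun v => φ v - φ v0 + x, ?_⟩, ?_⟩
      · intro f e
        have h1 := hφ e
        have h2 := hφ (ι f • e)
        have : kmk π (ι f • e) = kmk π e := (kmk_eq π T.E).2 ⟨ι f, (hker _).2 ⟨f, rfl⟩, rfl⟩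
        rw [this, T.t_smul, T.o_smul] at h2
        linarith
      · show ((fun c : KOrb π T.E => _), _) = _
        ext c
        · have := hφ c.out
          have e : kmk π c.out = c := Quotient.out_eq' c
          rw [e] at this
          show (φ (T.t c.out) - φ v0 + x) - (φ (T.o c.out) - φ v0 + x) = l c
          linarith
        · simp
  -- second count
  have key2 : Nonempty (W ≃ₗ[ℚ] (Fin n → ℚ) × (KOrb π T.V → ℚ)) := by
    let Ψ : (T.V → ℚ) →ₗ[ℚ] (Fin n → ℚ) × (KOrb π T.V → ℚ) :=
      { toFun := fun φ => (fun i => φ (ι (FreeGroup.of i) • v0) - φ v0, fun c => φ c.out)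
        map_add' := by
          intro a b; ext
          · simp only [Pi.add_apply, Prod.mk_add_mk]; ring
          · simp
        map_smul' := by
          intro a b; ext
          · simp only [Pi.smul_apply, smul_eq_mul, Prod.smul_mk, RingHom.id_apply]; ring
          · simp }
    have hchi : ∀ φ ∈ W, ∀ f v w, φ (ι f • v) - φ v = φ (ι f • w) - φ w := by
      intro φ hφ f v w
      exact hconst (fun v => φ (ι f • v) - φ v) (fun e => by have := hφ f e; linarith) v w
    refine ⟨LinearEquiv.ofBijective (Ψ.comp W.subtype) ⟨?_, ?_⟩⟩
    · rw [← LinearMap.ker_eq_bot, LinearMap.ker_eq_bot']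
      rintro ⟨φ, hφ⟩ h
      have h1 : (fun i => φ (ι (FreeGroup.of i) • v0) - φ v0) = 0 := congrArg Prod.fst h
      have h2 : (fun c : KOrb π T.V => φ c.out) = 0 := congrArg Prod.snd h
      have h3 : ∀ f v, φ (ι f • v) = φ v := by
        intro f
        have hf : f ∈ Subgroup.closure (Set.range (FreeGroup.of : Fin n → _)) := by
          rw [FreeGroup.closure_range_of]; trivial
        induction hf using Subgroup.closure_induction with
        | mem s hs =>
          obtain ⟨i, rfl⟩ := hs
          intro v
          have := hchi φ hφ (FreeGroup.of i) v v0
          have h5 := congrFun h1 i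
          simp only [Pi.zero_apply] at h5
          linarith
        | one => simp
        | mul g h _ _ i1 i2 => intro v; rw [map_mul, mul_smul, i1, i2]
        | inv g _ i => intro v; rw [← i (ι g⁻¹ • v), ← mul_smul, ← map_mul]; simp
      ext v
      show φ v = 0
      have : kmk π v = kmk π (kmk π v).out := (Quotient.out_eq' _).symm
      obtain ⟨g, hg, he⟩ := (kmk_eq π T.V).1 this
      obtain ⟨f, rfl⟩ := (hker g).1 hg
      rw [← he, h3]
      exact congrFun h2 _
    · rintro ⟨x, y⟩
      let χ : FreeGroup (Fin n) →* Multiplicative ℚ := FreeGroup.lift fun i => Multiplicative.ofAdd (x i)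
      have hex : ∀ v : T.V, ∃ f, ι f • (kmk π v).out = v := by
        intro v
        have : kmk π v = kmk π (kmk π v).out := (Quotient.out_eq' _).symm
        obtain ⟨g, hg, he⟩ := (kmk_eq π T.V).1 this
        obtain ⟨f, rfl⟩ := (hker g).1 hg
        exact ⟨f, he⟩
      choose s hs using hex
      have hs1 : ∀ f v, s (ι f • v) = f * s v := by
        intro f v
        have e : kmk π (ι f • v) = kmk π v := (kmk_eq π T.V).2 ⟨ι f, (hker _).2 ⟨f, rfl⟩, rfl⟩
        have h1 := hs (ι f • v)
        rw [e] at h1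
        conv_rhs at h1 => rw [← hs v]
        by_contra hne
        have hne' : (f * s v)⁻¹ * s (ι f • v) ≠ 1 := fun h => hne (inv_mul_eq_one.1 h).symm
        refine T.free _ hne' (kmk π v).out ?_
        rw [map_mul, mul_smul, h1, map_inv, map_mul, inv_smul_eq_iff, mul_smul]
      let φ : T.V → ℚ := fun v => (χ (s v)).toAdd + y (kmk π v)
      have hφ1 : ∀ f v, φ (ι f • v) = (χ f).toAdd + φ v := by
        intro f v
        have e : kmk π (ι f • v) = kmk π v := (kmk_eq π T.V).2 ⟨ι f, (hker _).2 ⟨f, rfl⟩, rfl⟩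
        simp only [φ, hs1, e, map_mul, toAdd_mul]; ring
      refine ⟨⟨φ, ?_⟩, ?_⟩
      · intro f e
        rw [hφ1, hφ1]; ring
      · show ((fun i => φ _ - φ _), (fun c : KOrb π T.V => φ c.out)) = _
        ext c
        · simp only [hφ1]
          simp [χ]
        · have e : kmk π c.out = c := Quotient.out_eq' c
          have h1 := hs c.out
          rw [e] at h1
          have : s c.out = 1 := by
            by_contra hne
            exact T.free _ hne _ h1
          simp [φ, this, e]
  obtain ⟨e1⟩ := key1
  obtain ⟨e2⟩ := key2
  have := (e1.symm.trans e2).finrank_eq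
  simp only [Module.finrank_prod, Module.finrank_pi, Module.finrank_self, Fintype.card_fin] at this
  rw [Nat.card_eq_fintype_card, Nat.card_eq_fintype_card]
  exact this

end Euler
end PartSec5
end OutFormal

namespace OutFormal
section PartSec6

/-! ### Growing a maximal tree -/

/-- The chain condition on a list of (vertex group, edge group) pairs. -/
def Chn {Γ : Type} [Group Γ] (Q0 : Subgroup Γ) : List (Subgroup Γ × Subgroup Γ) → Prop
  | [] => True
  | x :: L => x.2 < x.1 ∧ (∃ Q ∈ Q0 :: L.map Prod.fst, x.2 ≤ Q) ∧ Chn Q0 L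

section Grow
variable {n : ℕ} {Γ P : Type} [Group Γ] [CommGroup P] [Finite P]
  {ι : FreeGroup (Fin n) →* Γ} {π : Γ →* P}

lemma wt_smul {X : Type} [MulAction Γ X] (g : Γ) (x : X) :
    wt π (stb Γ (g • x)) = wt π (stb Γ x) := by
  unfold wt
  congr 1
  ext y
  constructor
  · rintro ⟨h, hh, rfl⟩
    refine ⟨g⁻¹ * h * g, ?_, ?_⟩
    · show (g⁻¹ * h * g) • x = x
      rw [mul_smul, mul_smul, show h • g • x = g • x from hh, inv_smul_smul]
    · rw [map_mul, map_mul, map_inv, mul_comm, mul_inv_cancel_left]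
  · rintro ⟨h, hh, rfl⟩
    refine ⟨g * h * g⁻¹, ?_, ?_⟩
    · show (g * h * g⁻¹) • g • x = g • x
      rw [mul_smul, mul_smul, inv_smul_smul, show h • x = x from hh]
    · rw [map_mul, map_mul, map_inv, mul_comm, inv_mul_cancel_left]

lemma wt_gmk {X : Type} [MulAction Γ X] {x y : X} (h : gmk Γ x = gmk Γ y) :
    wt π (stb Γ x) = wt π (stb Γ y) := by
  obtain ⟨g, rfl⟩ := (gmk_eq X).1 h
  exact wt_smul g y

/-- A partially grown maximal tree. -/
structure Grown (π : Γ →* P) (T : TreeData ι) (v0 : T.V) (S : Finset T.V) (B : Finset T.E)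
    (L : List (Subgroup Γ × Subgroup Γ)) : Prop where
  v0_mem : v0 ∈ S
  injS : Set.InjOn (gmk Γ) (S : Set T.V)
  injB : Set.InjOn (gmk Γ) (B : Set T.E)
  edges : ∀ e ∈ B, T.o e ∈ S ∧ T.t e ∈ S
  cov : ∀ v ∈ S, ∃ Q ∈ stb Γ v0 :: L.map Prod.fst, stb Γ v ≤ Q
  chain : Chn (stb Γ v0) L
  vst : ∀ x ∈ L, ∃ v : T.V, x.1 = stb Γ v
  cnt : ∑ v ∈ S, wt π (stb Γ v) + (L.map fun x => wt π x.2).sum =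
    ∑ e ∈ B, wt π (stb Γ e) + wt π (stb Γ v0) + (L.map fun x => wt π x.1).sum

lemma Grown.step {T : TreeData ι} {v0 : T.V} {S B L} (h : Grown π T v0 S B L)
    (e : T.E) (v v' : T.V) (hv : v ∈ S) (hv' : ∀ s ∈ S, gmk Γ s ≠ gmk Γ v')
    (he : (T.o e = v ∧ T.t e = v') ∨ (T.t e = v ∧ T.o e = v')) :
    ∃ S' B' L', Grown π T v0 S' B' L' ∧ (S'.card = S.card + 1) := by
  classical
  have hv'S : v' ∉ S := fun h => hv' _ h rfl
  have hev : stb Γ e ≤ stb Γ v ∧ stb Γ e ≤ stb Γ v' := by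
    have h1 : stb Γ e ≤ stb Γ (T.o e) := fun g hg => by
      show g • _ = _
      rw [← T.o_smul, show g • e = e from hg]
    have h2 : stb Γ e ≤ stb Γ (T.t e) := fun g hg => by
      show g • _ = _
      rw [← T.t_smul, show g • e = e from hg]
    rcases he with ⟨rfl, rfl⟩ | ⟨rfl, rfl⟩
    · exact ⟨h1, h2⟩
    · exact ⟨h2, h1⟩
  have heB' : ∀ b ∈ B, gmk Γ b ≠ gmk Γ e := by
    intro b hb hbe
    obtain ⟨g, rfl⟩ := (gmk_eq T.E).1 hbe
    obtain ⟨h1, h2⟩ := h.edges _ hb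
    rw [T.o_smul] at h1
    rw [T.t_smul] at h2
    rcases he with ⟨rfl, rfl⟩ | ⟨rfl, rfl⟩
    · exact hv' _ h2 ((gmk_eq T.V).2 ⟨g, rfl⟩)
    · exact hv' _ h1 ((gmk_eq T.V).2 ⟨g, rfl⟩)
  have heB : e ∉ B := fun h => heB' _ h rfl
  have injS : Set.InjOn (gmk Γ) ((insert v' S : Finset T.V) : Set T.V) := by
    rw [Finset.coe_insert, Set.injOn_insert (by simpa using hv'S)]
    refine ⟨h.injS, ?_⟩
    rintro ⟨s, hs, hs'⟩
    exact hv' s hs hs'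
  have injB : Set.InjOn (gmk Γ) ((insert e B : Finset T.E) : Set T.E) := by
    rw [Finset.coe_insert, Set.injOn_insert (by simpa using heB)]
    refine ⟨h.injB, ?_⟩
    rintro ⟨s, hs, hs'⟩
    exact heB' s hs hs'
  have edges : ∀ b ∈ insert e B, T.o b ∈ insert v' S ∧ T.t b ∈ insert v' S := by
    intro b hb
    rcases Finset.mem_insert.1 hb with rfl | hb
    · rcases he with ⟨h1, h2⟩ | ⟨h1, h2⟩ <;> rw [h1, h2] <;> simp [hv]
    · exact ⟨Finset.mem_insert_of_mem (h.edges b hb).1, Finset.mem_insert_of_mem (h.edges b hb).2⟩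
  have hcnt := h.cnt
  by_cases hst : stb Γ e = stb Γ v'
  · refine ⟨insert v' S, insert e B, L, ⟨Finset.mem_insert_of_mem h.v0_mem, injS, injB, edges,
      ?_, h.chain, h.vst, ?_⟩, Finset.card_insert_of_notMem hv'S⟩
    · intro x hx
      rcases Finset.mem_insert.1 hx with rfl | hx
      · obtain ⟨Q, hQ, h1⟩ := h.cov v hv
        exact ⟨Q, hQ, hst ▸ (hev.1.trans h1)⟩
      · exact h.cov x hx
    · rw [Finset.sum_insert hv'S, Finset.sum_insert heB, hst]
      omega
  · refine ⟨insert v' S, insert e B, (stb Γ v', stb Γ e) :: L,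
      ⟨Finset.mem_insert_of_mem h.v0_mem, injS, injB, edges,
      ?_, ⟨lt_of_le_of_ne hev.2 hst, ?_, h.chain⟩, ?_, ?_⟩, Finset.card_insert_of_notMem hv'S⟩
    · intro x hx
      rcases Finset.mem_insert.1 hx with rfl | hx
      · exact ⟨stb Γ x, by simp, le_rfl⟩
      · obtain ⟨Q, hQ, h1⟩ := h.cov x hx
        refine ⟨Q, ?_, h1⟩
        simp only [List.map_cons, List.mem_cons] at hQ ⊢
        tauto
    · obtain ⟨Q, hQ, h1⟩ := h.cov v hv
      exact ⟨Q, hQ, hev.1.trans h1⟩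
    · intro x hx
      rcases List.mem_cons.1 hx with rfl | hx
      · exact ⟨v', rfl⟩
      · exact h.vst x hx
    · rw [Finset.sum_insert hv'S, Finset.sum_insert heB]
      simp only [List.map_cons, List.sum_cons]
      omega

lemma Grown.exists_full (T : TreeData ι) [Finite (GOrb Γ T.V)] (v0 : T.V) :
    ∃ S B L, Grown π T v0 S B L ∧ ∀ v, ∃ s ∈ S, gmk Γ s = gmk Γ v := by
  classical
  have := Fintype.ofFinite (GOrb Γ T.V)
  have hbase : ∃ S B L, Grown π T v0 S B L := by
    refine ⟨{v0}, ∅, [], by simp, by simp, by simp, by simp, ?_, trivial, by simp, by simp⟩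
    intro v hv
    rw [Finset.mem_singleton.1 hv]
    exact ⟨_, by simp, le_rfl⟩
  by_contra hcon
  push Not at hcon
  have hgrow : ∀ k : ℕ, ∃ S B L, Grown π T v0 S B L ∧ k ≤ S.card := by
    intro k
    induction k with
    | zero => obtain ⟨S, B, L, h⟩ := hbase; exact ⟨S, B, L, h, Nat.zero_le _⟩
    | succ k ih =>
      obtain ⟨S, B, L, h, hk⟩ := ih
      obtain ⟨w, hw⟩ := hcon S B L h
      by_contra hno
      have hstep : ∀ (e : T.E) (v v' : T.V), v ∈ S →
          ((T.o e = v ∧ T.t e = v') ∨ (T.t e = v ∧ T.o e = v')) → ∃ s ∈ S, gmk Γ s = gmk Γ v' := by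
        intro e v v' hv he
        by_contra hc
        push Not at hc
        obtain ⟨S', B', L', h', hc'⟩ := h.step e v v' hv hc he
        exact hno ⟨S', B', L', h', by omega⟩
      have hstep' : ∀ (e : T.E) (v v' : T.V), (∃ s ∈ S, gmk Γ s = gmk Γ v) →
          ((T.o e = v ∧ T.t e = v') ∨ (T.t e = v ∧ T.o e = v')) → ∃ s ∈ S, gmk Γ s = gmk Γ v' := by
        rintro e v v' ⟨s, hs, hsv⟩ he
        obtain ⟨g, rfl⟩ := (gmk_eq T.V).1 hsv
        obtain ⟨s', hs', h2⟩ := hstep (g • e) (g • v) (g • v') hs (by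
          rw [T.o_smul, T.t_smul]
          rcases he with ⟨rfl, rfl⟩ | ⟨rfl, rfl⟩
          · left; exact ⟨rfl, rfl⟩
          · right; exact ⟨rfl, rfl⟩)
        exact ⟨s', hs', h2.trans ((gmk_eq T.V).2 ⟨g, rfl⟩)⟩
      obtain ⟨s, hs, h2⟩ := T.conn (fun v => ∃ s ∈ S, gmk Γ s = gmk Γ v)
        (fun e => ⟨fun h => hstep' e _ _ h (Or.inl ⟨rfl, rfl⟩),
          fun h => hstep' e _ _ h (Or.inr ⟨rfl, rfl⟩)⟩) v0 w ⟨v0, h.v0_mem, rfl⟩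
      exact hw s hs h2
  obtain ⟨S, B, L, h, hk⟩ := hgrow (Fintype.card (GOrb Γ T.V) + 1)
  have := Finset.card_le_card_of_injOn (t := Finset.univ) (gmk Γ) (fun _ _ => Finset.mem_univ _) h.injS
  rw [Finset.card_univ] at this
  omega

end Grow
end PartSec6
end OutFormal

namespace OutFormal
section PartSec7

/-! ### Decomposition of the extension -/
section Decomp
variable {n : ℕ} {Γ P : Type} [Group Γ] [CommGroup P] [Finite P]
  {ι : FreeGroup (Fin n) →* Γ} {π : Γ →* P}

lemma TreeData.stb_le_o (T : TreeData ι) (e : T.E) : stb Γ e ≤ stb Γ (T.o e) := fun g hg => by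
  show g • _ = _
  rw [← T.o_smul, show g • e = e from hg]

lemma TreeData.stb_le_t (T : TreeData ι) (e : T.E) : stb Γ e ≤ stb Γ (T.t e) := fun g hg => by
  show g • _ = _
  rw [← T.t_smul, show g • e = e from hg]

lemma TreeData.finite_orbE (T : TreeData ι) : Finite (GOrb Γ T.E) := by
  obtain ⟨R, hR, h⟩ := T.finE
  have := hR.to_subtype
  refine Finite.of_surjective (fun r : R => gmk Γ (r : T.E)) ?_
  intro c
  obtain ⟨g, hg⟩ := h c.out
  refine ⟨⟨_, hg⟩, ?_⟩
  exact ((gmk_eq T.E).2 ⟨g, rfl⟩ : gmk Γ (g • c.out) = gmk Γ c.out).trans (gmk_out c)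

lemma TreeData.finite_orbV (T : TreeData ι) : Finite (GOrb Γ T.V) := by
  obtain ⟨R, hR, h⟩ := T.finV
  have := hR.to_subtype
  refine Finite.of_surjective (fun r : R => gmk Γ (r : T.V)) ?_
  intro c
  obtain ⟨g, hg⟩ := h c.out
  refine ⟨⟨_, hg⟩, ?_⟩
  exact ((gmk_eq T.V).2 ⟨g, rfl⟩ : gmk Γ (g • c.out) = gmk Γ c.out).trans (gmk_out c)

lemma TreeData.stb_inj (T : TreeData ι) (hker : ∀ γ, π γ = 1 ↔ γ ∈ ι.range) (v : T.V)
    (g : Γ) (hg : g ∈ stb Γ v) (h1 : π g = 1) : g = 1 := by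
  obtain ⟨f, rfl⟩ := (hker g).1 h1
  by_contra hne
  exact T.free f (fun h => hne (by rw [h, map_one])) v hg

lemma wt_dvd {Q R : Subgroup Γ} (h : R ≤ Q) : wt π Q ∣ wt π R :=
  Subgroup.index_dvd_of_le (Subgroup.map_mono h)

lemma wt_pow {p : ℕ} (hp : p.Prime) (hexp : ∀ x : P, x ^ p = 1) (Q : Subgroup Γ) :
    ∃ k, wt π Q = p ^ k := by
  haveI := Fact.mk hp
  have hP : IsPGroup p P := fun x => ⟨1, by rw [pow_one]; exact hexp x⟩
  obtain ⟨m, hm⟩ := hP.exists_card_eq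
  have : wt π Q ∣ p ^ m := by rw [← hm]; exact Subgroup.index_dvd_card _
  obtain ⟨k, -, hk⟩ := (Nat.dvd_prime_pow hp).1 this
  exact ⟨k, hk⟩

/-- The result of the decomposition. -/
structure Deco (π : Γ →* P) (n : ℕ) (Q0 : Subgroup Γ) (L : List (Subgroup Γ × Subgroup Γ))
    (J : Type) [Fintype J] (A a b : J → Subgroup Γ) (τ : J → Γ) : Prop where
  inj : ∀ Q ∈ Q0 :: L.map Prod.fst, ∀ g ∈ Q, π g = 1 → g = 1
  wt0 : wt π Q0 = 1
  chain : Chn Q0 L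
  ha : ∀ j, a j ∈ Q0 :: L.map Prod.fst
  hb : ∀ j, b j ∈ Q0 :: L.map Prod.fst
  hAa : ∀ j, A j ≤ a j
  hAb : ∀ j, ∀ g ∈ A j, (τ j)⁻¹ * g * τ j ∈ b j
  cnt : ∑ j, wt π (A j) + (L.map fun x => wt π x.2).sum = n + (L.map fun x => wt π x.1).sum
  gen : Subgroup.closure ({g | ∃ Q ∈ Q0 :: L.map Prod.fst, g ∈ Q} ∪ Set.range τ) = ⊤

lemma exists_root (p : ℕ) (hp : p.Prime) (hp3 : 3 < p) (hn : n = 2 * (p - 1))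
    (hexp : ∀ x : P, x ^ p = 1) (T : TreeData ι) [Fintype (GOrb Γ T.V)] [Fintype (GOrb Γ T.E)]
    (hE : ∑ c : GOrb Γ T.E, wt π (stb Γ c.out) + 1 = n + ∑ c : GOrb Γ T.V, wt π (stb Γ c.out)) :
    ∃ v : T.V, wt π (stb Γ v) = 1 := by
  by_contra hno
  push Not at hno
  have h1 : ∀ v : T.V, p ∣ wt π (stb Γ v) := by
    intro v
    obtain ⟨k, hk⟩ := wt_pow (π := π) hp hexp (stb Γ v)
    have := hno v
    rcases k with _ | k
    · rw [hk] at this; simp at this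
    · rw [hk, pow_succ]; exact Dvd.intro_left _ rfl
  have h2 : ∀ e : T.E, p ∣ wt π (stb Γ e) := fun e => (h1 (T.o e)).trans (wt_dvd (T.stb_le_o e))
  have h3 := Finset.dvd_sum (s := Finset.univ) (fun (c : GOrb Γ T.V) _ => h1 c.out)
  have h4 := Finset.dvd_sum (s := Finset.univ) (fun (c : GOrb Γ T.E) _ => h2 c.out)
  obtain ⟨x, hx⟩ := h3
  obtain ⟨y, hy⟩ := h4
  rw [hx, hy, hn] at hE
  have : p ∣ 3 := by
    have : (p : ℤ) ∣ 3 := ⟨2 + x - y, by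
      have h5 : ((p * y + 1 : ℕ) : ℤ) = ((2 * (p - 1) + p * x : ℕ) : ℤ) := by rw [hE]
      push_cast [Nat.cast_sub (by omega : 1 ≤ p)] at h5
      linarith⟩
    exact_mod_cast this
  have := Nat.le_of_dvd (by norm_num) this
  omega

lemma exists_deco (p : ℕ) (hp : p.Prime) (hp3 : 3 < p) (hn : n = 2 * (p - 1))
    (hι : Function.Injective ι) (hπ : Function.Surjective π)
    (hker : ∀ γ, π γ = 1 ↔ γ ∈ ι.range) (hexp : ∀ x : P, x ^ p = 1) (T : TreeData ι) :
    ∃ (Q0 : Subgroup Γ) (L : List (Subgroup Γ × Subgroup Γ)) (J : Type) (_ : Fintype J)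
      (A a b : J → Subgroup Γ) (τ : J → Γ), Deco π n Q0 L J A a b τ := by
  classical
  have := T.finite_orbE
  have := T.finite_orbV
  have := Fintype.ofFinite (GOrb Γ T.V)
  have := Fintype.ofFinite (GOrb Γ T.E)
  obtain ⟨f1, e1⟩ := orbit_count π T.V hπ
  obtain ⟨f2, e2⟩ := orbit_count π T.E hπ
  have hE := euler hι hker T
  rw [e1, e2] at hE
  obtain ⟨v0, hv0⟩ := exists_root p hp hp3 hn hexp T hE
  obtain ⟨S, B, L, h, hS⟩ := Grown.exists_full (π := π) T v0
  have hsumV : ∑ c : GOrb Γ T.V, wt π (stb Γ c.out) = ∑ v ∈ S, wt π (stb Γ v) := by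
    symm
    refine Finset.sum_bij (fun v _ => gmk Γ v) (fun _ _ => Finset.mem_univ _) ?_ ?_ ?_
    · intro a ha b hb hab; exact h.injS ha hb hab
    · intro c _
      obtain ⟨s, hs, h1⟩ := hS c.out
      exact ⟨s, hs, h1.trans (gmk_out c)⟩
    · intro v _
      exact wt_gmk (gmk_out _).symm
  have hsumE : ∑ c : GOrb Γ T.E, wt π (stb Γ c.out) = ∑ e ∈ B, wt π (stb Γ e) +
      ∑ c : {c : GOrb Γ T.E // c ∉ B.image (gmk Γ)}, wt π (stb Γ c.1.out) := by
    rw [← Finset.sum_add_sum_compl (B.image (gmk Γ))]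
    congr 1
    · symm
      refine Finset.sum_bij (fun v _ => gmk Γ v) (fun _ hv => Finset.mem_image_of_mem _ hv) ?_ ?_ ?_
      · intro a ha b hb hab; exact h.injB ha hb hab
      · intro c hc
        obtain ⟨s, hs, h1⟩ := Finset.mem_image.1 hc
        exact ⟨s, hs, h1⟩
      · intro v _
        exact wt_gmk (gmk_out _).symm
    · exact Finset.sum_subtype _ (fun x => by rw [Finset.mem_compl]) _
  have hlift : ∀ c : {c : GOrb Γ T.E // c ∉ B.image (gmk Γ)}, ∃ (e : T.E) (s s' : T.V) (τ : Γ),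
      gmk Γ e = c.1 ∧ s ∈ S ∧ s' ∈ S ∧ T.o e = s ∧ T.t e = τ • s' := by
    intro c
    obtain ⟨s, hs, h1⟩ := hS (T.o c.1.out)
    obtain ⟨g, hg⟩ := (gmk_eq T.V).1 h1
    obtain ⟨s', hs', h2⟩ := hS (T.t (g • c.1.out))
    obtain ⟨τ, hτ⟩ := (gmk_eq T.V).1 h2.symm
    refine ⟨g • c.1.out, s, s', τ, ?_, hs, hs', ?_, hτ.symm⟩
    · conv_rhs => rw [← gmk_out c.1]
      exact (gmk_eq T.E).2 ⟨g, rfl⟩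
    · rw [T.o_smul, hg]
  choose ed s s' τ hed hs hs' ho ht using hlift
  choose a0 ha0 ha1 using fun c => h.cov (s c) (hs c)
  choose b0 hb0 hb1 using fun c => h.cov (s' c) (hs' c)
  refine ⟨stb Γ v0, L, {c : GOrb Γ T.E // c ∉ B.image (gmk Γ)}, inferInstance,
    fun c => stb Γ (ed c), a0, b0, τ, ?_, hv0, h.chain, ha0, hb0, ?_, ?_, ?_, ?_⟩
  · intro Q hQ g hg h1
    rcases List.mem_cons.1 hQ with rfl | hQ
    · exact T.stb_inj hker v0 g hg h1
    · obtain ⟨x, hx, rfl⟩ := List.mem_map.1 hQ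
      obtain ⟨v, hv⟩ := h.vst x hx
      rw [hv] at hg
      exact T.stb_inj hker v g hg h1
  · intro c
    refine le_trans ?_ (ha1 c)
    rw [← ho c]; exact T.stb_le_o _
  · intro c g hg
    apply hb1 c
    have := T.stb_le_t _ hg
    rw [ht c] at this
    show _ • _ = _
    rw [mul_smul, mul_smul, show g • τ c • s' c = _ from this, inv_smul_smul]
  · have h1 : ∀ c, wt π (stb Γ (ed c)) = wt π (stb Γ c.1.out) := fun c =>
      wt_gmk (by rw [hed c, gmk_out])
    simp only [h1]
    have := h.cnt
    omega
  · set Δ := Subgroup.closure ({g | ∃ Q ∈ stb Γ v0 :: L.map Prod.fst, g ∈ Q} ∪ Set.range τ) with hΔ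
    have hst : ∀ v ∈ S, stb Γ v ≤ Δ := by
      intro v hv g hg
      obtain ⟨Q, hQ, h1⟩ := h.cov v hv
      exact Subgroup.subset_closure (Or.inl ⟨Q, hQ, h1 hg⟩)
    have hτ : ∀ c, τ c ∈ Δ := fun c => Subgroup.subset_closure (Or.inr ⟨c, rfl⟩)
    have hlift2 : ∀ e : T.E, ∃ g : Γ, ∃ e' : T.E, ∃ x ∈ S, ∃ y ∈ S, ∃ d ∈ Δ,
        e = g • e' ∧ T.o e' = x ∧ T.t e' = d • y := by
      intro e
      by_cases hc : gmk Γ e ∈ B.image (gmk Γ)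
      · obtain ⟨e', he', h1⟩ := Finset.mem_image.1 hc
        obtain ⟨g, hg⟩ := (gmk_eq T.E).1 h1.symm
        exact ⟨g, e', _, (h.edges e' he').1, _, (h.edges e' he').2, 1, Δ.one_mem, hg.symm, rfl,
          by rw [one_smul]⟩
      · obtain ⟨g, hg⟩ := (gmk_eq T.E).1 (hed ⟨_, hc⟩).symm
        exact ⟨g, _, _, hs ⟨_, hc⟩, _, hs' ⟨_, hc⟩, _, hτ ⟨_, hc⟩, hg.symm, ho _, ht _⟩
    have key : ∀ (g d : Γ) (x y : T.V), x ∈ S → y ∈ S → d ∈ Δ → g • x = d • y → g ∈ Δ := by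
      intro g d x y hx hy hd hgd
      have : x = y := by
        refine h.injS hx hy ((gmk_eq T.V).2 ⟨g⁻¹ * d, ?_⟩)
        rw [mul_smul, ← hgd, inv_smul_smul]
      subst this
      have h1 : d⁻¹ * g ∈ stb Γ x := by
        show _ • _ = _
        rw [mul_smul, hgd, inv_smul_smul]
      have := Δ.mul_mem hd (hst x hx h1)
      rwa [mul_inv_cancel_left] at this
    have hall : ∀ v : T.V, ∃ d ∈ Δ, ∃ x ∈ S, v = d • x := by
      intro v
      refine T.conn (fun v => ∃ d ∈ Δ, ∃ x ∈ S, v = d • x) ?_ v0 v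
        ⟨1, Δ.one_mem, v0, h.v0_mem, by rw [one_smul]⟩
      intro e
      obtain ⟨g, e', x, hx, y, hy, d, hd, rfl, h1, h2⟩ := hlift2 e
      rw [T.o_smul, T.t_smul, h1, h2]
      constructor
      · rintro ⟨d', hd', z, hz, h3⟩
        have := key _ _ _ _ hx hz hd' h3
        exact ⟨g * d, Δ.mul_mem this hd, y, hy, by rw [mul_smul]⟩
      · rintro ⟨d', hd', z, hz, h3⟩
        rw [← mul_smul] at h3
        have := key _ _ _ _ hy hz hd' h3
        refine ⟨g, ?_, x, hx, rfl⟩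
        have := Δ.mul_mem this (Δ.inv_mem hd)
        rwa [mul_inv_cancel_right] at this
    rw [eq_top_iff]
    intro γ _
    obtain ⟨d, hd, x, hx, h1⟩ := hall (γ • v0)
    exact key _ _ _ _ h.v0_mem hx hd h1

end Decomp
end PartSec7
end OutFormal

namespace OutFormal
section PartSec8

/-! ### Classification of the extensions -/
section Classify
variable {Γ P : Type} [Group Γ] [CommGroup P] [Finite P] {π : Γ →* P}

/-- Sections of `π`. -/
def IsSec (π : Γ →* P) (σ : P →* Γ) : Prop := ∀ x, π (σ x) = x

lemma full_section {Q : Subgroup Γ} (h1 : wt π Q = 1) (inj : ∀ g ∈ Q, π g = 1 → g = 1) :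
    ∃ σ : P →* Γ, IsSec π σ ∧ (∀ x, σ x ∈ Q) ∧ ∀ g ∈ Q, σ (π g) = g := by
  have hsur : ∀ x : P, ∃ q ∈ Q, π q = x := by
    intro x
    have : x ∈ Q.map π := by rw [Subgroup.index_eq_one.1 h1]; trivial
    exact this
  choose f hf hf' using hsur
  have hu : ∀ g ∈ Q, ∀ h ∈ Q, π g = π h → g = h := by
    intro g hg h hh he
    have := inj (g * h⁻¹) (Q.mul_mem hg (Q.inv_mem hh)) (by rw [map_mul, map_inv, he, mul_inv_cancel])
    exact mul_inv_eq_one.1 this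
  refine ⟨MonoidHom.mk' f ?_, hf', hf, ?_⟩
  · intro a b
    exact hu _ (hf _) _ (Q.mul_mem (hf _) (hf _)) (by rw [map_mul, hf', hf', hf'])
  · intro g hg
    exact hu _ (hf _) _ hg (hf' _)

/-- Case of the rose. -/
def CaseR (π : Γ →* P) (p : ℕ) : Prop :=
  Nat.card P = p ∧ ∃ (σ : P →* Γ) (x0 : Γ) (y : Fin (p - 2) → Γ), IsSec π σ ∧ π x0 = 1 ∧
    (∀ i, π (y i) = 1) ∧ (∀ i x, y i * σ x = σ x * y i) ∧
    ∀ H : Subgroup Γ, (∀ x, σ x ∈ H) → x0 ∈ H → (∀ i, y i ∈ H) → H = ⊤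

/-- Case of the theta graph. -/
def CaseS (π : Γ →* P) (p : ℕ) : Prop :=
  Nat.card P = p ∧ ∃ (s t : ℕ) (σ σ' : P →* Γ) (a : Fin s → Γ) (c : Fin t → Γ),
    s + t = p - 1 ∧ s ≤ t ∧ IsSec π σ ∧ IsSec π σ' ∧
    (∀ i, π (a i) = 1) ∧ (∀ i, π (c i) = 1) ∧
    (∀ i x, a i * σ x = σ x * a i) ∧ (∀ i x, c i * σ' x = σ' x * c i) ∧
    ∀ H : Subgroup Γ, (∀ x, σ x ∈ H) → (∀ x, σ' x ∈ H) → (∀ i, a i ∈ H) → (∀ i, c i ∈ H) → H = ⊤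

/-- Case of the diagonal. -/
def CaseD (π : Γ →* P) (p : ℕ) : Prop :=
  Nat.card P = p ∧ ∃ (σ σ' σ'' : P →* Γ), IsSec π σ ∧ IsSec π σ' ∧ IsSec π σ'' ∧
    ∀ H : Subgroup Γ, (∀ x, σ x ∈ H) → (∀ x, σ' x ∈ H) → (∀ x, σ'' x ∈ H) → H = ⊤

/-- Case of rank two. -/
def Case2 (π : Γ →* P) (p : ℕ) : Prop :=
  Nat.card P = p ^ 2 ∧ ∃ (A B : Subgroup P) (σ σ' σ'' : P →* Γ), Nat.card A = p ∧ Nat.card B = p ∧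
    A ⊓ B = ⊥ ∧ IsSec π σ ∧ IsSec π σ' ∧ IsSec π σ'' ∧
    (∀ x ∈ A, σ' x = σ x) ∧ (∀ x ∈ B, σ'' x = σ x) ∧
    ∀ H : Subgroup Γ, (∀ x, σ x ∈ H) → (∀ x, σ' x ∈ H) → (∀ x, σ'' x ∈ H) → H = ⊤

lemma num_aux {p q r : ℕ} (hp : p.Prime) (hp3 : 3 < p) (hq : ∃ k, q = p ^ k) (hr : ∃ k, r = p ^ k)
    (hqr : q ∣ r) (hne : q ≠ r) : q + (p - 1) ≤ r ∧ (r ≤ q + 2 * (p - 1) → q = 1 ∧ r = p) := by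
  obtain ⟨j, rfl⟩ := hq
  obtain ⟨i, rfl⟩ := hr
  have hji : j ≤ i := (Nat.pow_dvd_pow_iff_le_right hp.one_lt).1 hqr
  have hji' : j ≠ i := fun h => hne (by rw [h])
  obtain ⟨k, rfl⟩ := Nat.exists_eq_add_of_le hji
  obtain ⟨m, rfl⟩ : ∃ m, k = m + 1 := ⟨k - 1, by omega⟩
  have h1 : 0 < p ^ j := pow_pos hp.pos _
  have h2 : 0 < p ^ m := pow_pos hp.pos _
  have e : p ^ (j + (m + 1)) = p ^ j * p ^ m * p := by ring
  rw [e]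
  obtain ⟨z, rfl⟩ : ∃ z, p = z + 1 := ⟨p - 1, by omega⟩
  simp only [Nat.add_sub_cancel]
  have h5 : (z + 1) ^ j = 1 ∨ z + 1 ≤ (z + 1) ^ j := by
    rcases j with _ | j
    · left; simp
    · right; exact Nat.le_self_pow (by omega) _
  generalize (z + 1) ^ j = q at *
  have hz : 3 ≤ z := by omega
  refine ⟨by nlinarith [mul_pos h1 h2], ?_⟩
  intro h
  rcases m with _ | m
  · simp only [pow_zero, mul_one] at h ⊢
    have : q = 1 := by
      rcases h5 with h5 | h5
      · exact h5
      · nlinarith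
    subst this; simp
  · exfalso
    have h3 : (z + 1) ≤ (z + 1) ^ (m + 1) := Nat.le_self_pow (by omega) _
    nlinarith [Nat.mul_le_mul h1 h3]

lemma wt_ne {Q R : Subgroup Γ} (h : R < Q) (inj : ∀ g ∈ Q, π g = 1 → g = 1) : wt π Q ≠ wt π R := by
  intro he
  unfold wt at he
  have h1 : R.map π ≤ Q.map π := Subgroup.map_mono h.le
  have h2 : R.map π = Q.map π := by
    by_contra hne
    have := Subgroup.index_strictAnti (lt_of_le_of_ne h1 hne)
    omega
  obtain ⟨g, hg, hgR⟩ := SetLike.exists_of_lt h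
  have : π g ∈ R.map π := by rw [h2]; exact ⟨g, hg, rfl⟩
  obtain ⟨r, hr, hrg⟩ := this
  have := inj (g * r⁻¹) (Q.mul_mem hg (Q.inv_mem (h.le hr)))
    (by rw [map_mul, map_inv, hrg, mul_inv_cancel])
  exact hgR (by rw [mul_inv_eq_one.1 this]; exact hr)

/-- correcting an element to the kernel -/
lemma corr (σ σ' : P →* Γ) (hσ : IsSec π σ) (hσ' : IsSec π σ') (τ : Γ)
    (h : ∀ x, τ⁻¹ * σ x * τ = σ' x) :
    ∃ t : Γ, π t = 1 ∧ (∀ x, t * σ' x = σ x * t) ∧ ∃ x, τ = t * σ' x := by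
  refine ⟨τ * (σ' (π τ))⁻¹, ?_, ?_, π τ, by group⟩
  · rw [map_mul, map_inv, hσ', mul_inv_cancel]
  · intro x
    have h1 : (σ' (π τ))⁻¹ * σ' x = σ' x * (σ' (π τ))⁻¹ := by
      rw [← map_inv, ← map_mul, ← map_mul, mul_comm]
    rw [mul_assoc, h1, ← h x]; group

lemma card_one_of_all_one {J : Type} [Fintype J] (w : J → ℕ) (h : ∀ j, w j = 1) (m : ℕ)
    (hs : ∑ j, w j = m) : Fintype.card J = m := by
  rw [← hs]; simp [h]

end Classify
end PartSec8
end OutFormal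

namespace OutFormal
section PartSec9

section Classify2
variable {Γ P : Type} [Group Γ] [CommGroup P] [Finite P] {π : Γ →* P}

lemma central_one (hf : ∀ γ : Γ, (∀ g, γ * g = g * γ) → γ = 1) (γ : Γ)
    (h : Subgroup.centralizer {γ} = ⊤) : γ = 1 := by
  apply hf
  intro g
  have : g ∈ Subgroup.centralizer {γ} := by rw [h]; trivial
  exact (Subgroup.mem_centralizer_singleton_iff.1 this).symm

lemma card_of_triv {p : ℕ} (A : Subgroup P) (hA : A.index = p) (σ : P →* Γ) (hσ : IsSec π σ)
    (h : ∀ x ∈ A, σ x = 1) : Nat.card P = p := by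
  have : A = ⊥ := by
    rw [eq_bot_iff]
    intro x hx
    rw [Subgroup.mem_bot, ← hσ x, h x hx, map_one]
  rw [← hA, this, Subgroup.index_bot]

lemma sec_comm (σ : P →* Γ) (x y : P) : σ x * σ y = σ y * σ x := by
  rw [← map_mul, ← map_mul, mul_comm]

lemma classify0 {p : ℕ} (hp : p.Prime) (hp3 : 3 < p) [Nontrivial P]
    (hf : ∀ γ : Γ, (∀ g, γ * g = g * γ) → γ = 1) (σ : P →* Γ) (hσ : IsSec π σ)
    {J : Type} [Fintype J] (A : J → Subgroup P) (hA : ∀ j, ∃ k, (A j).index = p ^ k) (τ : J → Γ)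
    (h : ∀ j, ∀ x ∈ A j, (τ j)⁻¹ * σ x * τ j = σ x) (hs : ∑ j, (A j).index = 2 * (p - 1))
    (gen : ∀ H : Subgroup Γ, (∀ x, σ x ∈ H) → (∀ j, τ j ∈ H) → H = ⊤) : CaseR π p := by
  classical
  have h' : ∀ j, ∀ x ∈ A j, τ j * σ x = σ x * τ j := by
    intro j x hx
    conv_lhs => rw [← h j x hx]
    group
  by_cases hall : ∀ j, (A j).index = 1
  · exfalso
    have : ∀ x, σ x = 1 := by
      intro x
      refine central_one hf _ (gen _ ?_ ?_)
      · intro y; rw [Subgroup.mem_centralizer_singleton_iff]; exact sec_comm _ _ _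
      · intro j; rw [Subgroup.mem_centralizer_singleton_iff]
        exact h' j x (by rw [Subgroup.index_eq_one.1 (hall j)]; trivial)
    obtain ⟨x, hx⟩ := exists_ne (1 : P)
    exact hx (by rw [← hσ x, this x, map_one])
  push Not at hall
  obtain ⟨j0, hj0⟩ := hall
  have hsum := Fintype.sum_eq_add_sum_subtype_ne (fun j => (A j).index) j0
  rw [hs] at hsum
  have hj0p : (A j0).index = p := by
    obtain ⟨k, hk⟩ := hA j0
    have := (num_aux (q := 1) hp hp3 ⟨0, rfl⟩ ⟨k, hk⟩ (one_dvd _) (Ne.symm hj0)).2 (by omega)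
    exact this.2
  have hone : ∀ j : {j // j ≠ j0}, (A j.1).index = 1 := by
    intro j
    by_contra hne
    obtain ⟨k, hk⟩ := hA j
    have h1 := (num_aux (q := 1) hp hp3 ⟨0, rfl⟩ ⟨k, hk⟩ (one_dvd _) (Ne.symm hne)).1
    have h2 := Finset.single_le_sum (f := fun j : {j // j ≠ j0} => (A j.1).index)
      (fun _ _ => Nat.zero_le _) (Finset.mem_univ j)
    omega
  have hcard : Fintype.card {j // j ≠ j0} = p - 2 :=
    card_one_of_all_one _ hone _ (by omega)
  have hcent : ∀ x ∈ A j0, σ x = 1 := by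
    intro x hx
    refine central_one hf _ (gen _ ?_ ?_)
    · intro y; rw [Subgroup.mem_centralizer_singleton_iff]; exact sec_comm _ _ _
    · intro j; rw [Subgroup.mem_centralizer_singleton_iff]
      by_cases hj : j = j0
      · subst hj; exact h' j x hx
      · exact h' j x (by rw [Subgroup.index_eq_one.1 (hone ⟨j, hj⟩)]; trivial)
  have hyex : ∀ j : {j // j ≠ j0}, ∃ t : Γ, π t = 1 ∧ (∀ x, t * σ x = σ x * t) ∧
      ∃ x, τ j.1 = t * σ x := by
    intro j
    exact corr σ σ hσ hσ (τ j.1) (fun x => h j.1 x (by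
      rw [Subgroup.index_eq_one.1 (hone j)]; trivial))
  choose y hy1 hy2 z hz using hyex
  let e := Fintype.equivFinOfCardEq hcard
  refine ⟨card_of_triv (A j0) hj0p σ hσ hcent, σ, τ j0 * (σ (π (τ j0)))⁻¹, fun i => y (e.symm i), hσ,
    by rw [map_mul, map_inv, hσ, mul_inv_cancel], fun i => hy1 _, fun i x => hy2 _ x, ?_⟩
  intro H h1 h2 h3
  apply gen H h1
  intro j
  by_cases hj : j = j0
  · subst hj
    have := H.mul_mem h2 (h1 (π (τ j)))
    rwa [inv_mul_cancel_right] at this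
  · have h4 := h3 (e ⟨j, hj⟩)
    simp only [Equiv.symm_apply_apply] at h4
    rw [show τ j = _ from hz ⟨j, hj⟩]
    exact H.mul_mem h4 (h1 _)

lemma classify1 {p : ℕ} (hp3 : 3 < p)
    (hf : ∀ γ : Γ, (∀ g, γ * g = g * γ) → γ = 1) (S : Bool → P →* Γ) (hS : ∀ i, IsSec π (S i))
    (A : Subgroup P) (hA : A.index = p) (hagree : ∀ x ∈ A, S true x = S false x)
    {J : Type} [Fintype J] (hJ : Fintype.card J = p - 1) (a b : J → Bool) (τ : J → Γ)
    (h : ∀ j x, (τ j)⁻¹ * S (a j) x * τ j = S (b j) x)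
    (gen : ∀ H : Subgroup Γ, (∀ i x, S i x ∈ H) → (∀ j, τ j ∈ H) → H = ⊤) :
    CaseR π p ∨ CaseS π p := by
  classical
  have hag : ∀ i j, ∀ x ∈ A, S i x = S j x := by
    intro i j x hx
    have := hagree x hx
    cases i <;> cases j <;> simp [this]
  have h' : ∀ j x, τ j * S (b j) x = S (a j) x * τ j := by
    intro j x
    rw [← h j x]; group
  have hcent : ∀ x ∈ A, S false x = 1 := by
    intro x hx
    refine central_one hf _ (gen _ ?_ ?_)
    · intro i y; rw [Subgroup.mem_centralizer_singleton_iff, hag false i x hx]; exact sec_comm _ _ _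
    · intro j; rw [Subgroup.mem_centralizer_singleton_iff]
      have := h' j x
      rwa [hag _ false x hx, hag (a j) false x hx] at this
  have hcardP := card_of_triv A hA _ (hS false) hcent
  have hcor := fun j => corr _ _ (hS (a j)) (hS (b j)) (τ j) (h j)
  choose y hy1 hy2 z hz using hcor
  have gen' : ∀ H : Subgroup Γ, (∀ i x, S i x ∈ H) → (∀ j, y j ∈ H) → H = ⊤ := by
    intro H h1 h2
    refine gen H h1 fun j => ?_
    rw [hz j]; exact H.mul_mem (h2 j) (h1 _ _)
  by_cases hloop : ∀ j, a j = b j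
  · right
    let J0 := {j // a j = false}
    let J1 := {j // ¬ a j = false}
    have hsum : Fintype.card J0 + Fintype.card J1 = p - 1 := by
      rw [← hJ]
      have := Fintype.card_subtype_compl (fun j => a j = false)
      have h2 := Fintype.card_subtype_le (fun j => a j = false)
      show Fintype.card {j // a j = false} + Fintype.card {j // ¬ a j = false} = _
      omega
    let e0 := Fintype.equivFin J0
    let e1 := Fintype.equivFin J1
    have hc0 : ∀ (j : J0) x, y j.1 * S false x = S false x * y j.1 := by
      intro j x
      have := hy2 j.1 x
      rwa [← hloop j.1, j.2] at this
    have hc1 : ∀ (j : J1) x, y j.1 * S true x = S true x * y j.1 := by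
      intro j x
      have := hy2 j.1 x
      rwa [← hloop j.1, Bool.eq_true_of_not_eq_false j.2] at this
    have hgen2 : ∀ H : Subgroup Γ, (∀ x, S false x ∈ H) → (∀ x, S true x ∈ H) →
        (∀ i, y (e0.symm i).1 ∈ H) → (∀ i, y (e1.symm i).1 ∈ H) → H = ⊤ := by
      intro H h1 h2 h3 h4
      refine gen' H ?_ ?_
      · intro i; cases i
        · exact h1
        · exact h2
      · intro j
        by_cases hj : a j = false
        · have := h3 (e0 ⟨j, hj⟩)
          rwa [Equiv.symm_apply_apply] at this
        · have := h4 (e1 ⟨j, hj⟩)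
          rwa [Equiv.symm_apply_apply] at this
    refine ⟨hcardP, ?_⟩
    rcases le_total (Fintype.card J0) (Fintype.card J1) with hle | hle
    · exact ⟨_, _, S false, S true, fun i => y (e0.symm i).1, fun i => y (e1.symm i).1, hsum, hle,
        hS _, hS _, fun i => hy1 _, fun i => hy1 _, fun i x => hc0 _ x, fun i x => hc1 _ x, hgen2⟩
    · exact ⟨_, _, S true, S false, fun i => y (e1.symm i).1, fun i => y (e0.symm i).1,
        by omega, hle, hS _, hS _, fun i => hy1 _, fun i => hy1 _, fun i x => hc1 _ x,
        fun i x => hc0 _ x, fun H h1 h2 h3 h4 => hgen2 H h2 h1 h4 h3⟩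
  · left
    push Not at hloop
    obtain ⟨j0, hj0⟩ := hloop
    -- T conjugates `S true` to `S false`
    obtain ⟨T, hT1, hT2, hT3⟩ : ∃ T : Γ, π T = 1 ∧ (∀ x, T * S true x = S false x * T) ∧
        ∀ H : Subgroup Γ, T ∈ H → y j0 ∈ H := by
      cases ha : a j0 <;> cases hb : b j0
      · rw [ha, hb] at hj0; exact absurd rfl hj0
      · refine ⟨y j0, hy1 _, ?_, fun H h => h⟩
        intro x; have := hy2 j0 x; rwa [ha, hb] at this
      · refine ⟨(y j0)⁻¹, by rw [map_inv, hy1, inv_one], ?_, fun H h => by simpa using H.inv_mem h⟩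
        intro x; have := hy2 j0 x; rw [ha, hb] at this
        rw [inv_mul_eq_iff_eq_mul, ← mul_assoc, this, mul_inv_cancel_right]
      · rw [ha, hb] at hj0; exact absurd rfl hj0
    -- unify
    let U : Bool → Γ := fun i => if i then T else 1
    have hU1 : ∀ i, π (U i) = 1 := by intro i; cases i <;> simp [U, hT1]
    have hU2 : ∀ i x, U i * S i x = S false x * U i := by intro i x; cases i <;> simp [U, hT2]
    have hcard : Fintype.card {j // j ≠ j0} = p - 2 := by
      have h1 := Fintype.card_subtype_compl (fun j => j = j0)
      rw [Fintype.card_subtype_eq, hJ] at h1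
      show Fintype.card {j // ¬ j = j0} = _
      omega
    let e := Fintype.equivFinOfCardEq hcard
    refine ⟨hcardP, S false, T, fun i => U (a (e.symm i).1) * y (e.symm i).1 * (U (b (e.symm i).1))⁻¹,
      hS _, hT1, ?_, ?_, ?_⟩
    · intro i; simp only [map_mul, map_inv, hU1, hy1]; simp
    · intro i x
      beta_reduce
      generalize (e.symm i).1 = j
      have h1 := hU2 (a j) x
      have h2 := hU2 (b j) x
      have h3 := hy2 j x
      have h4 : (U (b j))⁻¹ * S false x = S (b j) x * (U (b j))⁻¹ := by
        rw [inv_mul_eq_iff_eq_mul, ← mul_assoc, h2, mul_inv_cancel_right]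
      calc _ = U (a j) * y j * ((U (b j))⁻¹ * S false x) := by simp only [mul_assoc]
        _ = U (a j) * (y j * S (b j) x) * (U (b j))⁻¹ := by rw [h4]; group
        _ = (U (a j) * S (a j) x) * y j * (U (b j))⁻¹ := by rw [h3]; group
        _ = _ := by rw [h1]; simp only [mul_assoc]
    · intro H h1 h2 h3
      have hUH : ∀ i, U i ∈ H := by
        intro i; cases i
        · simp [U]
        · simpa [U] using h2
      refine gen' H ?_ ?_
      · intro i x
        have : S i x = (U i)⁻¹ * S false x * U i := by
          rw [mul_assoc, ← hU2, inv_mul_cancel_left]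
        rw [this]
        exact H.mul_mem (H.mul_mem (H.inv_mem (hUH i)) (h1 x)) (hUH i)
      · intro j
        by_cases hj : j = j0
        · subst hj; exact hT3 H h2
        · have h4 := h3 (e ⟨j, hj⟩)
          simp only [Equiv.symm_apply_apply] at h4
          have := H.mul_mem (H.mul_mem (H.inv_mem (hUH (a j))) h4) (hUH (b j))
          convert this using 1
          group

lemma classify2 {p : ℕ} (hp : p.Prime) (hexp : ∀ x : P, x ^ p = 1)
    (hf : ∀ γ : Γ, (∀ g, γ * g = g * γ) → γ = 1) (σ σ' σ'' : P →* Γ) (hσ : IsSec π σ)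
    (hσ' : IsSec π σ') (hσ'' : IsSec π σ'')
    (A B : Subgroup P) (hA : A.index = p) (hB : B.index = p) (hA' : ∀ x ∈ A, σ' x = σ x)
    (hB' : ∀ x ∈ B, σ'' x = σ x)
    (gen : ∀ H : Subgroup Γ, (∀ x, σ x ∈ H) → (∀ x, σ' x ∈ H) → (∀ x, σ'' x ∈ H) → H = ⊤) :
    CaseD π p ∨ Case2 π p := by
  have hintr : ∀ x ∈ A ⊓ B, σ x = 1 := by
    intro x hx
    refine central_one hf _ (gen _ ?_ ?_ ?_)
    · intro y; rw [Subgroup.mem_centralizer_singleton_iff]; exact sec_comm _ _ _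
    · intro y; rw [Subgroup.mem_centralizer_singleton_iff, ← hA' x hx.1]; exact sec_comm _ _ _
    · intro y; rw [Subgroup.mem_centralizer_singleton_iff, ← hB' x hx.2]; exact sec_comm _ _ _
  by_cases hAB : A = B
  · left
    subst hAB
    exact ⟨card_of_triv A hA σ hσ (fun x hx => hintr x ⟨hx, hx⟩), σ, σ', σ'', hσ, hσ', hσ'', gen⟩
  · right
    have hbot : A ⊓ B = ⊥ := by
      rw [eq_bot_iff]
      intro x hx
      rw [Subgroup.mem_bot, ← hσ x, hintr x hx, map_one]
    haveI := Fact.mk hp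
    have hP : IsPGroup p P := fun x => ⟨1, by rw [pow_one]; exact hexp x⟩
    obtain ⟨m, hm⟩ := hP.exists_card_eq
    have h1 := A.card_mul_index
    have h2 := B.card_mul_index
    rw [hA, hm] at h1
    rw [hB, hm] at h2
    have hinj : Function.Injective (fun x : A × B => (x.1 * x.2 : P)) := by
      rintro ⟨a, b⟩ ⟨a', b'⟩ h
      simp only at h
      have h3 : (a' : P)⁻¹ * a = b' * (b : P)⁻¹ := by
        rw [inv_mul_eq_iff_eq_mul, ← mul_assoc, ← h, mul_inv_cancel_right]
      have h4 : (a' : P)⁻¹ * a ∈ A ⊓ B :=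
        ⟨A.mul_mem (A.inv_mem a'.2) a.2, by rw [h3]; exact B.mul_mem b'.2 (B.inv_mem b.2)⟩
      rw [hbot, Subgroup.mem_bot] at h4
      rw [h4] at h3
      ext
      · exact (inv_mul_eq_one.1 h4).symm
      · exact (mul_inv_eq_one.1 h3.symm).symm
    have h3 := Nat.card_le_card_of_injective _ hinj
    rw [Nat.card_prod, hm] at h3
    have hp2 := hp.two_le
    rcases m with _ | _ | m
    · exfalso
      simp only [pow_zero] at h1
      have := Nat.eq_one_of_mul_eq_one_left h1
      omega
    · exfalso
      simp only [zero_add, pow_one] at h1 h2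
      have e1 : Nat.card A = 1 := Nat.eq_of_mul_eq_mul_right hp.pos (by rw [h1, one_mul])
      have e2 : Nat.card B = 1 := Nat.eq_of_mul_eq_mul_right hp.pos (by rw [h2, one_mul])
      exact hAB ((Subgroup.card_eq_one.1 e1).trans (Subgroup.card_eq_one.1 e2).symm)
    · have e1 : Nat.card A = p ^ (m + 1) := Nat.eq_of_mul_eq_mul_right hp.pos (by rw [h1, ← pow_succ])
      have e2 : Nat.card B = p ^ (m + 1) := Nat.eq_of_mul_eq_mul_right hp.pos (by rw [h2, ← pow_succ])
      rw [e1, e2, ← pow_add] at h3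
      have := (Nat.pow_le_pow_iff_right hp.one_lt).1 h3
      have hm0 : m = 0 := by omega
      subst hm0
      exact ⟨hm, A, B, σ, σ', σ'', by simpa using e1, by simpa using e2, hbot, hσ, hσ', hσ'', hA', hB', gen⟩

end Classify2
end PartSec9
end OutFormal

namespace OutFormal
section PartSec10

section Classify3
variable {n : ℕ} {Γ P : Type} [Group Γ] [CommGroup P] [Finite P] {π : Γ →* P}

lemma chn_sum {p : ℕ} (hp : p.Prime) (hp3 : 3 < p) (hexp : ∀ x : P, x ^ p = 1) (Q0 : Subgroup Γ)
    (L : List (Subgroup Γ × Subgroup Γ)) (h : Chn Q0 L)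
    (inj : ∀ Q ∈ Q0 :: L.map Prod.fst, ∀ g ∈ Q, π g = 1 → g = 1) :
    (L.map fun x => wt π x.1).sum + L.length * (p - 1) ≤ (L.map fun x => wt π x.2).sum := by
  induction L with
  | nil => simp
  | cons x L ih =>
    obtain ⟨h1, h2, h3⟩ := h
    have := ih h3 (fun Q hQ => inj Q (by
      simp only [List.map_cons, List.mem_cons] at hQ ⊢; tauto))
    have h4 := (num_aux hp hp3 (wt_pow (π := π) hp hexp x.1) (wt_pow (π := π) hp hexp x.2)
      (wt_dvd h1.le) (wt_ne h1 (inj _ (by simp)))).1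
    simp only [List.map_cons, List.sum_cons, List.length_cons]
    linarith [add_mul L.length 1 (p - 1)]

/-- data of a full vertex group -/
lemma full_agree {Q Q' R : Subgroup Γ} {σ σ' : P →* Γ} (hσ : ∀ g ∈ Q, σ (π g) = g)
    (hσ' : ∀ g ∈ Q', σ' (π g) = g) (h : R ≤ Q) (h' : R ≤ Q') : ∀ x ∈ R.map π, σ' x = σ x := by
  rintro x ⟨r, hr, rfl⟩
  rw [hσ r (h hr), hσ' r (h' hr)]

lemma full_conj {Q Q' R : Subgroup Γ} {σ σ' : P →* Γ} (hσ : ∀ g ∈ Q, σ (π g) = g)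
    (hσ' : ∀ g ∈ Q', σ' (π g) = g) (h : R ≤ Q) (τ : Γ) (h' : ∀ g ∈ R, τ⁻¹ * g * τ ∈ Q') :
    ∀ x ∈ R.map π, τ⁻¹ * σ x * τ = σ' x := by
  rintro x ⟨r, hr, rfl⟩
  rw [hσ r (h hr), ← hσ' _ (h' r hr)]
  congr 1
  rw [map_mul, map_mul, map_inv, mul_comm, mul_inv_cancel_left]

theorem deco_classify {p : ℕ} (hp : p.Prime) (hp3 : 3 < p) (hn : n = 2 * (p - 1)) [Nontrivial P]
    (hexp : ∀ x : P, x ^ p = 1) (hf : ∀ γ : Γ, (∀ g, γ * g = g * γ) → γ = 1)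
    {Q0 : Subgroup Γ} {L : List (Subgroup Γ × Subgroup Γ)} {J : Type} [Fintype J]
    {A a b : J → Subgroup Γ} {τ : J → Γ} (D : Deco π n Q0 L J A a b τ) :
    CaseR π p ∨ CaseS π p ∨ CaseD π p ∨ Case2 π p := by
  classical
  have hlen := chn_sum hp hp3 hexp Q0 L D.chain D.inj
  have hcnt := D.cnt
  have gen : ∀ H : Subgroup Γ, (∀ Q ∈ Q0 :: L.map Prod.fst, Q ≤ H) → (∀ j, τ j ∈ H) → H = ⊤ := by
    intro H h1 h2
    rw [eq_top_iff, ← D.gen, Subgroup.closure_le]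
    rintro g (⟨Q, hQ, hg⟩ | ⟨j, rfl⟩)
    · exact h1 Q hQ hg
    · exact h2 j
  obtain ⟨σ0, hσ0, hm0, hu0⟩ := full_section D.wt0 (D.inj Q0 (by simp))
  have hle0 : ∀ {Q : Subgroup Γ} {σ : P →* Γ} {H : Subgroup Γ}, (∀ g ∈ Q, σ (π g) = g) →
      (∀ x, σ x ∈ H) → Q ≤ H := by
    intro Q σ H h1 h2 g hg
    rw [← h1 g hg]; exact h2 _
  rcases L with _ | ⟨x, _ | ⟨y, _ | ⟨z, L⟩⟩⟩
  · left
    have ha : ∀ j, a j = Q0 := fun j => by simpa using D.ha j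
    have hb : ∀ j, b j = Q0 := fun j => by simpa using D.hb j
    refine classify0 hp hp3 hf σ0 hσ0 (fun j => (A j).map π) (fun j => wt_pow hp hexp _) τ ?_ ?_ ?_
    · intro j
      exact full_conj hu0 hu0 ((D.hAa j).trans (ha j).le) (τ j)
        (fun g hg => (hb j) ▸ D.hAb j g hg)
    · simp only [List.map_nil, List.sum_nil, add_zero] at hcnt
      rw [← hn, ← hcnt]; rfl
    · intro H h1 h2
      refine gen H ?_ h2
      intro Q hQ
      rw [show Q = Q0 by simpa using hQ]
      exact hle0 hu0 h1
  · obtain ⟨Q1, R1⟩ := x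
    obtain ⟨hlt, ⟨Q, hQ, hRQ⟩, -⟩ := D.chain
    obtain rfl : Q = Q0 := by simpa using hQ
    simp only [List.map_cons, List.map_nil, List.sum_cons, List.sum_nil, add_zero] at hcnt
    have hnum := num_aux hp hp3 (wt_pow (π := π) hp hexp Q1) (wt_pow (π := π) hp hexp R1)
      (wt_dvd hlt.le) (wt_ne hlt (D.inj _ (by simp)))
    obtain ⟨hq, hr⟩ := hnum.2 (by omega)
    obtain ⟨σ1, hσ1, hm1, hu1⟩ := full_section hq (D.inj Q1 (by simp))
    have hone : ∀ j, wt π (A j) = 1 := by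
      intro j
      by_contra hne
      have h1 := (num_aux (q := 1) hp hp3 ⟨0, rfl⟩ (wt_pow (π := π) hp hexp (A j)) (one_dvd _) (Ne.symm hne)).1
      have h2 := Finset.single_le_sum (f := fun j => wt π (A j))
        (fun _ _ => Nat.zero_le _) (Finset.mem_univ j)
      omega
    have hJ : Fintype.card J = p - 1 := card_one_of_all_one _ hone _ (by omega)
    let S : Bool → P →* Γ := fun i => if i then σ1 else σ0
    let QQ : Bool → Subgroup Γ := fun i => if i then Q1 else Q
    have hQQ : ∀ i, ∀ g ∈ QQ i, S i (π g) = g := by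
      intro i; cases i
      · simpa [QQ, S] using hu0
      · simpa [QQ, S] using hu1
    have hS : ∀ i, IsSec π (S i) := by
      intro i; cases i
      · simpa [S] using hσ0
      · simpa [S] using hσ1
    have ha : ∀ j, ∃ i, a j = QQ i := by
      intro j
      have := D.ha j
      simp only [List.map_cons, List.map_nil, List.mem_cons, List.not_mem_nil, or_false] at this
      rcases this with h | h
      · exact ⟨false, by simpa [QQ] using h⟩
      · exact ⟨true, by simpa [QQ] using h⟩
    have hb : ∀ j, ∃ i, b j = QQ i := by
      intro j
      have := D.hb j
      simp only [List.map_cons, List.map_nil, List.mem_cons, List.not_mem_nil, or_false] at this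
      rcases this with h | h
      · exact ⟨false, by simpa [QQ] using h⟩
      · exact ⟨true, by simpa [QQ] using h⟩
    choose a' ha' using ha
    choose b' hb' using hb
    have := classify1 hp3 hf S hS (R1.map π) hr
      (full_agree (hQQ false) (hQQ true) (by simpa [QQ] using hRQ) (by simpa [QQ] using hlt.le))
      hJ a' b' τ (fun j x => full_conj (hQQ (a' j)) (hQQ (b' j)) (ha' j ▸ D.hAa j) (τ j)
        (fun g hg => hb' j ▸ D.hAb j g hg) x (by rw [Subgroup.index_eq_one.1 (hone j)]; trivial)) (by
        intro H h1 h2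
        refine gen H ?_ h2
        intro Q' hQ'
        simp only [List.map_cons, List.map_nil, List.mem_cons, List.not_mem_nil, or_false] at hQ'
        rcases hQ' with rfl | rfl
        · exact hle0 hu0 (h1 false)
        · exact hle0 hu1 (h1 true))
    tauto
  · obtain ⟨Q2, R2⟩ := x
    obtain ⟨Q1, R1⟩ := y
    obtain ⟨hlt2, ⟨Q, hQ, hRQ⟩, hlt1, ⟨Q', hQ', hRQ'⟩, -⟩ := D.chain
    obtain rfl : Q' = Q0 := by simpa using hQ'
    simp only [List.map_cons, List.map_nil, List.sum_cons, List.sum_nil, add_zero] at hcnt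
    have hnum2 := num_aux hp hp3 (wt_pow (π := π) hp hexp Q2) (wt_pow (π := π) hp hexp R2)
      (wt_dvd hlt2.le) (wt_ne hlt2 (D.inj _ (by simp)))
    have hnum1 := num_aux hp hp3 (wt_pow (π := π) hp hexp Q1) (wt_pow (π := π) hp hexp R1)
      (wt_dvd hlt1.le) (wt_ne hlt1 (D.inj _ (by simp)))
    obtain ⟨hq2, hr2⟩ := hnum2.2 (by omega)
    obtain ⟨hq1, hr1⟩ := hnum1.2 (by omega)
    obtain ⟨σ1, hσ1, hm1, hu1⟩ := full_section hq1 (D.inj Q1 (by simp))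
    obtain ⟨σ2, hσ2, hm2, hu2⟩ := full_section hq2 (D.inj Q2 (by simp))
    have hJ : ∀ j : J, False := by
      intro j
      obtain ⟨k, hk⟩ := wt_pow (π := π) hp hexp (A j)
      have h1 : 0 < wt π (A j) := hk ▸ pow_pos hp.pos _
      have h2 := Finset.single_le_sum (f := fun j => wt π (A j))
        (fun _ _ => Nat.zero_le _) (Finset.mem_univ j)
      omega
    have gen2 : ∀ H : Subgroup Γ, (∀ x, σ0 x ∈ H) → (∀ x, σ1 x ∈ H) → (∀ x, σ2 x ∈ H) → H = ⊤ := by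
      intro H h0 h1 h2
      refine gen H ?_ (fun j => (hJ j).elim)
      intro Q'' hQ''
      simp only [List.map_cons, List.map_nil, List.mem_cons, List.not_mem_nil, or_false] at hQ''
      rcases hQ'' with rfl | rfl | rfl
      · exact hle0 hu0 h0
      · exact hle0 hu2 h2
      · exact hle0 hu1 h1
    simp only [List.map_cons, List.map_nil, List.mem_cons, List.not_mem_nil, or_false] at hQ
    right; right
    rcases hQ with rfl | rfl
    · exact classify2 hp hexp hf σ0 σ1 σ2 hσ0 hσ1 hσ2 (R1.map π) (R2.map π) hr1 hr2
        (full_agree hu0 hu1 hRQ' hlt1.le) (full_agree hu0 hu2 hRQ hlt2.le) gen2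
    · exact classify2 hp hexp hf σ1 σ0 σ2 hσ1 hσ0 hσ2 (R1.map π) (R2.map π) hr1 hr2
        (full_agree hu1 hu0 hlt1.le hRQ') (full_agree hu1 hu2 hRQ hlt2.le)
        (fun H h1 h0 h2 => gen2 H h0 h1 h2)
  · exfalso
    simp only [List.length_cons] at hlen
    have : 3 * (p - 1) ≤ (L.length + 1 + 1 + 1) * (p - 1) := Nat.mul_le_mul_right _ (by omega)
    omega

end Classify3

section Main
variable {n : ℕ} {Γ P : Type} [Group Γ] [CommGroup P] [Finite P]
  {ι : FreeGroup (Fin n) →* Γ} {π : Γ →* P}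

theorem classify_ext {p : ℕ} (hp : p.Prime) (hp3 : 3 < p) (hn : n = 2 * (p - 1)) [Nontrivial P]
    (hι : Function.Injective ι) (hπ : Function.Surjective π)
    (hker : ∀ γ, π γ = 1 ↔ γ ∈ ι.range) (hexp : ∀ x : P, x ^ p = 1)
    (hf : ∀ γ : Γ, (∀ g, γ * g = g * γ) → γ = 1) :
    CaseR π p ∨ CaseS π p ∨ CaseD π p ∨ Case2 π p := by
  obtain ⟨T⟩ := exists_tree (by omega) p (hp.odd_of_ne_two (by omega)) hι hπ hker hexp
  obtain ⟨Q0, L, J, _, A, a, b, τ, D⟩ := exists_deco p hp hp3 hn hι hπ hker hexp T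
  exact deco_classify hp hp3 hn hexp hf D

end Main
end PartSec10
end OutFormal

namespace OutFormal
section PartSec11

/-! ### Free groups are Hopfian -/
section Hopf

lemma resfin {α : Type} (w : FreeGroup α) (hw : w ≠ 1) :
    ∃ (X : Type) (_ : Fintype X) (_ : DecidableEq X) (ρ : FreeGroup α →* Equiv.Perm X), ρ w ≠ 1 := by
  classical
  obtain ⟨L, rfl⟩ : ∃ L, FreeGroup.mk L = w := Quot.exists_rep w
  let XS : Set (FreeGroup α) := FreeGroup.mk '' {L' | L' <:+ L}
  have hfin : XS.Finite := by
    apply Set.Finite.image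
    refine Set.Finite.subset (L.tails.toFinset.finite_toSet) ?_
    intro L' h
    simpa [List.mem_tails] using h
  have : Fintype XS := hfin.fintype
  have hex : ∀ a : α, ∃ f : Equiv.Perm XS, ∀ x : XS, ∀ y : XS, (y : FreeGroup α) = FreeGroup.of a * x →
      f x = y := by
    intro a
    let e : {x : XS // FreeGroup.of a * x ∈ XS} ≃ {x : XS // (FreeGroup.of a)⁻¹ * x ∈ XS} :=
      { toFun := fun x => ⟨⟨_, x.2⟩, by simp⟩
        invFun := fun x => ⟨⟨_, x.2⟩, by simp⟩
        left_inv := fun x => by ext; simp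
        right_inv := fun x => by ext; simp }
    refine ⟨e.extendSubtype, ?_⟩
    intro x y hxy
    have hx : FreeGroup.of a * x ∈ XS := by rw [← hxy]; exact y.2
    rw [Equiv.extendSubtype_apply_of_mem e x hx]
    ext
    exact hxy.symm
  choose f hf using hex
  refine ⟨XS, inferInstance, inferInstance, FreeGroup.lift f, ?_⟩
  have hmem : ∀ L', L' <:+ L → FreeGroup.mk L' ∈ XS := fun L' h => ⟨L', h, rfl⟩
  have key : ∀ L' (h : L' <:+ L), FreeGroup.lift f (FreeGroup.mk L') ⟨1, hmem [] List.nil_suffix⟩ =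
      ⟨FreeGroup.mk L', hmem L' h⟩ := by
    intro L'
    induction L' with
    | nil => intro h; rfl
    | cons x L' ih =>
      intro h
      have h' : L' <:+ L := (List.suffix_cons x L').trans h
      have e1 : FreeGroup.mk (x :: L') = FreeGroup.mk [x] * FreeGroup.mk L' := by
        rw [FreeGroup.mul_mk]; rfl
      have ih' := ih h'
      obtain ⟨a, _ | _⟩ := x
      · have e2 : (FreeGroup.mk [(a, false)] : FreeGroup α) = (FreeGroup.of a)⁻¹ := rfl
        rw [e2] at e1
        have h3 := hf a ⟨FreeGroup.mk ((a, false) :: L'), hmem _ h⟩ ⟨FreeGroup.mk L', hmem L' h'⟩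
          (by
            show FreeGroup.mk L' = FreeGroup.of a * FreeGroup.mk ((a, false) :: L')
            rw [e1]; simp)
        calc FreeGroup.lift f (FreeGroup.mk ((a, false) :: L')) _
            = (f a)⁻¹ (FreeGroup.lift f (FreeGroup.mk L') ⟨1, hmem [] List.nil_suffix⟩) := by
              rw [e1, map_mul, map_inv, FreeGroup.lift_apply_of]; rfl
          _ = _ := by rw [ih', ← h3]; simp
      · have e2 : (FreeGroup.mk [(a, true)] : FreeGroup α) = FreeGroup.of a := rfl
        rw [e2] at e1
        have h3 := hf a ⟨FreeGroup.mk L', hmem L' h'⟩ ⟨FreeGroup.mk ((a, true) :: L'), hmem _ h⟩ e1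
        calc FreeGroup.lift f (FreeGroup.mk ((a, true) :: L')) _
            = (f a) (FreeGroup.lift f (FreeGroup.mk L') ⟨1, hmem [] List.nil_suffix⟩) := by
              rw [e1, map_mul, FreeGroup.lift_apply_of]; rfl
          _ = _ := by rw [ih', ← h3]
  intro h1
  have := key L List.suffix_rfl
  rw [h1] at this
  exact hw (congrArg Subtype.val this).symm

lemma hopf {n : ℕ} (f : FreeGroup (Fin n) →* FreeGroup (Fin n)) (hf : Function.Surjective f) :
    Function.Injective f := by
  rw [injective_iff_map_eq_one]
  intro w hw
  by_contra hne
  obtain ⟨X, _, _, ρ, hρ⟩ := resfin w hne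
  have : Finite (FreeGroup (Fin n) →* Equiv.Perm X) :=
    Finite.of_equiv _ (FreeGroup.lift (α := Fin n) (β := Equiv.Perm X))
  have hinj : Function.Injective (fun r : FreeGroup (Fin n) →* Equiv.Perm X => r.comp f) := by
    intro r r' h
    ext1 i
    obtain ⟨z, hz⟩ := hf (FreeGroup.of i)
    rw [← hz]
    exact DFunLike.congr_fun h z
  obtain ⟨r, hr⟩ := Finite.surjective_of_injective hinj ρ
  apply hρ
  rw [← hr]
  show r (f w) = 1
  rw [hw, map_one]

lemma exists_aut {n : ℕ} {I : Type} (eI : I ≃ Fin n) (g : I → FreeGroup (Fin n))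
    (hg : Subgroup.closure (Set.range g) = ⊤) :
    ∃ Θ : MulAut (FreeGroup (Fin n)), ∀ k, Θ (FreeGroup.of (eI k)) = g k := by
  let f : FreeGroup (Fin n) →* FreeGroup (Fin n) := FreeGroup.lift (fun i => g (eI.symm i))
  have hs : Function.Surjective f := by
    rw [← MonoidHom.range_eq_top, eq_top_iff, ← hg, Subgroup.closure_le]
    rintro _ ⟨k, rfl⟩
    exact ⟨FreeGroup.of (eI k), by simp [f]⟩
  refine ⟨MulEquiv.ofBijective f ⟨hopf f hs, hs⟩, ?_⟩
  intro k
  show f (FreeGroup.of (eI k)) = g k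
  simp [f]

lemma aut_ext {n : ℕ} {I : Type} (eI : I ≃ Fin n) {φ ψ : MulAut (FreeGroup (Fin n))}
    (h : ∀ k, φ (FreeGroup.of (eI k)) = ψ (FreeGroup.of (eI k))) : φ = ψ := by
  have : φ.toMonoidHom = ψ.toMonoidHom := by
    ext1 i
    have := h (eI.symm i)
    rwa [Equiv.apply_symm_apply] at this
  ext x
  exact DFunLike.congr_fun this x

lemma formalGen_eq {n : ℕ} {I : Type} (eI : I ≃ Fin n) (rhs : I → FreeGroup I)
    {φ : MulAut (FreeGroup (Fin n))}
    (h : ∀ k, φ (FreeGroup.of (eI k)) = FreeGroup.freeGroupCongr eI (rhs k)) :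
    formalGen eI rhs = {Out.mk _ φ} := by
  ext x
  constructor
  · rintro ⟨ψ, h1, rfl⟩
    rw [aut_ext eI (fun k => (h1 k).trans (h k).symm)]
    rfl
  · rintro rfl
    exact ⟨φ, h, rfl⟩

lemma conj_formal {n : ℕ} {I : Type} (eI : I ≃ Fin n) (g : I → FreeGroup (Fin n))
    (hg : Subgroup.closure (Set.range g) = ⊤) :
    ∃ θ : OutF n, ∀ (rhs : I → FreeGroup I) (b : MulAut (FreeGroup (Fin n))),
      (∀ k, b (g k) = FreeGroup.lift g (rhs k)) →
      formalGen eI rhs = {θ * Out.mk _ b * θ⁻¹} := by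
  obtain ⟨Θ, hΘ⟩ := exists_aut eI g hg
  refine ⟨Out.mk _ Θ⁻¹, ?_⟩
  intro rhs b hb
  have h2 : ∀ w : FreeGroup I, Θ (FreeGroup.freeGroupCongr eI w) = FreeGroup.lift g w := by
    intro w
    have : (Θ.toMonoidHom.comp (FreeGroup.freeGroupCongr eI).toMonoidHom) = FreeGroup.lift g := by
      ext1 i
      simp [hΘ]
    exact DFunLike.congr_fun this w
  rw [formalGen_eq (φ := Θ⁻¹ * b * Θ) eI rhs, map_mul, map_mul, map_inv, inv_inv]
  intro k
  show Θ⁻¹ (b (Θ (FreeGroup.of (eI k)))) = _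
  rw [hΘ, hb, ← h2, ← MulAut.mul_apply, inv_mul_cancel, MulAut.one_apply]

lemma center_free {n : ℕ} (hn : 2 ≤ n) (f : FreeGroup (Fin n))
    (h : ∀ g, f * g = g * f) : f = 1 := by
  by_contra hne
  obtain ⟨x, L, hx⟩ : ∃ x L, f.toWord = x :: L := by
    cases hw : f.toWord with
    | nil => exact absurd (FreeGroup.toWord_eq_nil_iff.1 hw) hne
    | cons x L => exact ⟨x, L, rfl⟩
  obtain ⟨y, hy⟩ : ∃ y : Fin n, y ≠ x.1 := by
    have : Nontrivial (Fin n) := Fin.nontrivial_iff_two_le.2 hn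
    exact exists_ne _
  have hred : FreeGroup.IsReduced (x :: L) := hx ▸ FreeGroup.isReduced_toWord
  have e1 : (FreeGroup.of y * f).toWord = (y, true) :: x :: L := by
    have : FreeGroup.of y * f = FreeGroup.mk ((y, true) :: x :: L) := by
      rw [← FreeGroup.mk_toWord (x := f), hx]; rfl
    rw [this]
    apply toWord_of_isReduced
    rw [FreeGroup.isReduced_cons_cons]
    exact ⟨fun h => absurd h hy, hred⟩
  have e2 := toWord_mul_of f y hne (by
    rintro rfl
    rw [FreeGroup.toWord_inv, FreeGroup.toWord_of] at hx
    simp [FreeGroup.invRev] at hx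
    exact hy (by rw [← hx.1]))
  rw [h, e1] at e2
  rw [hx] at e2
  simp at e2
  exact hy (by rw [← e2])

end Hopf
end PartSec11
end OutFormal

namespace OutFormal
section PartSec12

/-! ### Recognizing the standard subgroups -/
section Recog

/-- Concrete data attached to a finite abelian subgroup of `Out(F_n)`. -/
structure ExtData (n : ℕ) (Γ P : Type) [Group Γ] [CommGroup P] where
  ι : FreeGroup (Fin n) →* Γ
  π : Γ →* P
  α : Γ →* MulAut (FreeGroup (Fin n))
  j : P →* OutF n
  inj : Function.Injective ι
  ker : ∀ γ, π γ = 1 ↔ γ ∈ ι.range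
  cj : ∀ γ f, γ * ι f * γ⁻¹ = ι (α γ f)
  out : ∀ γ, Out.mk _ (α γ) = j (π γ)

variable {n : ℕ} {Γ P : Type} [Group Γ] [CommGroup P] (D : ExtData n Γ P)

lemma ExtData.pi_iota (f) : D.π (D.ι f) = 1 := (D.ker _).2 ⟨f, rfl⟩

lemma ExtData.gen_of {σ : P →* Γ} (hσ : IsSec D.π σ) (N : Subgroup (FreeGroup (Fin n)))
    (hN : ∀ x, ∀ f ∈ N, D.α (σ x) f ∈ N)
    (hgen : ∀ H : Subgroup Γ, (∀ x, σ x ∈ H) → (∀ f ∈ N, D.ι f ∈ H) → H = ⊤) : N = ⊤ := by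
  let H : Subgroup Γ :=
    { carrier := {γ | ∃ f ∈ N, ∃ x, γ = D.ι f * σ x}
      one_mem' := ⟨1, N.one_mem, 1, by simp⟩
      mul_mem' := by
        rintro _ _ ⟨f, hf, x, rfl⟩ ⟨g, hg, y, rfl⟩
        refine ⟨f * D.α (σ x) g, N.mul_mem hf (hN x g hg), x * y, ?_⟩
        rw [map_mul, ← D.cj, map_mul]; group
      inv_mem' := by
        rintro _ ⟨f, hf, x, rfl⟩
        refine ⟨D.α (σ x⁻¹) f⁻¹, hN _ _ (N.inv_mem hf), x⁻¹, ?_⟩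
        rw [← D.cj, map_inv, map_inv]; group }
  have hH : H = ⊤ := hgen H (fun x => ⟨1, N.one_mem, x, by simp⟩) (fun f hf => ⟨f, hf, 1, by simp⟩)
  rw [eq_top_iff]
  intro f _
  have : D.ι f ∈ H := by rw [hH]; trivial
  obtain ⟨g, hg, x, hx⟩ := this
  have h1 : x = 1 := by
    have := congrArg D.π hx
    rw [map_mul, D.pi_iota, D.pi_iota, hσ, one_mul] at this
    exact this.symm
  rw [h1, map_one, mul_one] at hx
  rw [D.inj hx]; exact hg

lemma ExtData.stable {I : Type} (g : I → FreeGroup (Fin n)) (φ : MulAut (FreeGroup (Fin n)))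
    (h : ∀ i, φ (g i) ∈ Subgroup.closure (Set.range g)) :
    ∀ f ∈ Subgroup.closure (Set.range g), φ f ∈ Subgroup.closure (Set.range g) := by
  have : Subgroup.closure (Set.range g) ≤ (Subgroup.closure (Set.range g)).comap φ.toMonoidHom := by
    rw [Subgroup.closure_le]
    rintro _ ⟨i, rfl⟩
    exact h i
  exact fun f hf => this hf

lemma ExtData.cocycle {σ σ' : P →* Γ} (hσ : IsSec D.π σ) (hσ' : IsSec D.π σ') :
    ∃ V : P → FreeGroup (Fin n), (∀ x, σ x = D.ι (V x) * σ' x) ∧ V 1 = 1 ∧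
      (∀ x y, D.α (σ x) (V y) = V (x * y) * (V x)⁻¹) ∧
      (∀ x c, D.α (σ' x) c = c → D.α (σ x) c = V x * c * (V x)⁻¹) := by
  have h : ∀ x, ∃ f, D.ι f = σ x * (σ' x)⁻¹ := by
    intro x
    exact (D.ker _).1 (by rw [map_mul, map_inv, hσ, hσ', mul_inv_cancel])
  choose V hV using h
  have hV' : ∀ x, σ x = D.ι (V x) * σ' x := fun x => by rw [hV]; group
  refine ⟨V, hV', ?_, ?_, ?_⟩
  · apply D.inj; rw [hV]; simp
  · intro x y
    apply D.inj
    rw [← D.cj, map_mul, map_inv, hV, hV, hV, map_mul, map_mul]; group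
  · intro x c hc
    apply D.inj
    rw [← D.cj, hV', map_mul, map_mul, map_inv]
    conv_rhs => rw [← hc, ← D.cj]
    group

lemma ExtData.lift_ker {γ : Γ} (h : D.π γ = 1) : ∃ f, D.ι f = γ := (D.ker _).1 h

lemma ExtData.fix_of_comm {f : FreeGroup (Fin n)} {γ : Γ} (h : D.ι f * γ = γ * D.ι f) :
    D.α γ f = f := by
  apply D.inj
  rw [← D.cj, ← h]; group

lemma exists_gen {A : Type} [Group A] {p : ℕ} (hp : p.Prime) (h : Nat.card A = p) :
    ∃ x : A, x ^ p = 1 ∧ ∀ y, ∃ m < p, y = x ^ m := by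
  classical
  have := Fact.mk hp
  have hc : IsCyclic A := isCyclic_of_prime_card h
  have hf : Finite A := Nat.finite_of_card_ne_zero (by rw [h]; exact hp.ne_zero)
  obtain ⟨x, hx⟩ := hc.exists_generator
  have ho : orderOf x = p := by rw [orderOf_eq_card_of_forall_mem_zpowers hx, h]
  refine ⟨x, by rw [← ho]; exact pow_orderOf_eq_one x, ?_⟩
  intro y
  have := (mem_powers_iff_mem_range_orderOf (x := x)).1 (mem_powers_iff_mem_zpowers.2 (hx y))
  rw [ho] at this
  simp at this
  obtain ⟨m, h1, h2⟩ := this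
  exact ⟨m, h1, h2.symm⟩

lemma subconj_of {S : Set P} (hS : Subgroup.closure S = ⊤) (j : P →* OutF n) (θ : OutF n)
    (T : Set (OutF n)) (hT : T = (fun x => θ * j x * θ⁻¹) '' S) :
    SubConj j.range (Subgroup.closure T) := by
  refine ⟨θ, ?_⟩
  rw [MonoidHom.range_eq_map, ← hS, MonoidHom.map_closure, MonoidHom.map_closure, hT, Set.image_image]
  rfl

lemma closure_single {A : Type} [Group A] {p : ℕ} {x : A} (h : ∀ y, ∃ m < p, y = x ^ m) :
    Subgroup.closure {x} = ⊤ := by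
  rw [eq_top_iff]
  intro y _
  obtain ⟨m, _, rfl⟩ := h y
  exact Subgroup.pow_mem _ (Subgroup.subset_closure (Set.mem_singleton x)) _

/-- The pattern matching of `rotWord` by a cocycle. -/
lemma rot_lift {K : Type} [Group K] {p : ℕ} (hp : 0 < p - 1) (V : P → K) (x : P) (hx : x ^ p = 1)
    (hV : V 1 = 1) (k : Fin (p - 1)) {I : Type} (g : I → K) (e : Fin (p - 1) → I)
    (hg : ∀ k, g (e k) = V (x ^ ((k : ℕ) + 1))) :
    FreeGroup.lift g (FreeGroup.map e (rotWord p hp k)) = V (x * x ^ ((k : ℕ) + 1)) * (V x)⁻¹ := by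
  unfold rotWord
  have h0 : x * x ^ ((k : ℕ) + 1) = x ^ ((k : ℕ) + 1 + 1) := (pow_succ' _ _).symm
  split_ifs with h
  · simp [hg, h0]
  · have : (k : ℕ) + 1 + 1 = p := by have := k.2; omega
    simp only [map_inv, FreeGroup.map.of, FreeGroup.lift_apply_of, hg, h0, this, hx, hV, one_mul,
      zero_add, pow_one]

lemma ExtData.caseR {p : ℕ} (hp : p.Prime) (hp3 : 3 < p) (D : ExtData (2 * (p - 1)) Γ P)
    (h : CaseR D.π p) : SubConj D.j.range (ERose p (by lia)) := by
  obtain ⟨hc, σ, x0, y, hσ, hx0, hy, hyc, hgen⟩ := h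
  obtain ⟨x, hxp, hx⟩ := exists_gen hp hc
  obtain ⟨x0, rfl⟩ := D.lift_ker hx0
  choose y' hy' using fun i => D.lift_ker (hy i)
  obtain rfl : (fun i => D.ι (y' i)) = y := funext hy'
  let g : Fin p ⊕ Fin (p - 2) → FreeGroup (Fin (2 * (p - 1))) :=
    Sum.elim (fun i => D.α (σ (x ^ (i : ℕ))) x0) y'
  have hm : ∀ z, D.α (σ z) x0 ∈ Subgroup.closure (Set.range g) := by
    intro z
    obtain ⟨m, hm, rfl⟩ := hx z
    exact Subgroup.subset_closure ⟨Sum.inl ⟨m, hm⟩, rfl⟩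
  have hfix : ∀ z i, D.α (σ z) (y' i) = y' i := fun z i => D.fix_of_comm (hyc i z)
  have hN : Subgroup.closure (Set.range g) = ⊤ := by
    apply D.gen_of hσ
    · intro z
      apply ExtData.stable
      rintro (i | i)
      · have : D.α (σ z) (g (Sum.inl i)) = D.α (σ (z * x ^ (i : ℕ))) x0 := by
          rw [map_mul, map_mul]; rfl
        rw [this]; exact hm _
      · have : D.α (σ z) (g (Sum.inr i)) = y' i := hfix z i
        rw [this]; exact Subgroup.subset_closure ⟨Sum.inr i, rfl⟩
    · intro H h1 h2
      apply hgen H h1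
      · have := h2 _ (hm 1)
        simpa using this
      · intro i
        exact h2 _ (Subgroup.subset_closure ⟨Sum.inr i, rfl⟩)
  obtain ⟨θ, hθ⟩ := conj_formal (eRose p (by lia)) g hN
  unfold ERose
  apply subconj_of (closure_single hx) D.j θ
  rw [hθ _ (D.α (σ x)), Set.image_singleton, D.out, hσ]
  rintro (i | i)
  · show D.α (σ x) (D.α (σ (x ^ (i : ℕ))) x0) = FreeGroup.lift g (FreeGroup.of _)
    rw [FreeGroup.lift_apply_of]
    show _ = D.α (σ (x ^ ((finRotate p i : Fin p) : ℕ))) x0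
    have : x ^ ((finRotate p i : Fin p) : ℕ) = x * x ^ (i : ℕ) := by
      obtain ⟨q, rfl⟩ : ∃ q, p = q + 1 := ⟨p - 1, by omega⟩
      by_cases h : i = Fin.last q
      · subst h
        rw [finRotate_last, ← pow_succ', Fin.val_last, hxp]; simp
      · rw [← pow_succ', coe_finRotate_of_ne_last h]
    rw [this, map_mul, map_mul]; rfl
  · show D.α (σ x) (y' i) = FreeGroup.lift g (FreeGroup.of _)
    rw [FreeGroup.lift_apply_of, hfix]; rfl

lemma ExtData.caseS {p : ℕ} (hp : p.Prime) (hp3 : 3 < p) (D : ExtData (2 * (p - 1)) Γ P)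
    (h : CaseS D.π p) : ∃ s, ∃ _hs : 2 * s ≤ p - 1,
      SubConj D.j.range (ETheta p s (by lia) (by lia)) := by
  obtain ⟨hc, s, t, σ, σ', a, c, hst, hle, hσ, hσ', ha, hcc, hac, hcc', hgen⟩ := h
  obtain rfl : t = p - 1 - s := by omega
  refine ⟨s, by omega, ?_⟩
  obtain ⟨x, hxp, hx⟩ := exists_gen hp hc
  choose a' ha' using fun i => D.lift_ker (ha i)
  obtain rfl : (fun i => D.ι (a' i)) = a := funext ha'
  choose c' hc' using fun i => D.lift_ker (hcc i)
  obtain rfl : (fun i => D.ι (c' i)) = c := funext hc'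
  obtain ⟨V, hV, hV1, hVV, hVc⟩ := D.cocycle hσ hσ'
  let g : Fin s ⊕ (Fin (p - 1) ⊕ Fin (p - 1 - s)) → FreeGroup (Fin (2 * (p - 1))) :=
    Sum.elim a' (Sum.elim (fun k => V (x ^ ((k : ℕ) + 1))) c')
  have hm : ∀ z, V z ∈ Subgroup.closure (Set.range g) := by
    intro z
    obtain ⟨m, hm, rfl⟩ := hx z
    rcases m with _ | m
    · rw [pow_zero, hV1]; exact Subgroup.one_mem _
    · exact Subgroup.subset_closure ⟨Sum.inr (Sum.inl ⟨m, by omega⟩), rfl⟩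
  have hfa : ∀ z i, D.α (σ z) (a' i) = a' i := fun z i => D.fix_of_comm (hac i z)
  have hfc : ∀ z i, D.α (σ z) (c' i) = V z * c' i * (V z)⁻¹ :=
    fun z i => hVc _ _ (D.fix_of_comm (hcc' i z))
  have hcm : ∀ i, c' i ∈ Subgroup.closure (Set.range g) :=
    fun i => Subgroup.subset_closure ⟨Sum.inr (Sum.inr i), rfl⟩
  have ham : ∀ i, a' i ∈ Subgroup.closure (Set.range g) :=
    fun i => Subgroup.subset_closure ⟨Sum.inl i, rfl⟩
  have hN : Subgroup.closure (Set.range g) = ⊤ := by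
    apply D.gen_of hσ
    · intro z
      apply ExtData.stable
      rintro (i | i | i)
      · have : D.α (σ z) (g (Sum.inl i)) = a' i := hfa z i
        rw [this]; exact ham i
      · have : D.α (σ z) (g (Sum.inr (Sum.inl i))) = _ := hVV z _
        rw [this]; exact Subgroup.mul_mem _ (hm _) (Subgroup.inv_mem _ (hm _))
      · have : D.α (σ z) (g (Sum.inr (Sum.inr i))) = _ := hfc z i
        rw [this]
        exact Subgroup.mul_mem _ (Subgroup.mul_mem _ (hm _) (hcm i)) (Subgroup.inv_mem _ (hm _))
    · intro H h1 h2
      apply hgen H h1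
      · intro z
        have := H.mul_mem (H.inv_mem (h2 _ (hm z))) (h1 z)
        rwa [hV z, inv_mul_cancel_left] at this
      · exact fun i => h2 _ (ham i)
      · exact fun i => h2 _ (hcm i)
  obtain ⟨θ, hθ⟩ := conj_formal (eTheta p s (by lia) (by lia)) g hN
  unfold ETheta
  apply subconj_of (closure_single hx) D.j θ
  rw [hθ _ (D.α (σ x)), Set.image_singleton, D.out, hσ]
  rintro (i | i | i)
  · show D.α (σ x) (a' i) = FreeGroup.lift g (FreeGroup.of _)
    rw [FreeGroup.lift_apply_of, hfa]; rfl
  · show D.α (σ x) (V _) = FreeGroup.lift g (FreeGroup.map _ (rotWord p _ i))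
    rw [rot_lift _ V x hxp hV1 i g _ (fun k => rfl), hVV]
  · show D.α (σ x) (c' i) = FreeGroup.lift g (FreeGroup.of _ * FreeGroup.of _ * (FreeGroup.of _)⁻¹)
    rw [hfc]
    simp [g]

lemma wedge_gen {p : ℕ} {D : ExtData (2 * (p - 1)) Γ P} {σ σ' σ'' : P →* Γ}
    (hσ : IsSec D.π σ) {V W : P → FreeGroup (Fin (2 * (p - 1)))}
    (hV : ∀ x, σ x = D.ι (V x) * σ' x) (hW : ∀ x, σ x = D.ι (W x) * σ'' x)
    (hVV : ∀ x y, D.α (σ x) (V y) = V (x * y) * (V x)⁻¹)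
    (hWW : ∀ x y, D.α (σ x) (W y) = W (x * y) * (W x)⁻¹)
    (hgen : ∀ H : Subgroup Γ, (∀ x, σ x ∈ H) → (∀ x, σ' x ∈ H) → (∀ x, σ'' x ∈ H) → H = ⊤)
    (x y : P) (g : Fin (p - 1) ⊕ Fin (p - 1) → FreeGroup (Fin (2 * (p - 1))))
    (hg : g = Sum.elim (fun k : Fin (p - 1) => V (x ^ ((k : ℕ) + 1)))
      (fun k : Fin (p - 1) => W (y ^ ((k : ℕ) + 1))))
    (hm : ∀ z, V z ∈ Subgroup.closure (Set.range g))
    (hm' : ∀ z, W z ∈ Subgroup.closure (Set.range g)) :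
    Subgroup.closure (Set.range g) = ⊤ := by
  apply D.gen_of hσ
  · intro z
    apply ExtData.stable
    rintro (i | i)
    · have : D.α (σ z) (g (Sum.inl i)) = V (z * x ^ ((i : ℕ) + 1)) * (V z)⁻¹ := by
        rw [hg]; exact hVV z _
      rw [this]; exact Subgroup.mul_mem _ (hm _) (Subgroup.inv_mem _ (hm _))
    · have : D.α (σ z) (g (Sum.inr i)) = W (z * y ^ ((i : ℕ) + 1)) * (W z)⁻¹ := by
        rw [hg]; exact hWW z _
      rw [this]; exact Subgroup.mul_mem _ (hm' _) (Subgroup.inv_mem _ (hm' _))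
  · intro H h1 h2
    apply hgen H h1
    · intro z
      have := H.mul_mem (H.inv_mem (h2 _ (hm z))) (h1 z)
      rwa [hV z, inv_mul_cancel_left] at this
    · intro z
      have := H.mul_mem (H.inv_mem (h2 _ (hm' z))) (h1 z)
      rwa [hW z, inv_mul_cancel_left] at this

lemma ExtData.caseD {p : ℕ} (hp : p.Prime) (hp3 : 3 < p) (D : ExtData (2 * (p - 1)) Γ P)
    (h : CaseD D.π p) : SubConj D.j.range (EDiag p (by lia)) := by
  obtain ⟨hc, σ, σ', σ'', hσ, hσ', hσ'', hgen⟩ := h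
  obtain ⟨x, hxp, hx⟩ := exists_gen hp hc
  obtain ⟨V, hV, hV1, hVV, -⟩ := D.cocycle hσ hσ'
  obtain ⟨W, hW, hW1, hWW, -⟩ := D.cocycle hσ hσ''
  let g : Fin (p - 1) ⊕ Fin (p - 1) → FreeGroup (Fin (2 * (p - 1))) :=
    Sum.elim (fun k => V (x ^ ((k : ℕ) + 1))) (fun k => W (x ^ ((k : ℕ) + 1)))
  have hm : ∀ z, V z ∈ Subgroup.closure (Set.range g) := by
    intro z
    obtain ⟨m, hm, rfl⟩ := hx z
    rcases m with _ | m
    · rw [pow_zero, hV1]; exact Subgroup.one_mem _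
    · exact Subgroup.subset_closure ⟨Sum.inl ⟨m, by omega⟩, rfl⟩
  have hm' : ∀ z, W z ∈ Subgroup.closure (Set.range g) := by
    intro z
    obtain ⟨m, hm, rfl⟩ := hx z
    rcases m with _ | m
    · rw [pow_zero, hW1]; exact Subgroup.one_mem _
    · exact Subgroup.subset_closure ⟨Sum.inr ⟨m, by omega⟩, rfl⟩
  have hN := wedge_gen hσ hV hW hVV hWW hgen x x g rfl hm hm'
  obtain ⟨θ, hθ⟩ := conj_formal (eWedge p) g hN
  unfold EDiag
  apply subconj_of (closure_single hx) D.j θ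
  rw [hθ _ (D.α (σ x)), Set.image_singleton, D.out, hσ]
  rintro (i | i)
  · show D.α (σ x) (V _) = FreeGroup.lift g (FreeGroup.map _ (rotWord p _ i))
    rw [rot_lift _ V x hxp hV1 i g _ (fun k => rfl), hVV]
  · show D.α (σ x) (W _) = FreeGroup.lift g (FreeGroup.map _ (rotWord p _ i))
    rw [rot_lift _ W x hxp hW1 i g _ (fun k => rfl), hWW]

lemma ExtData.case2 {p : ℕ} (hp : p.Prime) (hp3 : 3 < p) (D : ExtData (2 * (p - 1)) Γ P)
    (h : Case2 D.π p) : SubConj D.j.range (E2 p (by lia)) := by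
  obtain ⟨hc, A, B, σ, σ', σ'', hA, hB, hAB, hσ, hσ', hσ'', hsA, hsB, hgen⟩ := h
  have hfin : Finite P := Nat.finite_of_card_ne_zero (by rw [hc]; exact pow_ne_zero _ hp.ne_zero)
  obtain ⟨⟨a, haA⟩, hap, ha⟩ := exists_gen hp hA
  obtain ⟨⟨b, hbB⟩, hbp, hb⟩ := exists_gen hp hB
  have hap' : a ^ p = 1 := congrArg Subtype.val hap
  have hbp' : b ^ p = 1 := congrArg Subtype.val hbp
  have hdec : ∀ z : P, ∃ k < p, ∃ l < p, z = a ^ k * b ^ l := by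
    intro z
    have hcomp : Subgroup.IsComplement' A B := by
      apply Subgroup.isComplement'_of_card_mul_and_disjoint
      · rw [hA, hB, hc]; ring
      · exact disjoint_iff.2 hAB
    have hz : z ∈ A ⊔ B := by rw [hcomp.sup_eq_top]; trivial
    obtain ⟨u, hu, v, hv, rfl⟩ := Subgroup.mem_sup.1 hz
    obtain ⟨k, hk, hk'⟩ := ha ⟨u, hu⟩
    obtain ⟨l, hl, hl'⟩ := hb ⟨v, hv⟩
    exact ⟨k, hk, l, hl, by rw [show u = a ^ k from congrArg Subtype.val hk',
      show v = b ^ l from congrArg Subtype.val hl']⟩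
  obtain ⟨V, hV, hV1, hVV, -⟩ := D.cocycle hσ hσ'
  obtain ⟨W, hW, hW1, hWW, -⟩ := D.cocycle hσ hσ''
  have hVA : ∀ z ∈ A, V z = 1 := by
    intro z hz
    apply D.inj
    have := hV z
    rw [hsA z hz] at this
    rw [map_one]; exact right_eq_mul.1 this
  have hWB : ∀ z ∈ B, W z = 1 := by
    intro z hz
    apply D.inj
    have := hW z
    rw [hsB z hz] at this
    rw [map_one]; exact right_eq_mul.1 this
  have hVm : ∀ z, ∀ u ∈ A, V (z * u) = V z := by
    intro z u hu
    have := hVV z u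
    rw [hVA u hu, map_one] at this
    exact (mul_inv_eq_one.1 this.symm)
  have hWm : ∀ z, ∀ u ∈ B, W (z * u) = W z := by
    intro z u hu
    have := hWW z u
    rw [hWB u hu, map_one] at this
    exact (mul_inv_eq_one.1 this.symm)
  let g : Fin (p - 1) ⊕ Fin (p - 1) → FreeGroup (Fin (2 * (p - 1))) :=
    Sum.elim (fun k => V (b ^ ((k : ℕ) + 1))) (fun k => W (a ^ ((k : ℕ) + 1)))
  have hm : ∀ z, V z ∈ Subgroup.closure (Set.range g) := by
    intro z
    obtain ⟨k, hk, l, hl, rfl⟩ := hdec z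
    rw [mul_comm (a ^ k), hVm _ _ (A.pow_mem haA k)]
    rcases l with _ | m
    · rw [pow_zero, hV1]; exact Subgroup.one_mem _
    · exact Subgroup.subset_closure ⟨Sum.inl ⟨m, by omega⟩, rfl⟩
  have hm' : ∀ z, W z ∈ Subgroup.closure (Set.range g) := by
    intro z
    obtain ⟨k, hk, l, hl, rfl⟩ := hdec z
    rw [hWm _ _ (B.pow_mem hbB l)]
    rcases k with _ | m
    · rw [pow_zero, hW1]; exact Subgroup.one_mem _
    · exact Subgroup.subset_closure ⟨Sum.inr ⟨m, by omega⟩, rfl⟩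
  have hN := wedge_gen hσ hV hW hVV hWW hgen b a g rfl hm hm'
  obtain ⟨θ, hθ⟩ := conj_formal (eWedge p) g hN
  have hcl : Subgroup.closure {b, a} = (⊤ : Subgroup P) := by
    rw [eq_top_iff]
    intro z _
    obtain ⟨k, _, l, _, rfl⟩ := hdec z
    exact Subgroup.mul_mem _ (Subgroup.pow_mem _ (Subgroup.subset_closure (by simp)) _)
      (Subgroup.pow_mem _ (Subgroup.subset_closure (by simp)) _)
  unfold E2
  apply subconj_of hcl D.j θ
  rw [hθ _ (D.α (σ b)), hθ _ (D.α (σ a)), Set.image_pair, D.out, hσ, D.out, hσ]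
  · rfl
  · rintro (i | i)
    · show D.α (σ a) (V _) = FreeGroup.lift g (FreeGroup.of _)
      rw [FreeGroup.lift_apply_of, hVV, mul_comm a, hVm _ _ haA, hVA a haA]; simp [g]
    · show D.α (σ a) (W _) = FreeGroup.lift g (FreeGroup.map _ (rotWord p _ i))
      rw [rot_lift _ W a hap' hW1 i g _ (fun k => rfl), hWW]
  · rintro (i | i)
    · show D.α (σ b) (V _) = FreeGroup.lift g (FreeGroup.map _ (rotWord p _ i))
      rw [rot_lift _ V b hbp' hV1 i g _ (fun k => rfl), hVV]
    · show D.α (σ b) (W _) = FreeGroup.lift g (FreeGroup.of _)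
      rw [FreeGroup.lift_apply_of, hWW, mul_comm b, hWm _ _ hbB, hWB b hbB]; simp [g]

end Recog
end PartSec12
end OutFormal

namespace OutFormal
section PartSec13

/-! ### Completeness -/
section Complete

lemma conj_aut {K : Type} [Group K] (φ : MulAut K) (f : K) :
    φ * MulAut.conj f * φ⁻¹ = MulAut.conj (φ f) := by
  ext h
  simp [MulAut.mul_apply, MulAut.conj_apply]

lemma out_mk_eq_one {K : Type} [Group K] (φ : MulAut K) :
    Out.mk K φ = 1 ↔ ∃ f, MulAut.conj f = φ :=
  (QuotientGroup.eq_one_iff φ).trans Iff.rfl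

lemma conj_free_inj {n : ℕ} (hn : 2 ≤ n) :
    Function.Injective (MulAut.conj : FreeGroup (Fin n) →* _) := by
  rw [injective_iff_map_eq_one]
  intro f hf
  apply center_free hn
  intro g
  have := DFunLike.congr_fun hf g
  rw [MulAut.conj_apply, MulAut.one_apply] at this
  exact mul_inv_eq_iff_eq_mul.1 this

lemma complete_hom {p : ℕ} (hp : p.Prime) (hp3 : 3 < p) {P : Type} [CommGroup P] [Finite P]
    [Nontrivial P] (hexp : ∀ x : P, x ^ p = 1) (j : P →* OutF (2 * (p - 1)))
    (hj : Function.Injective j) :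
    Nat.card P ≤ p ^ 2 ∧ (SubConj j.range (ERose p (by lia)) ∨
      (∃ s, ∃ _hs : 2 * s ≤ p - 1, SubConj j.range (ETheta p s (by lia) (by lia))) ∨
      SubConj j.range (E2 p (by lia)) ∨
      SubConj j.range (EDiag p (by lia))) := by
  let F := FreeGroup (Fin (2 * (p - 1)))
  have h2 : 2 ≤ 2 * (p - 1) := by omega
  let Γ : Subgroup (MulAut F × P) :=
    ((Out.mk F).comp (MonoidHom.fst _ _)).eqLocus (j.comp (MonoidHom.snd _ _))
  have hΓ : ∀ γ : Γ, Out.mk F γ.1.1 = j γ.1.2 := fun γ => γ.2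
  have hmem : ∀ f : F, ((MulAut.conj f, 1) : MulAut F × P) ∈ Γ := by
    intro f
    show Out.mk F (MulAut.conj f) = j 1
    rw [map_one, out_mk_eq_one]
    exact ⟨f, rfl⟩
  let ι : F →* Γ := MonoidHom.mk' (fun f => ⟨(MulAut.conj f, 1), hmem f⟩) (by
    intro a b
    ext1
    simp)
  let π : Γ →* P := (MonoidHom.snd _ _).comp Γ.subtype
  let α : Γ →* MulAut F := (MonoidHom.fst _ _).comp Γ.subtype
  have hαinj : ∀ γ : Γ, α γ = 1 → γ = 1 := by
    intro γ h
    have h1 : γ.1.1 = 1 := h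
    have := hΓ γ
    rw [h1, map_one] at this
    have h3 : γ.1.2 = 1 := hj (by rw [← this, map_one])
    ext1
    exact Prod.ext h1 h3
  have hαι : ∀ f, α (ι f) = MulAut.conj f := fun f => rfl
  have hιinj : Function.Injective ι := by
    intro a b h
    exact conj_free_inj h2 (by rw [← hαι, ← hαι, h])
  have hker : ∀ γ, π γ = 1 ↔ γ ∈ ι.range := by
    intro γ
    constructor
    · intro h
      have h1 : γ.1.2 = 1 := h
      have := hΓ γ
      rw [h1, map_one, out_mk_eq_one] at this
      obtain ⟨f, hf⟩ := this
      refine ⟨f, ?_⟩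
      ext1
      exact Prod.ext hf h1.symm
    · rintro ⟨f, rfl⟩; rfl
  have hαeq : ∀ γ δ : Γ, α γ = α δ → γ = δ := by
    intro γ δ h
    exact mul_inv_eq_one.1 (hαinj _ (by rw [map_mul, map_inv, h, mul_inv_cancel]))
  have hcj : ∀ γ f, γ * ι f * γ⁻¹ = ι (α γ f) := by
    intro γ f
    apply hαeq
    rw [map_mul, map_mul, map_inv, hαι, hαι, conj_aut]
  have hsur : Function.Surjective π := by
    intro x
    obtain ⟨φ, hφ⟩ := QuotientGroup.mk'_surjective _ (j x)
    exact ⟨⟨(φ, x), hφ⟩, rfl⟩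
  have hcent : ∀ γ : Γ, (∀ g, γ * g = g * γ) → γ = 1 := by
    intro γ h
    apply hαinj
    ext f
    have h1 := hcj γ f
    rw [h, mul_inv_cancel_right] at h1
    exact (hιinj h1).symm
  let D : ExtData (2 * (p - 1)) Γ P := ⟨ι, π, α, j, hιinj, hker, hcj, hΓ⟩
  have := classify_ext (ι := ι) (π := π) hp hp3 rfl hιinj hsur hker hexp hcent
  rcases this with h | h | h | h
  · exact ⟨by rw [h.1]; exact Nat.le_self_pow two_ne_zero _, Or.inl (D.caseR hp hp3 h)⟩
  · exact ⟨by rw [h.1]; exact Nat.le_self_pow two_ne_zero _, Or.inr (Or.inl (D.caseS hp hp3 h))⟩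
  · exact ⟨by rw [h.1]; exact Nat.le_self_pow two_ne_zero _,
      Or.inr (Or.inr (Or.inr (D.caseD hp hp3 h)))⟩
  · exact ⟨h.1.le, Or.inr (Or.inr (Or.inl (D.case2 hp hp3 h)))⟩

/-- A commutative group structure on a commutative subgroup. -/
@[reducible] def subComm {K : Type} [Group K] (P : Subgroup K)
    (h : ∀ a ∈ P, ∀ b ∈ P, a * b = b * a) : CommGroup P :=
  { (inferInstance : Group P) with
    mul_comm := fun a b => Subtype.ext (h a a.2 b b.2) }

lemma complete_fin {p : ℕ} (hp : p.Prime) (hp3 : 3 < p) (P : Subgroup (OutF (2 * (p - 1))))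
    (hP : IsElementaryAbelian p P) (hne : P ≠ ⊥) (hf : Finite P) :
    Nat.card P ≤ p ^ 2 ∧ (SubConj P (ERose p (by lia)) ∨
      (∃ s, ∃ _hs : 2 * s ≤ p - 1, SubConj P (ETheta p s (by lia) (by lia))) ∨
      SubConj P (E2 p (by lia)) ∨
      SubConj P (EDiag p (by lia))) := by
  letI := subComm P hP.1
  have : Nontrivial P := (Subgroup.nontrivial_iff_ne_bot P).2 hne
  have h := complete_hom hp hp3 (P := P) (fun x => Subtype.ext (hP.2 x x.2)) P.subtype
    (Subgroup.subtype_injective P)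
  rw [Subgroup.range_subtype] at h
  exact h

lemma complete_all {p : ℕ} (hp : p.Prime) (hp3 : 3 < p) (P : Subgroup (OutF (2 * (p - 1))))
    (hP : IsElementaryAbelian p P) (hne : P ≠ ⊥) :
    SubConj P (ERose p (by lia)) ∨
      (∃ s, ∃ _hs : 2 * s ≤ p - 1, SubConj P (ETheta p s (by lia) (by lia))) ∨
      SubConj P (E2 p (by lia)) ∨
      SubConj P (EDiag p (by lia)) := by
  by_cases hf : Finite P
  · exact (complete_fin hp hp3 P hP hne hf).2
  exfalso
  rw [not_finite_iff_infinite] at hf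
  obtain ⟨S, hS⟩ := Infinite.exists_subset_card_eq P (p ^ 2 + 1)
  letI := subComm P hP.1
  let T : Subgroup P := Subgroup.closure (S : Set P)
  have hTfg : Group.FG T := (Group.fg_iff_subgroup_fg T).2 ⟨S, rfl⟩
  have hTor : Monoid.IsTorsion T := by
    intro x
    rw [isOfFinOrder_iff_pow_eq_one]
    exact ⟨p, hp.pos, Subtype.ext (Subtype.ext (hP.2 _ x.1.2))⟩
  have hTfin : Finite T := CommGroup.finite_of_fg_torsion T hTor
  let Q : Subgroup (OutF (2 * (p - 1))) := T.map P.subtype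
  have hQP : Q ≤ P := by
    rintro _ ⟨x, _, rfl⟩; exact x.2
  have hQfin : Finite Q := by
    have : (Q : Set (OutF (2 * (p - 1)))).Finite := by
      have h1 : (T : Set P).Finite := hTfin
      exact h1.image _
    exact this
  have hcard : p ^ 2 + 1 ≤ Nat.card Q := by
    have e : Nat.card Q = Nat.card T :=
      (Nat.card_congr (T.equivMapOfInjective P.subtype P.subtype_injective).toEquiv).symm
    rw [e, ← hS]
    have : Nat.card (S : Set P) ≤ Nat.card (T : Set P) :=
      Nat.card_mono hTfin Subgroup.subset_closure
    simpa using this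
  have hQne : Q ≠ ⊥ := by
    intro h
    rw [h, Subgroup.card_bot] at hcard
    have := pow_pos hp.pos 2
    omega
  have := (complete_fin hp hp3 Q ⟨fun a ha b hb => hP.1 a (hQP ha) b (hQP hb),
    fun a ha => hP.2 a (hQP ha)⟩ hQne hQfin).1
  omega

end Complete
end PartSec13
end OutFormal

namespace OutFormal
section PartSec14

/-! ### An invariant of cyclic subgroups -/
section Invar
variable {n : ℕ}

/-- Twisted homomorphisms. -/
def Prs (φ : MulAut (FreeGroup (Fin n))) (K : Type) [Group K] (p : ℕ) : Type :=
  {x : (FreeGroup (Fin n) →* K) × K // x.2 ^ p = 1 ∧ ∀ f, x.1 (φ f) = x.2 * x.1 f * x.2⁻¹}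

variable {K : Type} [Group K]

instance [Finite K] (φ : MulAut (FreeGroup (Fin n))) (p : ℕ) : Finite (Prs φ K p) := by
  have : Finite (FreeGroup (Fin n) →* K) :=
    Finite.of_equiv _ (FreeGroup.lift (α := Fin n) (β := K))
  unfold Prs
  infer_instance

lemma prs_conj_le [Finite K] {p : ℕ} (ψ Θ : MulAut (FreeGroup (Fin n))) :
    Nat.card (Prs ψ K p) ≤ Nat.card (Prs (Θ * ψ * Θ⁻¹) K p) := by
  let F : Prs ψ K p → Prs (Θ * ψ * Θ⁻¹) K p := fun x =>
    ⟨(x.1.1.comp (Θ⁻¹ : MulAut _).toMonoidHom, x.1.2), x.2.1, by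
      intro f
      show x.1.1 (Θ⁻¹ ((Θ * ψ * Θ⁻¹) f)) = x.1.2 * x.1.1 (Θ⁻¹ f) * _
      rw [← x.2.2]
      congr 1
      rw [← MulAut.mul_apply, ← MulAut.mul_apply]
      congr 1
      group⟩
  apply Nat.card_le_card_of_injective F
  intro x y h
  have h' := congrArg Subtype.val h
  have h1 : x.1.1.comp (Θ⁻¹ : MulAut _).toMonoidHom = y.1.1.comp (Θ⁻¹ : MulAut _).toMonoidHom :=
    congrArg (fun z => z.1) h'
  have h2 : x.1.2 = y.1.2 := congrArg (fun z => z.2) h'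
  apply Subtype.ext
  apply Prod.ext _ h2
  ext1 i
  have := DFunLike.congr_fun h1 (Θ (FreeGroup.of i))
  simpa using this

lemma prs_pow_le [Finite K] (hn : 2 ≤ n) {p k : ℕ} (hp : p.Prime) (hk : ¬ p ∣ k)
    (φ : MulAut (FreeGroup (Fin n))) (w : FreeGroup (Fin n)) (hφ : φ ^ p = 1)
    (hψ : (MulAut.conj w * φ ^ k) ^ p = 1) :
    Nat.card (Prs φ K p) ≤ Nat.card (Prs (MulAut.conj w * φ ^ k) K p) := by
  have hpow : ∀ x : Prs φ K p, ∀ (m : ℕ) f,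
      x.1.1 ((φ ^ m) f) = x.1.2 ^ m * x.1.1 f * (x.1.2 ^ m)⁻¹ := by
    intro x m f
    induction m with
    | zero => simp
    | succ m ih =>
      rw [pow_succ', MulAut.mul_apply, x.2.2, ih, pow_succ']; group
  have hind : ∀ m : ℕ, ∃ wm, (MulAut.conj w * φ ^ k) ^ m = MulAut.conj wm * φ ^ (k * m) ∧
      ∀ x : Prs φ K p, (x.1.1 w * x.1.2 ^ k) ^ m = x.1.1 wm * x.1.2 ^ (k * m) := by
    intro m
    induction m with
    | zero => exact ⟨1, by simp, by simp⟩
    | succ m ih =>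
      obtain ⟨wm, h1, h2⟩ := ih
      refine ⟨wm * (φ ^ (k * m)) w, ?_, ?_⟩
      · rw [pow_succ, h1, map_mul, ← conj_aut, Nat.mul_succ, pow_add]; group
      · intro x
        rw [pow_succ, h2, map_mul, hpow, Nat.mul_succ, pow_add]; group
  obtain ⟨wp, h1, h2⟩ := hind p
  have hwp : wp = 1 := by
    apply conj_free_inj hn
    rw [hψ, mul_comm k, pow_mul, hφ, one_pow, mul_one] at h1
    rw [← h1, map_one]
  let F : Prs φ K p → Prs (MulAut.conj w * φ ^ k) K p := fun x =>
    ⟨(x.1.1, x.1.1 w * x.1.2 ^ k), by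
      show (x.1.1 w * x.1.2 ^ k) ^ p = 1
      rw [h2, hwp, map_one, one_mul, mul_comm, pow_mul, x.2.1, one_pow], by
      intro f
      show x.1.1 ((MulAut.conj w * φ ^ k) f) = x.1.1 w * x.1.2 ^ k * x.1.1 f * (x.1.1 w * x.1.2 ^ k)⁻¹
      rw [MulAut.mul_apply, MulAut.conj_apply, map_mul, map_mul, map_inv, hpow]
      group⟩
  apply Nat.card_le_card_of_injective F
  intro x y h
  have h' := congrArg Subtype.val h
  have e1 : x.1.1 = y.1.1 := congrArg (fun z => z.1) h'
  have e2 : x.1.1 w * x.1.2 ^ k = y.1.1 w * y.1.2 ^ k := congrArg (fun z => z.2) h'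
  apply Subtype.ext
  apply Prod.ext e1
  rw [e1] at e2
  have e3 := mul_left_cancel e2
  have hc : Nat.Coprime k p := ((hp.coprime_iff_not_dvd).2 hk).symm
  have aux : ∀ q : K, q ^ p = 1 → q = (q ^ k) ^ (Nat.gcdA k p) := by
    intro q hq
    have hb := Nat.gcd_eq_gcd_ab k p
    rw [hc.gcd_eq_one] at hb
    calc q = q ^ (((1 : ℕ)) : ℤ) := by simp
      _ = q ^ ((k : ℤ) * Nat.gcdA k p + p * Nat.gcdB k p) := by rw [hb]
      _ = _ := by
        rw [zpow_add, zpow_mul, zpow_mul, zpow_natCast, zpow_natCast, hq, one_zpow, mul_one]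
  rw [aux _ x.2.1, aux _ y.2.1, e3]

lemma prs_out_le [Finite K] (hn : 2 ≤ n) {p k : ℕ} (hp : p.Prime) (hk : ¬ p ∣ k)
    {φ φ' : MulAut (FreeGroup (Fin n))} (hφ : φ ^ p = 1) (hφ' : φ' ^ p = 1) (θ : OutF n)
    (h : Out.mk _ φ' = θ * Out.mk _ φ ^ k * θ⁻¹) :
    Nat.card (Prs φ K p) ≤ Nat.card (Prs φ' K p) := by
  obtain ⟨Θ, rfl⟩ : ∃ Θ, Out.mk _ Θ = θ := QuotientGroup.mk'_surjective _ θ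
  have h1 : Out.mk _ (Θ⁻¹ * φ' * Θ * (φ ^ k)⁻¹) = 1 := by
    simp only [map_mul, map_inv, map_pow, h]
    group
  rw [out_mk_eq_one] at h1
  obtain ⟨w, hw⟩ := h1
  have h2 : MulAut.conj w * φ ^ k = Θ⁻¹ * φ' * Θ := by rw [hw]; group
  have h3 : (MulAut.conj w * φ ^ k) ^ p = 1 := by
    rw [h2]
    have := conj_pow (i := p) (a := Θ⁻¹) (b := φ')
    rw [inv_inv] at this
    rw [this, hφ']; simp
  refine (prs_pow_le hn hp hk φ w hφ h3).trans ?_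
  have h4 : φ' = Θ * (MulAut.conj w * φ ^ k) * Θ⁻¹ := by rw [h2]; group
  conv_rhs => rw [h4]
  exact prs_conj_le _ _

lemma mem_cl_pow {G' : Type} [Group G'] {p : ℕ} (hp : p.Prime) {x y : G'} (hx : x ^ p = 1)
    (hy : y ∈ Subgroup.closure {x}) (hy1 : y ≠ 1) : ∃ k : ℕ, ¬ p ∣ k ∧ y = x ^ k := by
  rw [← Subgroup.zpowers_eq_closure] at hy
  have : IsOfFinOrder x := isOfFinOrder_iff_pow_eq_one.2 ⟨p, hp.pos, hx⟩
  obtain ⟨k, hk⟩ := (this.mem_powers_iff_mem_zpowers).2 hy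
  obtain rfl : x ^ k = y := hk
  refine ⟨k, ?_, rfl⟩
  rintro ⟨c, rfl⟩
  apply hy1
  show x ^ (p * c) = 1
  rw [pow_mul, hx, one_pow]

lemma prs_card_eq [Finite K] (hn : 2 ≤ n) {p : ℕ} (hp : p.Prime)
    {φ φ' : MulAut (FreeGroup (Fin n))} (hφ : φ ^ p = 1) (hφ' : φ' ^ p = 1)
    (h1 : Out.mk _ φ ≠ 1) (h1' : Out.mk _ φ' ≠ 1)
    (h : SubConj (Subgroup.closure {Out.mk _ φ}) (Subgroup.closure {Out.mk _ φ'})) :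
    Nat.card (Prs φ K p) = Nat.card (Prs φ' K p) := by
  obtain ⟨g, hg⟩ := h
  have e : (Out.mk _ φ) ^ p = 1 := by rw [← map_pow, hφ, map_one]
  have e' : (Out.mk _ φ') ^ p = 1 := by rw [← map_pow, hφ', map_one]
  apply le_antisymm
  · have : Out.mk _ φ' ∈ Subgroup.closure {Out.mk _ φ'} :=
      Subgroup.subset_closure (Set.mem_singleton _)
    rw [← hg] at this
    obtain ⟨y, hy, hy'⟩ := this
    have hy'' : g * y * g⁻¹ = Out.mk _ φ' := hy'
    have hy1 : y ≠ 1 := by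
      rintro rfl
      apply h1'; rw [← hy'']; simp
    obtain ⟨k, hk, rfl⟩ := mem_cl_pow hp e hy hy1
    exact prs_out_le hn hp hk hφ hφ' g hy''.symm
  · have : g * Out.mk _ φ * g⁻¹ ∈ Subgroup.closure {Out.mk _ φ'} := by
      rw [← hg]
      exact ⟨_, Subgroup.subset_closure (Set.mem_singleton _), rfl⟩
    obtain ⟨k, hk, hk'⟩ := mem_cl_pow hp e' this (by
      intro h; apply h1; rwa [conj_eq_one_iff] at h)
    refine prs_out_le hn hp hk hφ' hφ g⁻¹ ?_
    rw [← hk']; group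

/-- Twisted homomorphisms in coordinates. -/
def prsEquiv {I : Type} (eI : I ≃ Fin n) {rhs : I → FreeGroup I}
    {φ : MulAut (FreeGroup (Fin n))}
    (h : ∀ k, φ (FreeGroup.of (eI k)) = FreeGroup.freeGroupCongr eI (rhs k)) (p : ℕ) :
    Prs φ K p ≃ {x : (I → K) × K // x.2 ^ p = 1 ∧ ∀ k, FreeGroup.lift x.1 (rhs k) =
      x.2 * x.1 k * x.2⁻¹} := by
  have key : ∀ ρ : FreeGroup (Fin n) →* K, ∀ w,
      FreeGroup.lift (fun i => ρ (FreeGroup.of (eI i))) w = ρ (FreeGroup.freeGroupCongr eI w) := by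
    intro ρ w
    have : FreeGroup.lift (fun i => ρ (FreeGroup.of (eI i))) =
        ρ.comp (FreeGroup.freeGroupCongr eI).toMonoidHom := by
      ext1 i; simp
    exact DFunLike.congr_fun this w
  have key2 : ∀ (ρ : FreeGroup (Fin n) →* K) (q : K),
      (∀ f, ρ (φ f) = q * ρ f * q⁻¹) ↔ ∀ k, FreeGroup.lift (fun i => ρ (FreeGroup.of (eI i))) (rhs k) =
      q * ρ (FreeGroup.of (eI k)) * q⁻¹ := by
    intro ρ q
    constructor
    · intro hh k
      rw [key, ← h, hh]
    · intro hh f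
      have : ρ.comp φ.toMonoidHom = (MulAut.conj q).toMonoidHom.comp ρ := by
        ext1 i
        have := hh (eI.symm i)
        rw [key, ← h, Equiv.apply_symm_apply] at this
        exact this
      exact DFunLike.congr_fun this f
  let e0 : (FreeGroup (Fin n) →* K) ≃ (I → K) :=
    (FreeGroup.lift (α := Fin n) (β := K)).symm.trans (Equiv.arrowCongr eI.symm (Equiv.refl K))
  have he0 : ∀ ρ i, e0 ρ i = ρ (FreeGroup.of (eI i)) := by
    intro ρ i
    rfl
  refine (e0.prodCongr (Equiv.refl K)).subtypeEquiv ?_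
  rintro ⟨ρ, q⟩
  have : e0 ρ = fun i => ρ (FreeGroup.of (eI i)) := funext (he0 ρ)
  show _ ↔ q ^ p = 1 ∧ ∀ k, FreeGroup.lift (e0 ρ) (rhs k) = q * e0 ρ k * q⁻¹
  rw [this]
  exact and_congr_right fun _ => key2 ρ q

end Invar
end PartSec14
end OutFormal

namespace OutFormal
section PartSec15

/-! ### The standard automorphisms -/
section Std
variable {n : ℕ}

/-- `φ` is given by the formula `rhs`. -/
def IsFml {I : Type} (eI : I ≃ Fin n) (rhs : I → FreeGroup I)
    (φ : MulAut (FreeGroup (Fin n))) : Prop :=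
  ∀ k, φ (FreeGroup.of (eI k)) = FreeGroup.freeGroupCongr eI (rhs k)

lemma exists_fml {I : Type} (eI : I ≃ Fin n) (rhs : I → FreeGroup I)
    (h : ∀ N : Subgroup (FreeGroup I), (∀ k, rhs k ∈ N) → ∀ k, FreeGroup.of k ∈ N) :
    ∃ φ, IsFml eI rhs φ := by
  refine exists_aut eI (fun k => FreeGroup.freeGroupCongr eI (rhs k)) ?_
  rw [eq_top_iff, ← FreeGroup.closure_range_of, Subgroup.closure_le]
  rintro _ ⟨i, rfl⟩
  have := h ((Subgroup.closure (Set.range fun k => FreeGroup.freeGroupCongr eI (rhs k))).comap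
    (FreeGroup.freeGroupCongr eI).toMonoidHom)
    (fun k => Subgroup.subset_closure ⟨k, rfl⟩) (eI.symm i)
  simpa using this

lemma cov_fml {I A : Type} [Group A] {eI : I ≃ Fin n} {rhs : I → FreeGroup I}
    {φ : MulAut (FreeGroup (Fin n))} (h : IsFml eI rhs φ) (w : I → A) :
    ∃ ρ : FreeGroup (Fin n) →* A, ∀ k, ρ (FreeGroup.of (eI k)) = w k ∧
      ρ (φ (FreeGroup.of (eI k))) = FreeGroup.lift w (rhs k) := by
  refine ⟨(FreeGroup.lift w).comp (FreeGroup.freeGroupCongr eI).symm.toMonoidHom, ?_⟩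
  intro k
  constructor
  · have : FreeGroup.of (eI k) = FreeGroup.freeGroupCongr eI (FreeGroup.of k) := by simp
    rw [this]
    show FreeGroup.lift w ((FreeGroup.freeGroupCongr eI).symm (FreeGroup.freeGroupCongr eI (FreeGroup.of k))) = w k
    rw [MulEquiv.symm_apply_apply, FreeGroup.lift_apply_of]
  · rw [h]
    show FreeGroup.lift w ((FreeGroup.freeGroupCongr eI).symm (FreeGroup.freeGroupCongr eI _)) = _
    rw [MulEquiv.symm_apply_apply]

lemma out_fix {A : Type} [CommGroup A] {φ φ' : MulAut (FreeGroup (Fin n))} {k : ℕ}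
    (h : Out.mk _ φ' = Out.mk _ φ ^ k) (ρ : FreeGroup (Fin n) →* A) (hρ : ∀ f, ρ (φ f) = ρ f) (f) :
    ρ (φ' f) = ρ f := by
  have h1 : Out.mk _ (φ' * (φ ^ k)⁻¹) = 1 := by
    rw [map_mul, map_inv, map_pow, h, mul_inv_cancel]
  rw [out_mk_eq_one] at h1
  obtain ⟨w, hw⟩ := h1
  have h2 : φ' = MulAut.conj w * φ ^ k := by rw [hw]; group
  have h3 : ∀ m : ℕ, ρ ((φ ^ m) f) = ρ f := by
    intro m
    induction m with
    | zero => simp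
    | succ m ih => rw [pow_succ', MulAut.mul_apply, hρ, ih]
  rw [h2, MulAut.mul_apply, MulAut.conj_apply, map_mul, map_mul, map_inv, h3, mul_comm (ρ w),
    mul_inv_cancel_right]

lemma fml_ne_one {I A : Type} [CommGroup A] {eI : I ≃ Fin n} {rhs : I → FreeGroup I}
    {φ : MulAut (FreeGroup (Fin n))} (h : IsFml eI rhs φ) (w : I → A) (k : I)
    (hk : FreeGroup.lift w (rhs k) ≠ w k) : Out.mk _ φ ≠ 1 := by
  intro h1
  obtain ⟨ρ, hρ⟩ := cov_fml h w
  have := out_fix (φ := 1) (φ' := φ) (k := 0) (by rw [h1, pow_zero]) ρ (fun f => rfl)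
    (FreeGroup.of (eI k))
  rw [(hρ k).1, (hρ k).2] at this
  exact hk this

lemma fml_eq {I : Type} {eI : I ≃ Fin n} {rhs : I → FreeGroup I}
    {φ : MulAut (FreeGroup (Fin n))} (h : IsFml eI rhs φ) : formalGen eI rhs = {Out.mk _ φ} :=
  formalGen_eq eI rhs h

/-- The periodic sequence of edge classes. -/
def Uf {M : Type} [Group M] {p : ℕ} (hp : 1 < p) (v : Fin (p - 1) → M) (m : ℕ) : M :=
  if h : m % p = 0 then 1 else v ⟨m % p - 1, by have := Nat.mod_lt m (show 0 < p by omega); omega⟩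

lemma lift_rot {M : Type} [Group M] {p : ℕ} (hp : 1 < p) (v : Fin (p - 1) → M) (k : Fin (p - 1)) :
    FreeGroup.lift v (rotWord p (by lia) k) = Uf hp v (k + 2) * (Uf hp v 1)⁻¹ := by
  have h1 : Uf hp v 1 = v ⟨0, by omega⟩ := by
    unfold Uf
    rw [dif_neg (by rw [Nat.mod_eq_of_lt hp]; omega)]
    congr 2
    rw [Nat.mod_eq_of_lt hp]
  unfold rotWord
  split_ifs with h
  · have h2 : Uf hp v (k + 2) = v ⟨k + 1, h⟩ := by
      unfold Uf
      have h3 : ((k : ℕ) + 2) % p = k + 2 := Nat.mod_eq_of_lt (by lia)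
      rw [dif_neg (by lia)]
      congr 2
      omega
    rw [h1, h2]; simp
  · have h2 : Uf hp v (k + 2) = 1 := by
      unfold Uf
      have h3 : (k : ℕ) + 2 = p := by have := k.2; omega
      rw [dif_pos (by rw [h3]; simp)]
    rw [h1, h2]; simp

lemma Uf_val {M : Type} [Group M] {p : ℕ} (hp : 1 < p) (v : Fin (p - 1) → M) (k : Fin (p - 1)) :
    Uf hp v (k + 1) = v k := by
  unfold Uf
  have h3 : ((k : ℕ) + 1) % p = k + 1 := Nat.mod_eq_of_lt (by have := k.2; omega)
  rw [dif_neg (by lia)]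
  congr 1
  ext
  simp [h3]

lemma Uf_mod {M : Type} [Group M] {p : ℕ} (hp : 1 < p) (v : Fin (p - 1) → M) (m : ℕ) :
    Uf hp v m = Uf hp v (m % p) := by
  unfold Uf; simp

lemma Uf_zero {M : Type} [Group M] {p : ℕ} (hp : 1 < p) (v : Fin (p - 1) → M) :
    Uf hp v 0 = 1 := by unfold Uf; simp

lemma Uf_rot {M : Type} [Group M] {p : ℕ} (hp : 1 < p) (v : Fin (p - 1) → M) (φ : M →* M)
    (h : ∀ k, φ (v k) = FreeGroup.lift v (rotWord p (by lia) k)) (m : ℕ) :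
    φ (Uf hp v m) = Uf hp v (m + 1) * (Uf hp v 1)⁻¹ := by
  have hlt : m % p < p := Nat.mod_lt _ (by lia)
  have e : Uf hp v (m + 1) = Uf hp v (m % p + 1) := by
    rw [Uf_mod, Uf_mod hp v (m % p + 1)]; simp
  rw [Uf_mod, e]
  rcases hm : m % p with _ | j
  · rw [Uf_zero]; simp
  · have h4 : j < p - 1 := by omega
    have := Uf_val hp v ⟨j, h4⟩
    rw [show Uf hp v (j + 1) = _ from this, h, lift_rot]

lemma Uf_pow {p : ℕ} (hp : 1 < p) {M : Type} [Group M] (v : Fin (p - 1) → M) (φ : MulAut M)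
    (h : ∀ k, φ (v k) = FreeGroup.lift v (rotWord p (by lia) k)) (j m : ℕ) :
    (φ ^ j) (Uf hp v m) = Uf hp v (m + j) * (Uf hp v j)⁻¹ := by
  induction j with
  | zero => simp [Uf_zero]
  | succ j ih =>
    have : ∀ m, φ (Uf hp v m) = Uf hp v (m + 1) * (Uf hp v 1)⁻¹ := Uf_rot hp v φ.toMonoidHom h
    rw [pow_succ', MulAut.mul_apply, ih, map_mul, map_inv, this, this]
    simp [add_assoc]

lemma rot_pow_p {p : ℕ} (hp : 1 < p) {M : Type} [Group M] (v : Fin (p - 1) → M) (φ : MulAut M)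
    (h : ∀ k, φ (v k) = FreeGroup.lift v (rotWord p (by lia) k)) (k) :
    (φ ^ p) (v k) = v k := by
  rw [← Uf_val hp v k, Uf_pow hp v φ h, Uf_mod, Uf_mod hp v p]
  simp only [Nat.add_mod_right, Nat.mod_self, Uf_zero, inv_one, mul_one]
  rw [← Uf_mod]

lemma cc_pow_p {p : ℕ} (hp : 1 < p) {M : Type} [Group M] (v : Fin (p - 1) → M) (φ : MulAut M)
    (h : ∀ k, φ (v k) = FreeGroup.lift v (rotWord p (by lia) k)) (c : M)
    (hc : φ c = v ⟨0, by omega⟩ * c * (v ⟨0, by omega⟩)⁻¹) :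
    (φ ^ p) c = c := by
  have h0 : Uf hp v 1 = v ⟨0, by omega⟩ := Uf_val hp v ⟨0, by omega⟩
  rw [← h0] at hc
  have : ∀ j : ℕ, (φ ^ j) c = Uf hp v j * c * (Uf hp v j)⁻¹ := by
    intro j
    induction j with
    | zero => simp [Uf_zero]
    | succ j ih =>
      have : ∀ m, φ (Uf hp v m) = Uf hp v (m + 1) * (Uf hp v 1)⁻¹ := Uf_rot hp v φ.toMonoidHom h
      rw [pow_succ', MulAut.mul_apply, ih, map_mul, map_mul, map_inv, this, hc]
      group
  rw [this, Uf_mod]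
  simp [Uf_zero]

lemma rot_gen {p : ℕ} (hp : 1 < p) {M : Type} [Group M] (v : Fin (p - 1) → M) (N : Subgroup M)
    (h : ∀ k, FreeGroup.lift v (rotWord p (by lia) k) ∈ N) (k) : v k ∈ N := by
  have h1 : Uf hp v 1 ∈ N := by
    have := h ⟨p - 2, by omega⟩
    rw [lift_rot hp] at this
    have e : Uf hp v (((⟨p - 2, by omega⟩ : Fin (p - 1)) : ℕ) + 2) = 1 := by
      rw [show ((⟨p - 2, by omega⟩ : Fin (p - 1)) : ℕ) + 2 = p by simp; omega, Uf_mod]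
      simp [Uf_zero]
    rw [e, one_mul] at this
    exact N.inv_mem_iff.1 this
  have h2 : Uf hp v (k + 1) ∈ N := by
    obtain ⟨k, hk⟩ := k
    rcases k with _ | k
    · exact h1
    · have := h ⟨k, by omega⟩
      rw [lift_rot hp] at this
      have := N.mul_mem this h1
      rwa [inv_mul_cancel_right] at this
  rwa [Uf_val] at h2

lemma lift_map_of {I J : Type} (e : J → I) (w : FreeGroup J) :
    FreeGroup.lift (fun k => FreeGroup.of (e k)) w = FreeGroup.map e w := by
  have : FreeGroup.lift (fun k => FreeGroup.of (e k)) = FreeGroup.map e := by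
    ext1 i; simp
  rw [this]

lemma congr_map {I J : Type} (eI : I ≃ Fin n) (e : J → I) (w : FreeGroup J) :
    FreeGroup.freeGroupCongr eI (FreeGroup.map e w) =
      FreeGroup.lift (fun k => FreeGroup.of (eI (e k))) w := by
  have : (FreeGroup.freeGroupCongr eI).toMonoidHom.comp (FreeGroup.map e) =
      FreeGroup.lift (fun k => FreeGroup.of (eI (e k))) := by
    ext1 i; simp
  exact DFunLike.congr_fun this w

/-- Multiplicative integers. -/
abbrev MZ : Type := Multiplicative ℤ

lemma std_rose {p : ℕ} (hp : p.Prime) (hp3 : 3 < p) :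
    ∃ φ, IsFml (eRose p (by lia)) (rhsRose p) φ ∧ φ ^ p = 1 ∧ Out.mk _ φ ≠ 1 := by
  obtain ⟨φ, hφ⟩ := exists_fml (eRose p (by lia)) (rhsRose p) (by
    rintro N h (k | k)
    · have := h (Sum.inl ((finRotate p).symm k))
      unfold rhsRose at this
      simp only [Equiv.apply_symm_apply] at this
      exact this
    · exact h (Sum.inr k))
  refine ⟨φ, hφ, ?_, ?_⟩
  · apply aut_ext (eRose p (by lia))
    have h1 : ∀ (m : ℕ) i, (φ ^ m) (FreeGroup.of (eRose p (by lia) (Sum.inl i))) =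
        FreeGroup.of (eRose p (by lia) (Sum.inl ((finRotate p ^ m) i))) := by
      intro m i
      induction m with
      | zero => simp
      | succ m ih =>
        rw [pow_succ', MulAut.mul_apply, ih, hφ]
        show FreeGroup.freeGroupCongr _ (FreeGroup.of (Sum.inl (finRotate p _))) = _
        rw [pow_succ', Equiv.Perm.mul_apply]
        simp
    have h2 : ∀ (m : ℕ) i, (φ ^ m) (FreeGroup.of (eRose p (by lia) (Sum.inr i))) =
        FreeGroup.of (eRose p (by lia) (Sum.inr i)) := by
      intro m i
      induction m with
      | zero => simp
      | succ m ih =>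
        rw [pow_succ', MulAut.mul_apply, ih, hφ]
        show FreeGroup.freeGroupCongr _ (FreeGroup.of (Sum.inr i)) = _
        simp
    rintro (i | i)
    · rw [h1]
      have : finRotate p ^ p = 1 := by
        obtain ⟨q, rfl⟩ : ∃ q, p = q + 2 := ⟨p - 2, by omega⟩
        have h5 := (isCycle_finRotate (n := q)).orderOf
        rw [support_finRotate, Finset.card_univ, Fintype.card_fin] at h5
        exact orderOf_dvd_iff_pow_eq_one.1 (by rw [h5])
      rw [this]; rfl
    · rw [h2]; rfl
  · obtain ⟨q, rfl⟩ : ∃ q, p = q + 2 := ⟨p - 2, by omega⟩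
    apply fml_ne_one hφ (A := MZ)
      (Sum.elim (fun i => if i = 0 then Multiplicative.ofAdd 1 else 1) (fun _ => 1)) (Sum.inl 0)
    show FreeGroup.lift _ (FreeGroup.of _) ≠ _
    rw [FreeGroup.lift_apply_of]
    simp
    decide

lemma lift_map' {A I J : Type} [Group A] (w : I → A) (e : J → I) (z : FreeGroup J) :
    FreeGroup.lift w (FreeGroup.map e z) = FreeGroup.lift (fun k => w (e k)) z := by
  have : (FreeGroup.lift w).comp (FreeGroup.map e) = FreeGroup.lift (fun k => w (e k)) := by
    ext1 i; simp
  exact DFunLike.congr_fun this z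

/-- A test covector on the edge classes. -/
def tcov (p : ℕ) (k : Fin (p - 1)) : MZ := if (k : ℕ) = 0 then Multiplicative.ofAdd 1 else 1

lemma tcov_rot {p : ℕ} (hp3 : 3 < p) :
    FreeGroup.lift (tcov p) (rotWord p (by lia) ⟨0, by omega⟩) ≠ tcov p ⟨0, by omega⟩ := by
  unfold rotWord
  rw [dif_pos (by simp; omega)]
  simp only [map_mul, map_inv, FreeGroup.lift_apply_of, tcov]
  simp only [zero_add, one_ne_zero, if_false, if_true]
  decide

lemma std_theta {p s : ℕ} (hp3 : 3 < p) (hs : s ≤ p - 1) :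
    ∃ φ, IsFml (eTheta p s hs (by lia)) (rhsTheta p s (by lia)) φ ∧ φ ^ p = 1 ∧
      Out.mk _ φ ≠ 1 := by
  have hp1 : 1 < p := by omega
  obtain ⟨φ, hφ⟩ := exists_fml (eTheta p s hs (by lia)) (rhsTheta p s (by lia)) (by
    intro N h
    have hu : ∀ k, FreeGroup.of (Sum.inr (Sum.inl k)) ∈ N := by
      refine rot_gen hp1 (fun k => FreeGroup.of (Sum.inr (Sum.inl k))) N ?_
      intro k
      rw [lift_map_of (fun k => Sum.inr (Sum.inl k))]
      exact h (Sum.inr (Sum.inl k))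
    rintro (k | k | k)
    · exact h (Sum.inl k)
    · exact hu k
    · have h1 := h (Sum.inr (Sum.inr k))
      have h2 := N.mul_mem (N.mul_mem (N.inv_mem (hu ⟨0, by omega⟩)) h1) (hu ⟨0, by omega⟩)
      have e : ∀ a b : FreeGroup (Fin s ⊕ (Fin (p - 1) ⊕ Fin (p - 1 - s))),
          a⁻¹ * (a * b * a⁻¹) * a = b := by intro a b; group
      have h3 := e (FreeGroup.of (Sum.inr (Sum.inl ⟨0, by omega⟩))) (FreeGroup.of (Sum.inr (Sum.inr k)))
      rw [← h3]
      exact h2)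
  refine ⟨φ, hφ, ?_, ?_⟩
  · apply aut_ext (eTheta p s hs (by lia))
    have hr : ∀ k, φ (FreeGroup.of (eTheta p s hs (by lia) (Sum.inr (Sum.inl k)))) =
        FreeGroup.lift (fun k => FreeGroup.of (eTheta p s hs (by lia) (Sum.inr (Sum.inl k))))
          (rotWord p (by lia) k) := by
      intro k
      rw [hφ, ← congr_map]; rfl
    rintro (i | i | i)
    · have h1 : φ (FreeGroup.of (eTheta p s hs (by lia) (Sum.inl i))) =
          FreeGroup.of (eTheta p s hs (by lia) (Sum.inl i)) := by
        rw [hφ]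
        show FreeGroup.freeGroupCongr _ (FreeGroup.of (Sum.inl i)) = _
        simp
      have h2 : ∀ m : ℕ, (φ ^ m) (FreeGroup.of (eTheta p s hs (by lia) (Sum.inl i))) =
          FreeGroup.of (eTheta p s hs (by lia) (Sum.inl i)) := by
        intro m
        induction m with
        | zero => simp
        | succ m ih => rw [pow_succ', MulAut.mul_apply, ih, h1]
      rw [h2]; rfl
    · exact rot_pow_p hp1 _ φ hr i
    · apply cc_pow_p hp1 _ φ hr
      rw [hφ]
      show FreeGroup.freeGroupCongr _ (FreeGroup.of _ * FreeGroup.of _ * (FreeGroup.of _)⁻¹) = _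
      simp
  · apply fml_ne_one hφ (A := MZ)
      (Sum.elim (fun _ => 1) (Sum.elim (tcov p) (fun _ => 1))) (Sum.inr (Sum.inl ⟨0, by omega⟩))
    show FreeGroup.lift _ (FreeGroup.map _ (rotWord p _ _)) ≠ _
    rw [lift_map']
    exact tcov_rot hp3

lemma std_wL {p : ℕ} (hp3 : 3 < p) :
    ∃ φ, IsFml (eWedge p) (rhsWedgeL p (by lia)) φ := by
  have hp1 : 1 < p := by omega
  refine exists_fml _ _ ?_
  intro N h
  rintro (k | k)
  · refine rot_gen hp1 (fun k => FreeGroup.of (Sum.inl k)) N ?_ k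
    intro k
    rw [lift_map_of Sum.inl]
    exact h (Sum.inl k)
  · exact h (Sum.inr k)

lemma std_wR {p : ℕ} (hp3 : 3 < p) :
    ∃ φ, IsFml (eWedge p) (rhsWedgeR p (by lia)) φ := by
  have hp1 : 1 < p := by omega
  refine exists_fml _ _ ?_
  intro N h
  rintro (k | k)
  · exact h (Sum.inl k)
  · refine rot_gen hp1 (fun k => FreeGroup.of (Sum.inr k)) N ?_ k
    intro k
    rw [lift_map_of Sum.inr]
    exact h (Sum.inr k)

lemma std_diag {p : ℕ} (hp3 : 3 < p) :
    ∃ φ, IsFml (eWedge p) (rhsWedgeDiag p (by lia)) φ ∧ φ ^ p = 1 ∧ Out.mk _ φ ≠ 1 := by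
  have hp1 : 1 < p := by omega
  obtain ⟨φ, hφ⟩ := exists_fml (eWedge p) (rhsWedgeDiag p (by lia)) (by
    intro N h
    rintro (k | k)
    · refine rot_gen hp1 (fun k => FreeGroup.of (Sum.inl k)) N ?_ k
      intro k
      rw [lift_map_of Sum.inl]
      exact h (Sum.inl k)
    · refine rot_gen hp1 (fun k => FreeGroup.of (Sum.inr k)) N ?_ k
      intro k
      rw [lift_map_of Sum.inr]
      exact h (Sum.inr k))
  refine ⟨φ, hφ, ?_, ?_⟩
  · apply aut_ext (eWedge p)
    rintro (i | i)
    · refine rot_pow_p hp1 (fun k => FreeGroup.of (eWedge p (Sum.inl k))) φ ?_ i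
      intro k
      rw [hφ, ← congr_map]; rfl
    · refine rot_pow_p hp1 (fun k => FreeGroup.of (eWedge p (Sum.inr k))) φ ?_ i
      intro k
      rw [hφ, ← congr_map]; rfl
  · apply fml_ne_one hφ (A := MZ) (Sum.elim (tcov p) (fun _ => 1)) (Sum.inl ⟨0, by omega⟩)
    show FreeGroup.lift _ (FreeGroup.map _ (rotWord p _ _)) ≠ _
    rw [lift_map']
    exact tcov_rot hp3

lemma subconj_symm {G' : Type} [Group G'] {H K : Subgroup G'} (h : SubConj H K) : SubConj K H := by
  obtain ⟨g, rfl⟩ := h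
  refine ⟨g⁻¹, ?_⟩
  rw [Subgroup.map_map]
  convert Subgroup.map_id H
  ext x
  simp
  group

lemma E2_not_cyc {p : ℕ} (hp : p.Prime) (hp3 : 3 < p) (x : OutF (2 * (p - 1))) (hx : x ^ p = 1)
    (h : SubConj (E2 p (by lia)) (Subgroup.closure {x})) : False := by
  obtain ⟨L, hL⟩ := std_wL hp3
  obtain ⟨R, hR⟩ := std_wR hp3
  have hL1 : Out.mk _ L ≠ 1 := by
    apply fml_ne_one hL (A := MZ) (Sum.elim (tcov p) (fun _ => 1)) (Sum.inl ⟨0, by omega⟩)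
    show FreeGroup.lift _ (FreeGroup.map _ (rotWord p _ _)) ≠ _
    rw [lift_map']
    exact tcov_rot hp3
  have hR1 : Out.mk _ R ≠ 1 := by
    apply fml_ne_one hR (A := MZ) (Sum.elim (fun _ => 1) (tcov p)) (Sum.inr ⟨0, by omega⟩)
    show FreeGroup.lift _ (FreeGroup.map _ (rotWord p _ _)) ≠ _
    rw [lift_map']
    exact tcov_rot hp3
  obtain ⟨g, hg⟩ := h
  unfold E2 at hg
  rw [fml_eq hL, fml_eq hR] at hg
  have mL : g * Out.mk _ L * g⁻¹ ∈ Subgroup.closure {x} := by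
    rw [← hg]
    exact ⟨_, Subgroup.subset_closure (Or.inl (Set.mem_singleton _)), rfl⟩
  have mR : g * Out.mk _ R * g⁻¹ ∈ Subgroup.closure {x} := by
    rw [← hg]
    exact ⟨_, Subgroup.subset_closure (Or.inr (Set.mem_singleton _)), rfl⟩
  obtain ⟨i, hi, ei⟩ := mem_cl_pow hp hx mL (by rwa [Ne, conj_eq_one_iff])
  obtain ⟨j, hj, ej⟩ := mem_cl_pow hp hx mR (by rwa [Ne, conj_eq_one_iff])
  obtain ⟨m, -, hm⟩ := Nat.exists_mul_mod_eq_one_of_coprime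
    ((hp.coprime_iff_not_dvd).2 hi).symm hp.one_lt
  have hxm : x = (x ^ i) ^ m := by
    rw [← pow_mul, ← Nat.mod_add_div (i * m) p, hm, pow_add, pow_mul, hx]; simp
  have hRL : Out.mk _ R = Out.mk _ L ^ (m * j) := by
    have h1 : g * Out.mk _ R * g⁻¹ = g * (Out.mk _ L ^ (m * j)) * g⁻¹ := by
      rw [ej, ← conj_pow, ei]
      conv_lhs => rw [hxm]
      rw [pow_mul]
    exact mul_left_cancel (mul_right_cancel h1)
  obtain ⟨ρ, hρ⟩ := cov_fml hL (A := MZ) (Sum.elim (fun _ => 1) (tcov p))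
  have hfixL : ∀ f, ρ (L f) = ρ f := by
    have : ρ.comp L.toMonoidHom = ρ := by
      ext1 i
      obtain ⟨k, rfl⟩ := (eWedge p).surjective i
      show ρ (L _) = _
      rw [(hρ k).1, (hρ k).2]
      rcases k with k | k
      · show FreeGroup.lift _ (FreeGroup.map _ (rotWord p _ _)) = _
        rw [lift_map']
        show FreeGroup.lift (fun _ => (1 : MZ)) _ = 1
        have : FreeGroup.lift (fun _ : Fin (p - 1) => (1 : MZ)) = 1 := by ext1 i; simp
        rw [this]; rfl
      · show FreeGroup.lift _ (FreeGroup.of _) = _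
        rw [FreeGroup.lift_apply_of]
    exact fun f => DFunLike.congr_fun this f
  have hfixR := out_fix hRL ρ hfixL (FreeGroup.of (eWedge p (Sum.inr ⟨0, by omega⟩)))
  rw [(hρ _).1, hR] at hfixR
  have e : ρ (FreeGroup.freeGroupCongr (eWedge p) (rhsWedgeR p (by lia) (Sum.inr ⟨0, by omega⟩))) =
      FreeGroup.lift (tcov p) (rotWord p (by lia) ⟨0, by omega⟩) := by
    show ρ (FreeGroup.freeGroupCongr (eWedge p) (FreeGroup.map _ _)) = _
    rw [congr_map]
    have : ρ.comp (FreeGroup.lift (fun k => FreeGroup.of (eWedge p (Sum.inr k)))) =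
        FreeGroup.lift (tcov p) := by
      ext1 k
      simp [(hρ _).1]
    exact DFunLike.congr_fun this _
  rw [e] at hfixR
  exact tcov_rot hp3 hfixR

end Std
end PartSec15
end OutFormal

namespace OutFormal
section PartSec16

/-! ### Counting -/
section Count
variable {K : Type} [Group K]

lemma Uf_of_sol {p : ℕ} (hp : 1 < p) {v : Fin (p - 1) → K} {q y : K} (hq : q ^ p = 1)
    (hy : y ^ p = 1) (h : ∀ k : Fin (p - 1), v k = q ^ ((k : ℕ) + 1) * y ^ ((k : ℕ) + 1)) (m : ℕ) :
    Uf hp v m = q ^ m * y ^ m := by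
  have hlt : m % p < p := Nat.mod_lt _ (by lia)
  rw [Uf_mod, pow_eq_pow_mod m hq, pow_eq_pow_mod m hy]
  rcases hm : m % p with _ | j
  · rw [Uf_zero]; simp
  · have := Uf_val hp v ⟨j, by omega⟩
    rw [h] at this
    exact this

lemma rot_sol_of {p : ℕ} (hp : 1 < p) {v : Fin (p - 1) → K} {q y : K} (hq : q ^ p = 1)
    (hy : y ^ p = 1) (h : ∀ k : Fin (p - 1), v k = q ^ ((k : ℕ) + 1) * y ^ ((k : ℕ) + 1)) (k) :
    FreeGroup.lift v (rotWord p (by lia) k) = q * v k * q⁻¹ := by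
  rw [lift_rot hp, Uf_of_sol hp hq hy h, Uf_of_sol hp hq hy h, h]
  have e1 : q ^ ((k : ℕ) + 2) = q * q ^ ((k : ℕ) + 1) := pow_succ' _ _
  have e2 : y ^ ((k : ℕ) + 2) = y ^ ((k : ℕ) + 1) * y := pow_succ _ _
  rw [e1, e2]
  group

lemma rot_sol {p : ℕ} (hp : 1 < p) {v : Fin (p - 1) → K} {q : K} (hq : q ^ p = 1)
    (h : ∀ k, FreeGroup.lift v (rotWord p (by lia) k) = q * v k * q⁻¹) :
    (q⁻¹ * v ⟨0, by omega⟩) ^ p = 1 ∧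
    ∀ k : Fin (p - 1), v k = q ^ ((k : ℕ) + 1) * (q⁻¹ * v ⟨0, by omega⟩) ^ ((k : ℕ) + 1) := by
  set y := q⁻¹ * v ⟨0, by omega⟩ with hy
  have hv0 : Uf hp v 1 = q * y := by
    rw [hy, mul_inv_cancel_left]; exact Uf_val hp v ⟨0, by omega⟩
  have key : ∀ m, m ≤ p → Uf hp v m = q ^ m * y ^ m := by
    intro m
    induction m with
    | zero => intro _; rw [Uf_zero]; simp
    | succ m ih =>
      intro hm
      rcases m with _ | m
      · rw [zero_add, hv0, pow_one, pow_one]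
      · have h1 := h ⟨m, by omega⟩
        rw [lift_rot hp, ← Uf_val hp v ⟨m, by omega⟩] at h1
        have ih' : Uf hp v (((⟨m, by omega⟩ : Fin (p - 1)) : ℕ) + 1) = _ := ih (by lia)
        rw [ih', hv0, mul_inv_eq_iff_eq_mul] at h1
        have h2 : Uf hp v (m + 1 + 1) = _ := h1
        rw [h2, pow_succ' q (m + 1), pow_succ y (m + 1)]
        group
  refine ⟨?_, ?_⟩
  · have := key p le_rfl
    rw [Uf_mod, Nat.mod_self, Uf_zero, hq, one_mul] at this
    exact this.symm
  · intro k
    rw [← key _ (by have := k.2; omega), Uf_val]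

/-- Tuples commuting with an element of order dividing `p`. -/
def XX (K : Type) [Group K] (p s : ℕ) : Type :=
  {x : K × (Fin s → K) // x.1 ^ p = 1 ∧ ∀ i, x.2 i * x.1 = x.1 * x.2 i}

/-- Parametrization of the solutions for theta graphs. -/
def thetaEquiv {p s : ℕ} (hp : 1 < p) :
    {x : (Fin s ⊕ (Fin (p - 1) ⊕ Fin (p - 1 - s)) → K) × K // x.2 ^ p = 1 ∧
      ∀ k, FreeGroup.lift x.1 (rhsTheta p s (by lia) k) = x.2 * x.1 k * x.2⁻¹} ≃
    XX K p s × XX K p (p - 1 - s) where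
  toFun x :=
    have hr : ∀ k, FreeGroup.lift (fun k => x.1.1 (Sum.inr (Sum.inl k))) (rotWord p (by lia) k) =
        x.1.2 * x.1.1 (Sum.inr (Sum.inl k)) * x.1.2⁻¹ := by
      intro k
      rw [← lift_map']
      exact x.2.2 (Sum.inr (Sum.inl k))
    (⟨(x.1.2, fun i => x.1.1 (Sum.inl i)), x.2.1, by
      intro i
      have : FreeGroup.lift x.1.1 (FreeGroup.of (Sum.inl i)) = _ := x.2.2 (Sum.inl i)
      rw [FreeGroup.lift_apply_of] at this
      exact eq_mul_inv_iff_mul_eq.1 this⟩,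
     ⟨(x.1.2⁻¹ * x.1.1 (Sum.inr (Sum.inl ⟨0, by omega⟩)), fun i => x.1.1 (Sum.inr (Sum.inr i))),
      (rot_sol hp x.2.1 hr).1, by
      intro i
      have : FreeGroup.lift x.1.1 (FreeGroup.of (Sum.inr (Sum.inl ⟨0, by omega⟩)) *
        FreeGroup.of (Sum.inr (Sum.inr i)) * (FreeGroup.of (Sum.inr (Sum.inl ⟨0, by omega⟩)))⁻¹) = _ :=
        x.2.2 (Sum.inr (Sum.inr i))
      simp only [map_mul, map_inv, FreeGroup.lift_apply_of] at this
      show x.1.1 (Sum.inr (Sum.inr i)) * (x.1.2⁻¹ * x.1.1 (Sum.inr (Sum.inl ⟨0, by omega⟩))) =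
        x.1.2⁻¹ * x.1.1 (Sum.inr (Sum.inl ⟨0, by omega⟩)) * x.1.1 (Sum.inr (Sum.inr i))
      rw [mul_inv_eq_iff_eq_mul] at this
      rw [mul_assoc x.1.2⁻¹, this]
      group⟩)
  invFun z := ⟨(Sum.elim z.1.1.2 (Sum.elim
      (fun k => z.1.1.1 ^ ((k : ℕ) + 1) * z.2.1.1 ^ ((k : ℕ) + 1)) z.2.1.2), z.1.1.1), z.1.2.1, by
    rintro (i | i | i)
    · show FreeGroup.lift _ (FreeGroup.of _) = _
      rw [FreeGroup.lift_apply_of]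
      exact eq_mul_inv_iff_mul_eq.2 (z.1.2.2 i)
    · show FreeGroup.lift _ (FreeGroup.map _ (rotWord p _ _)) = _
      rw [lift_map']
      exact rot_sol_of hp z.1.2.1 z.2.2.1 (fun k => rfl) i
    · show FreeGroup.lift _ (FreeGroup.of _ * FreeGroup.of _ * (FreeGroup.of _)⁻¹) = _
      simp only [map_mul, map_inv, FreeGroup.lift_apply_of, Sum.elim_inr, Sum.elim_inl, zero_add,
        pow_one]
      have := z.2.2.2 i
      rw [mul_inv_rev, mul_assoc (z.1.1.1), ← this]
      group⟩
  left_inv := by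
    rintro ⟨⟨v, q⟩, hq, hv⟩
    have hr : ∀ k, FreeGroup.lift (fun k => v (Sum.inr (Sum.inl k))) (rotWord p (by lia) k) =
        q * v (Sum.inr (Sum.inl k)) * q⁻¹ := by
      intro k
      rw [← lift_map']
      exact hv (Sum.inr (Sum.inl k))
    have h2 := (rot_sol hp hq hr).2
    apply Subtype.ext
    refine Prod.ext ?_ rfl
    funext k
    rcases k with k | k | k
    · rfl
    · exact (h2 k).symm
    · rfl
  right_inv := by
    rintro ⟨⟨⟨q, a⟩, h1, h2⟩, ⟨⟨y, c⟩, h3, h4⟩⟩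
    refine Prod.ext rfl (Subtype.ext (Prod.ext ?_ rfl))
    show q⁻¹ * (q ^ (0 + 1) * y ^ (0 + 1)) = y
    simp

lemma card_theta {p s : ℕ} (hp3 : 3 < p) (hs : s ≤ p - 1) {φ}
    (h : IsFml (eTheta p s hs (by lia)) (rhsTheta p s (by lia)) φ) :
    Nat.card (Prs φ K p) = Nat.card (XX K p s) * Nat.card (XX K p (p - 1 - s)) := by
  rw [Nat.card_congr ((prsEquiv (K := K) _ h p).trans (thetaEquiv (by lia))), Nat.card_prod]

/-- The cyclic group of order `p`. -/
abbrev MP (p : ℕ) : Type := Multiplicative (ZMod p)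

lemma mp_pow {p : ℕ} (x : MP p) : x ^ p = 1 := by
  show Multiplicative.ofAdd (p • Multiplicative.toAdd x) = 1
  simp

lemma card_mp {p : ℕ} : Nat.card (MP p) = p := by
  show Nat.card (ZMod p) = p
  simp

lemma XX_mp {p s : ℕ} : Nat.card (XX (MP p) p s) = p ^ (s + 1) := by
  have e : XX (MP p) p s ≃ MP p × (Fin s → MP p) :=
    Equiv.subtypeUnivEquiv (fun x => ⟨mp_pow _, fun i => mul_comm _ _⟩)
  rw [Nat.card_congr e, Nat.card_prod, Nat.card_fun, card_mp, Nat.card_fin]; ring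

lemma card_rose {p : ℕ} (hp3 : 3 < p) {φ}
    (h : IsFml (eRose p (by lia)) (rhsRose p) φ) :
    Nat.card (Prs φ (MP p) p) = p ^ p := by
  obtain ⟨m, rfl⟩ : ∃ m, p = m + 2 := ⟨p - 2, by omega⟩
  have e : {x : (Fin (m + 2) ⊕ Fin (m + 2 - 2) → MP (m + 2)) × MP (m + 2) // x.2 ^ (m + 2) = 1 ∧
      ∀ k, FreeGroup.lift x.1 (rhsRose (m + 2) k) = x.2 * x.1 k * x.2⁻¹} ≃
      MP (m + 2) × (Fin (m + 2 - 2) → MP (m + 2)) × MP (m + 2) :=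
    { toFun := fun x => (x.1.1 (Sum.inl 0), fun i => x.1.1 (Sum.inr i), x.1.2)
      invFun := fun z => ⟨(Sum.elim (fun _ => z.1) z.2.1, z.2.2), mp_pow _, by
        rintro (i | i)
        · show FreeGroup.lift _ (FreeGroup.of _) = _
          rw [FreeGroup.lift_apply_of, mul_comm, inv_mul_cancel_left]; rfl
        · show FreeGroup.lift _ (FreeGroup.of _) = _
          rw [FreeGroup.lift_apply_of, mul_comm, inv_mul_cancel_left]⟩
      left_inv := by
        rintro ⟨⟨v, q⟩, hq, hv⟩
        apply Subtype.ext
        refine Prod.ext ?_ rfl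
        funext k
        rcases k with k | k
        · show v (Sum.inl 0) = v (Sum.inl k)
          have h1 : ∀ i, v (Sum.inl (finRotate (m + 2) i)) = v (Sum.inl i) := by
            intro i
            have : FreeGroup.lift v (FreeGroup.of _) = _ := hv (Sum.inl i)
            rw [FreeGroup.lift_apply_of, mul_comm, inv_mul_cancel_left] at this
            exact this
          induction k using Fin.induction with
          | zero => rfl
          | succ i ih =>
            rw [ih, ← h1]
            congr 2
            rw [finRotate_apply, Fin.coeSucc_eq_succ]
        · rfl
      right_inv := fun z => rfl }
  rw [Nat.card_congr ((prsEquiv (K := MP (m + 2)) _ h (m + 2)).trans e), Nat.card_prod, Nat.card_prod,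
    Nat.card_fun, card_mp, Nat.card_fin]
  simp only [Nat.add_sub_cancel]
  ring

lemma card_diag {p : ℕ} (hp3 : 3 < p) {φ}
    (h : IsFml (eWedge p) (rhsWedgeDiag p (by lia)) φ) :
    Nat.card (Prs φ (MP p) p) = p ^ 3 := by
  have hp : 1 < p := by omega
  have e : {x : (Fin (p - 1) ⊕ Fin (p - 1) → MP p) × MP p // x.2 ^ p = 1 ∧
      ∀ k, FreeGroup.lift x.1 (rhsWedgeDiag p (by lia) k) = x.2 * x.1 k * x.2⁻¹} ≃
      MP p × MP p × MP p :=
    { toFun := fun x => (x.1.2, x.1.2⁻¹ * x.1.1 (Sum.inl ⟨0, by omega⟩),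
        x.1.2⁻¹ * x.1.1 (Sum.inr ⟨0, by omega⟩))
      invFun := fun z => ⟨(Sum.elim (fun k : Fin (p - 1) => z.1 ^ ((k : ℕ) + 1) * z.2.1 ^ ((k : ℕ) + 1))
          (fun k : Fin (p - 1) => z.1 ^ ((k : ℕ) + 1) * z.2.2 ^ ((k : ℕ) + 1)), z.1), mp_pow _, by
        rintro (i | i)
        · show FreeGroup.lift _ (FreeGroup.map _ (rotWord p _ _)) = _
          rw [lift_map']
          exact rot_sol_of hp (mp_pow _) (mp_pow _) (fun k => rfl) i
        · show FreeGroup.lift _ (FreeGroup.map _ (rotWord p _ _)) = _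
          rw [lift_map']
          exact rot_sol_of hp (mp_pow _) (mp_pow _) (fun k => rfl) i⟩
      left_inv := by
        rintro ⟨⟨v, q⟩, hq, hv⟩
        have hr : ∀ k, FreeGroup.lift (fun k => v (Sum.inl k)) (rotWord p (by lia) k) =
            q * v (Sum.inl k) * q⁻¹ := by
          intro k
          rw [← lift_map']
          exact hv (Sum.inl k)
        have hr' : ∀ k, FreeGroup.lift (fun k => v (Sum.inr k)) (rotWord p (by lia) k) =
            q * v (Sum.inr k) * q⁻¹ := by
          intro k
          rw [← lift_map']
          exact hv (Sum.inr k)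
        apply Subtype.ext
        refine Prod.ext ?_ rfl
        funext k
        rcases k with k | k
        · exact ((rot_sol hp hq hr).2 k).symm
        · exact ((rot_sol hp hq hr').2 k).symm
      right_inv := by
        rintro ⟨q, y, z⟩
        refine Prod.ext rfl (Prod.ext ?_ ?_)
        · show q⁻¹ * (q ^ (0 + 1) * y ^ (0 + 1)) = y
          simp
        · show q⁻¹ * (q ^ (0 + 1) * z ^ (0 + 1)) = z
          simp }
  rw [Nat.card_congr ((prsEquiv (K := MP p) _ h p).trans e), Nat.card_prod, Nat.card_prod, card_mp]
  ring

lemma card_cent_one {p : ℕ} [NeZero p] :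
    Nat.card {a : DihedralGroup p // a * DihedralGroup.r 0 = DihedralGroup.r 0 * a} = 2 * p := by
  rw [← DihedralGroup.nat_card (n := p)]
  apply Nat.card_congr
  apply Equiv.subtypeUnivEquiv
  rintro (x | x) <;> simp

lemma card_cent_ne {p : ℕ} (hp : p.Prime) (hp3 : 3 < p) (i : ZMod p) (hi : i ≠ 0) :
    Nat.card {a : DihedralGroup p // a * DihedralGroup.r i = DihedralGroup.r i * a} = p := by
  have := Fact.mk hp
  have e : {a : DihedralGroup p // a * DihedralGroup.r i = DihedralGroup.r i * a} ≃ ZMod p :=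
    { toFun := fun a => match a.1 with
        | DihedralGroup.r j => j
        | DihedralGroup.sr j => j
      invFun := fun j => ⟨DihedralGroup.r j, by simp [add_comm]⟩
      left_inv := by
        rintro ⟨j | j, hj⟩
        · rfl
        · exfalso
          simp only [DihedralGroup.sr_mul_r, DihedralGroup.r_mul_sr, DihedralGroup.sr.injEq] at hj
          have h2 : (2 : ZMod p) * i = 0 := by linear_combination hj
          rcases mul_eq_zero.1 h2 with h | h
          · have : ((2 : ℕ) : ZMod p) = 0 := by exact_mod_cast h
            rw [ZMod.natCast_eq_zero_iff] at this
            exact absurd (Nat.le_of_dvd (by norm_num) this) (by lia)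
          · exact hi h
      right_inv := fun j => rfl }
  rw [Nat.card_congr e]; simp

lemma XX_dih {p s : ℕ} (hp : p.Prime) (hp3 : 3 < p) :
    Nat.card (XX (DihedralGroup p) p s) = p ^ s * (2 ^ s + (p - 1)) := by
  have := Fact.mk hp
  let e : (Σ i : ZMod p, (Fin s → {a : DihedralGroup p // a * DihedralGroup.r i = DihedralGroup.r i * a}))
      ≃ XX (DihedralGroup p) p s := Equiv.ofBijective
    (fun z => ⟨(DihedralGroup.r z.1, fun i => (z.2 i).1), by
      show DihedralGroup.r z.1 ^ p = 1
      rw [DihedralGroup.r_pow]; simp, fun i => (z.2 i).2⟩) (by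
    constructor
    · rintro ⟨i, a⟩ ⟨j, b⟩ h
      have h' := congrArg Subtype.val h
      have h1 : DihedralGroup.r i = DihedralGroup.r j := congrArg (fun z => z.1) h'
      have h2 : (fun k => (a k).1) = fun k => (b k).1 := congrArg (fun z => z.2) h'
      obtain rfl : i = j := by simpa using h1
      congr 1
      funext k
      exact Subtype.ext (congrFun h2 k)
    · rintro ⟨⟨q, a⟩, hq, ha⟩
      rcases q with i | i
      · exact ⟨⟨i, fun k => ⟨a k, ha k⟩⟩, rfl⟩
      · exfalso
        have hodd : p % 2 = 1 := (hp.eq_two_or_odd).resolve_left (by lia)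
        have h1 : (DihedralGroup.sr i : DihedralGroup p) ^ 2 = 1 := by
          rw [pow_two, DihedralGroup.sr_mul_self]
        have h2 : (DihedralGroup.sr i : DihedralGroup p) ^ p = DihedralGroup.sr i := by
          rw [pow_eq_pow_mod p h1, hodd, pow_one]
        have h3 : (DihedralGroup.sr i : DihedralGroup p) ^ p = 1 := hq
        rw [h2, DihedralGroup.one_def] at h3
        cases h3)
  rw [← Nat.card_congr e, Nat.card_sigma]
  have h1 : ∀ i : ZMod p, Nat.card (Fin s → {a : DihedralGroup p //
      a * DihedralGroup.r i = DihedralGroup.r i * a}) = if i = 0 then (2 * p) ^ s else p ^ s := by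
    intro i
    rw [Nat.card_fun, Nat.card_fin]
    split_ifs with hi
    · subst hi
      rw [card_cent_one]
    · rw [card_cent_ne hp hp3 i hi]
  simp only [h1]
  rw [Finset.sum_ite, Finset.sum_const, Finset.sum_const]
  have h3 : (Finset.univ.filter (fun i : ZMod p => i = 0)).card = 1 := by
    rw [Finset.filter_eq']; simp
  have h4 : (Finset.univ.filter (fun i : ZMod p => ¬ i = 0)).card = p - 1 := by
    rw [Finset.filter_ne', Finset.card_erase_of_mem (Finset.mem_univ _), Finset.card_univ, ZMod.card]
  rw [h3, h4, mul_pow]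
  simp only [smul_eq_mul]
  ring

lemma arith {p s t : ℕ} (hp3 : 3 < p) (hs : 2 * s ≤ p - 1) (ht : 2 * t ≤ p - 1) (hst : s < t)
    (h : p ^ s * (2 ^ s + (p - 1)) * (p ^ (p - 1 - s) * (2 ^ (p - 1 - s) + (p - 1))) =
      p ^ t * (2 ^ t + (p - 1)) * (p ^ (p - 1 - t) * (2 ^ (p - 1 - t) + (p - 1)))) : False := by
  obtain ⟨d, rfl⟩ : ∃ d, t = s + 1 + d := ⟨t - (s + 1), by omega⟩
  obtain ⟨e, he⟩ : ∃ e, p - 1 = 2 * (s + 1 + d) + e := ⟨p - 1 - 2 * (s + 1 + d), by omega⟩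
  have e1 : p - 1 - s = (s + 1 + d) + e + 1 + d := by omega
  have e2 : p - 1 - (s + 1 + d) = (s + 1 + d) + e := by omega
  rw [e1, e2] at h
  have hpos : 0 < p - 1 := by omega
  generalize p - 1 = r at *
  have hP : 0 < p ^ (2 * (s + 1 + d) + e) := pow_pos (by lia) _
  have h2 : (2 ^ s + r) * (2 ^ (s + 1 + d + e + 1 + d) + r) =
      (2 ^ (s + 1 + d) + r) * (2 ^ (s + 1 + d + e) + r) := by
    apply Nat.eq_of_mul_eq_mul_left hP
    calc _ = p ^ s * (2 ^ s + r) * (p ^ (s + 1 + d + e + 1 + d) *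
          (2 ^ (s + 1 + d + e + 1 + d) + r)) := by ring
      _ = _ := h
      _ = _ := by ring
  have h3 : r * (2 ^ s + 2 ^ (s + 1 + d + e + 1 + d)) = r * (2 ^ (s + 1 + d) + 2 ^ (s + 1 + d + e)) := by
    have h4 : 2 ^ s * 2 ^ (s + 1 + d + e + 1 + d) = 2 ^ (s + 1 + d) * 2 ^ (s + 1 + d + e) := by ring
    nlinarith
  have h5 := Nat.eq_of_mul_eq_mul_left hpos h3
  have h6 : 2 ^ (s + 1 + d) ≤ 2 ^ (s + 1 + d + e) := Nat.pow_le_pow_right (by norm_num) (by lia)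
  have h7 : 2 ^ (s + 1 + d + e + 1) ≤ 2 ^ (s + 1 + d + e + 1 + d) :=
    Nat.pow_le_pow_right (by norm_num) (by lia)
  have h8 : 2 ^ (s + 1 + d + e + 1) = 2 * 2 ^ (s + 1 + d + e) := by ring
  have h9 : 0 < 2 ^ s := by positivity
  omega

lemma theta_ne {p s t : ℕ} (hp : p.Prime) (hp3 : 3 < p) (hs : 2 * s ≤ p - 1) (ht : 2 * t ≤ p - 1)
    (hst : s ≠ t)
    (h : SubConj (ETheta p s (by lia) (by lia)) (ETheta p t (by lia) (by lia))) : False := by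
  have := Fact.mk hp
  obtain ⟨φ, h1, h2, h3⟩ := std_theta hp3 (show s ≤ p - 1 by omega)
  obtain ⟨ψ, k1, k2, k3⟩ := std_theta hp3 (show t ≤ p - 1 by omega)
  unfold ETheta at h
  rw [fml_eq h1, fml_eq k1] at h
  have := prs_card_eq (K := DihedralGroup p) (by lia) hp h2 k2 h3 k3 h
  rw [card_theta hp3 _ h1, card_theta hp3 _ k1, XX_dih hp hp3, XX_dih hp hp3, XX_dih hp hp3,
    XX_dih hp hp3] at this
  rcases lt_or_gt_of_ne hst with hlt | hlt
  · exact arith hp3 hs ht hlt this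
  · exact arith hp3 ht hs hlt this.symm

lemma final {p : ℕ} (hp : p.Prime) (hp3 : 3 < p) :
    (∀ s (hs : 2 * s ≤ p - 1),
      ¬ SubConj (ERose p (by lia)) (ETheta p s (by lia) (by lia))) ∧
    ¬ SubConj (ERose p (by lia)) (E2 p (by lia)) ∧
    ¬ SubConj (ERose p (by lia)) (EDiag p (by lia)) ∧
    (∀ s (hs : 2 * s ≤ p - 1),
      ¬ SubConj (ETheta p s (by lia) (by lia)) (E2 p (by lia)) ∧
      ¬ SubConj (ETheta p s (by lia) (by lia)) (EDiag p (by lia))) ∧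
    ¬ SubConj (E2 p (by lia)) (EDiag p (by lia)) := by
  have := Fact.mk hp
  have hn : 2 ≤ 2 * (p - 1) := by omega
  obtain ⟨ρ, r1, r2, r3⟩ := std_rose hp hp3
  obtain ⟨δ, d1, d2, d3⟩ := std_diag hp3
  have er : ERose p (by lia) = Subgroup.closure {Out.mk _ ρ} := by
    unfold ERose; rw [fml_eq r1]
  have ed : EDiag p (by lia) = Subgroup.closure {Out.mk _ δ} := by
    unfold EDiag; rw [fml_eq d1]
  have hpw : ∀ φ : MulAut (FreeGroup (Fin (2 * (p - 1)))), φ ^ p = 1 → (Out.mk _ φ) ^ p = 1 := by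
    intro φ h; rw [← map_pow, h, map_one]
  have cth : ∀ s (hs : s ≤ p - 1) φ, IsFml (eTheta p s hs (by lia)) (rhsTheta p s (by lia)) φ →
      Nat.card (Prs φ (MP p) p) = p ^ (p + 1) := by
    intro s hs φ h
    rw [card_theta hp3 hs h, XX_mp, XX_mp, ← pow_add]
    congr 1; omega
  simp only [er, ed]
  refine ⟨?_, ?_, ?_, ?_, ?_⟩
  · intro s hs h
    obtain ⟨φ, h1, h2, h3⟩ := std_theta hp3 (show s ≤ p - 1 by omega)
    unfold ETheta at h
    rw [fml_eq h1] at h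
    have := prs_card_eq (K := MP p) hn hp r2 h2 r3 h3 h
    rw [card_rose hp3 r1, cth s _ φ h1] at this
    have := Nat.pow_right_injective hp.two_le this
    omega
  · intro h
    exact E2_not_cyc hp hp3 _ (hpw _ r2) (subconj_symm h)
  · intro h
    have := prs_card_eq (K := MP p) hn hp r2 d2 r3 d3 h
    rw [card_rose hp3 r1, card_diag hp3 d1] at this
    have := Nat.pow_right_injective hp.two_le this
    omega
  · intro s hs
    obtain ⟨φ, h1, h2, h3⟩ := std_theta hp3 (show s ≤ p - 1 by omega)
    unfold ETheta
    rw [fml_eq h1]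
    constructor
    · intro h
      exact E2_not_cyc hp hp3 _ (hpw _ h2) (subconj_symm h)
    · intro h
      have := prs_card_eq (K := MP p) hn hp h2 d2 h3 d3 h
      rw [cth s _ φ h1, card_diag hp3 d1] at this
      have := Nat.pow_right_injective hp.two_le this
      omega
  · intro h
    exact E2_not_cyc hp hp3 _ (hpw _ d2) h

end Count
end PartSec16
end OutFormal

namespace OutFormal
open FreeGroup

/-!
STATEMENT 2.  Let `p > 3` be a prime and `n = 2(p-1)`.  The subgroups `E_R`,
`E_{s,p-1-s}` for `0 ≤ s ≤ (p-1)/2`, `E_2` and the diagonal `Δ(E_2)` of `E_2` are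
pairwise non-conjugate in `Out(F_n)`, and every nontrivial elementary abelian
`p`-subgroup of `Out(F_n)` is conjugate to one of them.
-/
theorem statement2 (p : ℕ) (hp : p.Prime) (hp3 : 3 < p) :
    -- pairwise non-conjugacy
    (∀ s (hs : 2 * s ≤ p - 1),
      ¬ SubConj (ERose p (by omega)) (ETheta p s (by omega) (by omega))) ∧
    ¬ SubConj (ERose p (by omega)) (E2 p (by omega)) ∧
    ¬ SubConj (ERose p (by omega)) (EDiag p (by omega)) ∧
    (∀ s t (hs : 2 * s ≤ p - 1) (ht : 2 * t ≤ p - 1), s ≠ t →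
      ¬ SubConj (ETheta p s (by omega) (by omega)) (ETheta p t (by omega) (by omega))) ∧
    (∀ s (hs : 2 * s ≤ p - 1),
      ¬ SubConj (ETheta p s (by omega) (by omega)) (E2 p (by omega)) ∧
      ¬ SubConj (ETheta p s (by omega) (by omega)) (EDiag p (by omega))) ∧
    ¬ SubConj (E2 p (by omega)) (EDiag p (by omega)) ∧
    -- completeness: every nontrivial elementary abelian `p`-subgroup is conjugate
    -- to one of `E_R`, `E_{s,p-1-s}` (`0 ≤ s ≤ (p-1)/2`), `E_2`, `Δ(E_2)`
    (∀ P : Subgroup (OutF (2 * (p - 1))), IsElementaryAbelian p P → P ≠ ⊥ →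
      SubConj P (ERose p (by omega)) ∨
      (∃ s, ∃ _hs : 2 * s ≤ p - 1, SubConj P (ETheta p s (by omega) (by omega))) ∨
      SubConj P (E2 p (by omega)) ∨
      SubConj P (EDiag p (by omega))) := by
  obtain ⟨h1, h2, h3, h4, h5⟩ := final hp hp3
  exact ⟨h1, h2, h3, fun s t hs ht hst h => theta_ne hp hp3 hs ht hst h, h4, h5,
    fun P hP hne => complete_all hp hp3 P hP hne⟩

end OutFormal
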